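/- arXiv:1705.09946 — 3 statements merged into one kernel-verified Lean document; each statement's English description precedes it below -/
import Mathlib

section
/- Let I = I(Z) for a fat point subscheme Z ⊆ ℙ^N. For all integers r, s ≥ 1, I^{(r(s+N−1))} ⊆ (I^{(s)})^r. In particular (taking s = 1), I^{(m)} ⊆ I^r whenever m ≥ rN. -/
open MvPolynomial

noncomputable section

/-- The ideal of polynomials vanishing on the affine cone over the projective point
with homogeneous coordinate vector `p` (i.e. all forms whose homogeneous components
vanish at `p`, for an infinite field). -/
def coneIdeal (K : Type*) [Field K] {n : ℕ} (p : Fin n → K) :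
    Ideal (MvPolynomial (Fin n) K) where
  carrier := {f | ∀ t : K, eval (t • p) f = 0}
  add_mem' := by
    intro a b ha hb t
    simp only [Set.mem_setOf_eq] at ha hb ⊢
    simp [map_add, ha t, hb t]
  zero_mem' := by
    intro t
    simp
  smul_mem' := by
    intro c f hf t
    simp only [Set.mem_setOf_eq] at hf ⊢
    simp [smul_eq_mul, map_mul, hf t]

/-- The degree-`t` homogeneous component of an ideal, as a `K`-vector subspace. -/
def homComp (K : Type*) [Field K] {n : ℕ} (I : Ideal (MvPolynomial (Fin n) K)) (t : ℕ) :
    Submodule K (MvPolynomial (Fin n) K) :=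
  (Submodule.restrictScalars K I) ⊓ homogeneousSubmodule (Fin n) K t

/-- `α(I)` : the least degree `t` such that `[I]_t ≠ 0`. -/
def alphaDeg (K : Type*) [Field K] {n : ℕ} (I : Ideal (MvPolynomial (Fin n) K)) : ℕ :=
  sInf {t : ℕ | homComp K I t ≠ ⊥}

/-- The ideal of the fat point scheme `Z = m_1 p_1 + ⋯ + m_s p_s`. -/
def fatIdeal (K : Type*) [Field K] {n s : ℕ} (p : Fin s → (Fin n → K)) (m : Fin s → ℕ) :
    Ideal (MvPolynomial (Fin n) K) :=
  ⨅ i, (coneIdeal K (p i)) ^ (m i)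

/-- The `k`-th symbolic power `I(kZ)` of the fat point ideal. -/
def symbPow (K : Type*) [Field K] {n s : ℕ} (p : Fin s → (Fin n → K)) (m : Fin s → ℕ)
    (k : ℕ) : Ideal (MvPolynomial (Fin n) K) :=
  fatIdeal K p (fun i => k * m i)

/-- The Waldschmidt constant `α̂(I(Z)) = inf_{k ≥ 1} α(I(kZ))/k`. -/
def waldschmidt (K : Type*) [Field K] {n s : ℕ} (p : Fin s → (Fin n → K)) (m : Fin s → ℕ) :
    ℝ :=
  ⨅ k : ℕ+, (alphaDeg K (symbPow K p m k) : ℝ) / (k : ℝ)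

/-- The vectors `p i` represent distinct points of projective space. -/
def ProjDistinct (K : Type*) [Field K] {n s : ℕ} (p : Fin s → (Fin n → K)) : Prop :=
  (∀ i, p i ≠ 0) ∧ ∀ i j, i ≠ j → ∀ c : K, p i ≠ c • p j



namespace ELS

section Frob
variable {σ K : Type*} [Field K] (p : ℕ) [hp : Fact p.Prime] [CharP K p] [PerfectRing K p]
  (e : ℕ)

/-- exponent division -/
def dv (q : ℕ) (d : σ →₀ ℕ) : σ →₀ ℕ := d.mapRange (· / q) (Nat.zero_div q)

def md (q : ℕ) (d : σ →₀ ℕ) : σ →₀ ℕ := d.mapRange (· % q) (Nat.zero_mod q)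

lemma md_add_dv (q : ℕ) (d : σ →₀ ℕ) : md q d + q • dv q d = d := by
  ext i; simp [md, dv, Nat.mod_add_div]

lemma md_dv_unique {q : ℕ} {a b : σ →₀ ℕ} (ha : ∀ i, a i < q) :
    md q (a + q • b) = a ∧ dv q (a + q • b) = b := by
  constructor
  · ext i; simp [md, Nat.mod_eq_of_lt (ha i)]
  · ext i
    have : 0 < q := lt_of_le_of_lt (Nat.zero_le _) (ha i)
    simp [dv, Nat.add_mul_div_left _ _ this, Nat.div_eq_of_lt (ha i)]

open Classical in
def piq (a : σ →₀ ℕ) (f : MvPolynomial σ K) : MvPolynomial σ K :=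
  ∑ d ∈ f.support, if md (p ^ e) d = a then
    monomial (dv (p ^ e) d) ((iterateFrobeniusEquiv K p e).symm (coeff d f)) else 0

lemma coeff_piq {a : σ →₀ ℕ} (ha : ∀ i, a i < p ^ e) (f : MvPolynomial σ K) (b : σ →₀ ℕ) :
    coeff b (piq p e a f) = (iterateFrobeniusEquiv K p e).symm (coeff (a + p ^ e • b) f) := by
  classical
  rw [piq, coeff_sum, Finset.sum_eq_single (a + p ^ e • b)]
  · rw [if_pos (md_dv_unique ha).1, (md_dv_unique ha).2, coeff_monomial, if_pos rfl]
  · intro d _ hd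
    split_ifs with h
    · rw [coeff_monomial, if_neg]
      intro h2
      apply hd
      rw [← h, ← h2, md_add_dv]
    · simp
  · intro h
    rw [notMem_support_iff] at h
    simp [h]

lemma piq_add {a : σ →₀ ℕ} (ha : ∀ i, a i < p ^ e) (f g : MvPolynomial σ K) :
    piq p e a (f + g) = piq p e a f + piq p e a g := by
  ext b
  simp [coeff_piq p e ha]

lemma piq_sum {a : σ →₀ ℕ} (ha : ∀ i, a i < p ^ e) {ι : Type*} (s : Finset ι)
    (f : ι → MvPolynomial σ K) :
    piq p e a (∑ i ∈ s, f i) = ∑ i ∈ s, piq p e a (f i) := by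
  ext b
  simp [coeff_piq p e ha, coeff_sum]

lemma piq_mul {a : σ →₀ ℕ} (ha : ∀ i, a i < p ^ e) (g h : MvPolynomial σ K) :
    piq p e a (g ^ p ^ e * h) = g * piq p e a h := by
  induction g using MvPolynomial.induction_on' with
  | add g1 g2 ih1 ih2 =>
    rw [add_pow_char_pow, add_mul, add_mul, piq_add p e ha, ih1, ih2]
  | monomial b0 c =>
    ext b
    rw [monomial_pow, coeff_piq p e ha, coeff_monomial_mul', coeff_monomial_mul',
      coeff_piq p e ha]
    have key : p ^ e • b0 ≤ a + p ^ e • b ↔ b0 ≤ b := by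
      constructor
      · intro h i
        have := h i
        simp only [Finsupp.smul_apply, Finsupp.add_apply, smul_eq_mul] at this
        have h2 := ha i
        by_contra hlt
        push Not at hlt
        have : p ^ e * (b i + 1) ≤ p ^ e * b0 i := Nat.mul_le_mul_left _ hlt
        rw [mul_add] at this
        omega
      · intro h i
        have := Nat.mul_le_mul_left (p ^ e) (h i)
        simp only [Finsupp.smul_apply, Finsupp.add_apply, smul_eq_mul]
        omega
    by_cases hle : b0 ≤ b
    · rw [if_pos hle, if_pos (key.2 hle), map_mul]
      congr 1
      · rw [RingEquiv.symm_apply_eq]; rfl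
      · congr 2
        ext i
        have := hle i
        simp only [Finsupp.smul_apply, Finsupp.add_apply, smul_eq_mul, Finsupp.tsub_apply]
        have := Nat.mul_le_mul_left (p ^ e) (hle i)
        rw [Nat.mul_sub]; omega
    · rw [if_neg hle, if_neg (mt key.1 hle), map_zero]

def box (σ : Type*) [Fintype σ] (E : ℕ) : Finset (σ →₀ ℕ) := by
  classical exact Finset.Iic (Finsupp.equivFunOnFinite.symm fun _ => E)

lemma mem_box [Fintype σ] {E : ℕ} {b : σ →₀ ℕ} : b ∈ box σ E ↔ ∀ i, b i ≤ E := by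
  classical
  simp [box, Finsupp.le_def]

lemma sum_piq [Fintype σ] (f : MvPolynomial σ K) :
    f = ∑ a ∈ box σ (p ^ e - 1), monomial a 1 * (piq p e a f) ^ p ^ e := by
  classical
  have hq : 0 < p ^ e := pow_pos hp.out.pos e
  have hb : ∀ a ∈ box σ (p ^ e - 1), ∀ i, a i < p ^ e := fun a ha i => by
    have := mem_box.1 ha i; omega
  induction f using MvPolynomial.induction_on' with
  | add f g ihf ihg =>
    have : ∀ a ∈ box σ (p ^ e - 1), monomial a 1 * (piq p e a (f + g)) ^ p ^ e
      = monomial a 1 * (piq p e a f) ^ p ^ e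
        + monomial a 1 * (piq p e a g) ^ p ^ e := by
      intro a ha
      rw [piq_add p e (hb a ha), add_pow_char_pow, mul_add]
    rw [Finset.sum_congr rfl this, Finset.sum_add_distrib, ← ihf, ← ihg]
  | monomial d c =>
    have hd : ∀ i, md (p ^ e) d i < p ^ e := fun i => by simpa [md] using Nat.mod_lt _ hq
    rw [Finset.sum_eq_single (md (p ^ e) d)]
    · have : piq p e (md (p ^ e) d) (monomial d c : MvPolynomial σ K) =
        monomial (dv (p ^ e) d) ((iterateFrobeniusEquiv K p e).symm c) := by
        ext b
        rw [coeff_piq p e hd, coeff_monomial, coeff_monomial]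
        by_cases h : dv (p ^ e) d = b
        · rw [if_pos h, if_pos]
          rw [← h, md_add_dv]
        · rw [if_neg h, if_neg, map_zero]
          intro h2; apply h
          rw [h2, (md_dv_unique hd).2]
      rw [this, monomial_pow, ← iterateFrobeniusEquiv_def, RingEquiv.apply_symm_apply,
        monomial_mul, one_mul, md_add_dv]
    · intro a ha hne
      have : piq p e a (monomial d c : MvPolynomial σ K) = 0 := by
        ext b
        rw [coeff_piq p e (hb a ha), coeff_monomial, if_neg, map_zero, coeff_zero]
        intro h2; apply hne
        rw [h2, (md_dv_unique (hb a ha)).1]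
      rw [this, zero_pow hq.ne', mul_zero]
    · intro h; refine absurd (mem_box.2 fun i => ?_) h
      have := hd i; omega

lemma totalDegree_piq {a : σ →₀ ℕ} (ha : ∀ i, a i < p ^ e) (f : MvPolynomial σ K) :
    p ^ e * (piq p e a f).totalDegree ≤ f.totalDegree := by
  have hq : 0 < p ^ e := pow_pos hp.out.pos e
  rw [mul_comm, ← Nat.le_div_iff_mul_le hq]
  refine Finset.sup_le fun b hb => ?_
  rw [Nat.le_div_iff_mul_le hq]
  rw [mem_support_iff, coeff_piq p e ha] at hb
  have h2 : a + p ^ e • b ∈ f.support := by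
    rw [mem_support_iff]; intro h; apply hb; rw [h, map_zero]
  refine le_trans ?_ (le_totalDegree h2)
  have := Finsupp.degree_apply (R := ℕ) b
  change Finsupp.degree b * p ^ e ≤ Finsupp.degree (a + p ^ e • b)
  rw [map_add, map_nsmul, smul_eq_mul, mul_comm]
  omega


lemma piq_mem {τ : Type*} [Fintype τ] (y : τ → MvPolynomial σ K) {k s : ℕ}
    (hk : p ^ e * s + Fintype.card τ * (p ^ e - 1) ≤ k + (p ^ e - 1))
    {a : σ →₀ ℕ} (ha : ∀ i, a i < p ^ e) {h : MvPolynomial σ K}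
    (hh : h ∈ Ideal.span (Set.range y) ^ k) :
    piq p e a h ∈ Ideal.span (Set.range y) ^ s := by
  classical
  have hq : 0 < p ^ e := pow_pos hp.out.pos e
  set q := p ^ e with hqdef
  obtain ⟨F, hF, rfl⟩ := (Ideal.mem_span_pow_iff_exists_isHomogeneous y h).1 hh
  rw [eval_eq']
  rw [piq_sum p e ha]
  refine Ideal.sum_mem _ fun α hα => ?_
  have hdeg : ∑ i, α i = k := by
    have := hF (mem_support_iff.1 hα)
    rw [Finsupp.weight_apply, Finsupp.sum_fintype _ _ (by simp)] at this
    simpa using this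
  have hdec : coeff α F * ∏ i, y i ^ α i =
      (∏ i, y i ^ (α i / q)) ^ p ^ e * (coeff α F * ∏ i, y i ^ (α i % q)) := by
    rw [← Finset.prod_pow, mul_left_comm, ← Finset.prod_mul_distrib]
    congr 1
    refine Finset.prod_congr rfl fun i _ => ?_
    rw [← pow_mul, ← pow_add, ← hqdef, mul_comm, Nat.div_add_mod]
  rw [hdec, piq_mul p e ha]
  refine Ideal.mul_mem_right _ _ ?_
  have hs : s ≤ ∑ i, α i / q := by
    have h1 : ∑ i, α i = q * ∑ i, α i / q + ∑ i, α i % q := by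
      rw [Finset.mul_sum, ← Finset.sum_add_distrib]
      exact Finset.sum_congr rfl fun i _ => (Nat.div_add_mod _ _).symm
    have h2 : ∑ i, α i % q ≤ Fintype.card τ * (q - 1) := by
      have := Finset.sum_le_card_nsmul Finset.univ (fun i => α i % q) (q - 1) (fun i _ => by
        have := Nat.mod_lt (α i) hq; omega)
      simpa using this
    by_contra hlt
    push Not at hlt
    have h3 : q * (∑ i, α i / q + 1) ≤ q * s := Nat.mul_le_mul_left _ hlt
    rw [mul_add] at h3
    omega
  refine Ideal.pow_le_pow_right hs ?_
  rw [← Finset.prod_pow_eq_pow_sum]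
  exact Ideal.prod_mem_prod fun i _ => Ideal.pow_mem_pow (Ideal.subset_span (Set.mem_range_self i)) _

lemma piq_const {a : σ →₀ ℕ} (ha : ∀ i, a i < p ^ e) {c : MvPolynomial σ K}
    (hc : c.totalDegree < p ^ e) (hac : coeff a c ≠ 0) :
    ∃ u : K, u ≠ 0 ∧ piq p e a c = C u := by
  have h0 : (piq p e a c).totalDegree = 0 := by
    have := totalDegree_piq p e ha c
    by_contra h
    have : p ^ e * 1 ≤ p ^ e * (piq p e a c).totalDegree :=
      Nat.mul_le_mul_left _ (Nat.one_le_iff_ne_zero.2 h)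
    omega
  refine ⟨_, ?_, totalDegree_eq_zero_iff_eq_C.1 h0⟩
  rw [coeff_piq p e ha]
  simpa using hac

end Frob

/-- Bounded representation predicate. -/
def Prods {σ K : Type*} [Field K] (I : Ideal (MvPolynomial σ K)) (r D : ℕ) :
    Set (MvPolynomial σ K) :=
  {h | ∃ g : Fin r → MvPolynomial σ K, (∀ l, g l ∈ I ∧ (g l).totalDegree ≤ D) ∧ h = ∏ l, g l}

theorem charp {σ K ι : Type*} {τ : ι → Type*} [Fintype σ] [∀ i, Fintype (τ i)] [Field K] (p : ℕ) [hp : Fact p.Prime]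
    [CharP K p] [PerfectRing K p]
    (y : ∀ i, τ i → MvPolynomial σ K) (m : ι → ℕ) (r t N d : ℕ) (hr : 1 ≤ r)
    (hτ : ∀ i, Fintype.card (τ i) = N) (hN : 1 ≤ N)
    (f : MvPolynomial σ K) (hd : f.totalDegree ≤ d)
    (hf : ∀ i, f ∈ Ideal.span (Set.range (y i)) ^ (r * (t + N - 1) * m i)) :
    f ∈ Submodule.span K (Prods (⨅ i, Ideal.span (Set.range (y i)) ^ (t * m i)) r
      (r * Fintype.card σ + 1 + 2 * d)) := by
  classical
  by_cases hf0 : f = 0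
  · rw [hf0]; exact Submodule.zero_mem _
  obtain ⟨e, he⟩ : ∃ e, r * d + r < p ^ e := ⟨_, Nat.lt_pow_self hp.out.one_lt⟩
  set I := ⨅ i, Ideal.span (Set.range (y i)) ^ (t * m i) with hI
  set q := p ^ e with hq
  have hq0 : 0 < q := by omega
  have hb : ∀ a ∈ box σ (q - 1), ∀ i, a i < p ^ e := fun a ha i => by
    have := mem_box.1 ha i; omega
  set A := q / r + 1 with hA
  have hA1 : q ≤ r * A := by
    rw [hA, mul_add]
    have := Nat.div_add_mod q r
    have := Nat.mod_lt q (show r > 0 by omega)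
    omega
  have hA2 : r * A ≤ q + r := by
    rw [hA, mul_add]
    have := Nat.div_add_mod q r
    omega
  have hA3 : A ≤ 2 * q := by
    have := Nat.div_le_self q r
    omega
  -- the coefficient polynomials
  have hgI : ∀ a ∈ box σ (q - 1), piq p e a (f ^ A) ∈ I := by
    intro a ha
    rw [hI, Ideal.mem_iInf]
    intro i
    rcases Nat.eq_zero_or_pos (m i) with h0 | h0
    · simp [h0]
    refine piq_mem p e (y i) (k := r * (t + N - 1) * m i * A) ?_ (hb a ha) ?_
    · rw [hτ, ← hq]
      obtain ⟨N', rfl⟩ : ∃ N', N = N' + 1 := ⟨N - 1, by omega⟩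
      obtain ⟨q', hq'⟩ : ∃ q', q = q' + 1 := ⟨q - 1, by omega⟩
      obtain ⟨m', hm'⟩ : ∃ m', m i = m' + 1 := ⟨m i - 1, by omega⟩
      have e1 : t + (N' + 1) - 1 = t + N' := by omega
      rw [e1]
      have e2 : q * ((t + N') * m i) ≤ r * A * ((t + N') * m i) := Nat.mul_le_mul_right _ hA1
      have e3 : q - 1 = q' := by omega
      rw [e3]
      have e4 : r * (t + N') * m i * A = r * A * ((t + N') * m i) := by ring
      rw [e4]
      have e5 : q * (t * m i) + (N' + 1) * q' ≤ q * ((t + N') * m i) + q' := by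
        rw [hq', hm']
        nlinarith [Nat.zero_le (N' * m' * q'), Nat.zero_le (N' * m')]
      omega
    · rw [pow_mul]; exact Ideal.pow_mem_pow (hf i) _
  have hgd : ∀ a ∈ box σ (q - 1), (piq p e a (f ^ A)).totalDegree ≤ 2 * d := by
    intro a ha
    have h1 := totalDegree_piq p e (hb a ha) (f ^ A)
    have h2 := totalDegree_pow f A
    have h3 : A * f.totalDegree ≤ 2 * q * d := Nat.mul_le_mul hA3 hd
    rw [← hq] at h1
    have h4 : q * (piq p e a (f ^ A)).totalDegree ≤ q * (2 * d) := by
      calc _ ≤ _ := h1.trans (h2.trans h3)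
        _ = _ := by ring
    exact Nat.le_of_mul_le_mul_left h4 hq0
  -- f ^ r has small degree
  have hdr : (f ^ r).totalDegree ≤ r * d :=
    (totalDegree_pow f r).trans (Nat.mul_le_mul_left _ hd)
  have hc0 : f ^ r ≠ 0 := pow_ne_zero _ hf0
  obtain ⟨a, haS⟩ := support_nonempty.2 hc0
  have ha : ∀ i, a i < p ^ e := by
    intro i
    have h1 := le_totalDegree haS
    have h2 : a i ≤ a.sum fun _ e => e := by
      rw [Finsupp.sum_fintype _ _ (by simp)]
      exact Finset.single_le_sum (f := fun i => a i) (fun _ _ => Nat.zero_le _) (Finset.mem_univ i)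
    omega
  obtain ⟨u, hu0, hu⟩ := piq_const p e ha (c := f ^ r) (by omega) (mem_support_iff.1 haS)
  have hpi : piq p e a (f ^ q * f ^ r) = f * C u := by
    rw [hq, piq_mul p e ha, hu]
  obtain ⟨s, hs⟩ : ∃ s, q + r = s + r * A := ⟨q + r - r * A, by omega⟩
  have hsr : s ≤ r := by omega
  have hexp : f ^ q * f ^ r = ∑ κ ∈ Fintype.piFinset (fun _ : Fin r => box σ (q - 1)),
      (∏ l, piq p e (κ l) (f ^ A)) ^ p ^ e * (f ^ s * ∏ l, monomial (κ l) 1) := by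
    rw [← pow_add, hs, pow_add, mul_comm r A, pow_mul]
    have h1 : (f ^ A) ^ r = ∏ _l : Fin r, ∑ a ∈ box σ (q - 1),
        monomial a 1 * (piq p e a (f ^ A)) ^ p ^ e := by
      rw [Finset.prod_const, Finset.card_univ, Fintype.card_fin]
      congr 1
      exact sum_piq p e (f ^ A)
    rw [h1, Finset.prod_univ_sum, Finset.mul_sum]
    refine Finset.sum_congr rfl fun κ _ => ?_
    rw [Finset.prod_mul_distrib, Finset.prod_pow]
    ring
  have hfin : f = C u⁻¹ * (f * C u) := by
    rw [mul_left_comm, ← C_mul, inv_mul_cancel₀ hu0, C_1, mul_one]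
  rw [hfin, ← hpi, hexp, piq_sum p e ha, Finset.mul_sum]
  refine Submodule.sum_mem _ fun κ hκ => ?_
  rw [Fintype.mem_piFinset] at hκ
  rw [piq_mul p e ha, ← smul_eq_C_mul]
  refine Submodule.smul_mem _ _ (Submodule.subset_span ?_)
  set v := piq p e a (f ^ s * ∏ l, monomial (κ l) 1) with hv
  have hvd : v.totalDegree ≤ r * Fintype.card σ + 1 := by
    have h1 := totalDegree_piq p e ha (f ^ s * ∏ l, monomial (κ l) 1)
    have h2 : (f ^ s).totalDegree ≤ q := by
      have := totalDegree_pow f s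
      have := Nat.mul_le_mul hsr hd
      omega
    have h3 : (∏ l, monomial (κ l) (1 : K)).totalDegree ≤ r * (Fintype.card σ * q) := by
      refine (totalDegree_finsetProd _ _).trans ?_
      refine (Finset.sum_le_card_nsmul _ _ (Fintype.card σ * q) fun l _ => ?_).trans (by simp)
      refine (totalDegree_monomial_le _ _).trans ?_
      rw [Finsupp.sum_fintype _ _ (by simp)]
      refine (Finset.sum_le_card_nsmul _ _ q fun i _ => ?_).trans (by simp)
      exact (hb _ (hκ l) i).le
    have h4 := totalDegree_mul (f ^ s) (∏ l, monomial (κ l) 1)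
    have h5 : q * v.totalDegree ≤ q * (r * Fintype.card σ + 1) := by
      calc q * v.totalDegree ≤ q + r * (Fintype.card σ * q) := (h1.trans h4).trans (add_le_add h2 h3)
        _ = _ := by ring
    exact Nat.le_of_mul_le_mul_left h5 hq0
  refine ⟨fun l => (if l = ⟨0, hr⟩ then v else 1) * piq p e (κ l) (f ^ A), fun l => ⟨?_, ?_⟩, ?_⟩
  · exact Ideal.mul_mem_left _ _ (hgI _ (hκ l))
  · refine (totalDegree_mul _ _).trans (add_le_add ?_ (hgd _ (hκ l)))
    split_ifs
    · exact hvd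
    · simp
  · rw [Finset.prod_mul_distrib, Finset.prod_ite_eq']
    simp [mul_comm]
lemma mem_box_of_totalDegree {σ R : Type*} [Fintype σ] [CommSemiring R] {E : ℕ}
    {g : MvPolynomial σ R} (hg : g.totalDegree ≤ E) : g.support ⊆ box σ E := by
  intro b hb
  refine mem_box.2 fun i => ?_
  have h1 := le_totalDegree hb
  have h2 : b i ≤ b.sum fun _ e => e := by
    rw [Finsupp.sum_fintype _ _ (by simp)]
    exact Finset.single_le_sum (f := fun i => b i) (fun _ _ => Nat.zero_le _) (Finset.mem_univ i)
  omega

lemma eq_sum_box {σ R : Type*} [Fintype σ] [CommSemiring R] {E : ℕ}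
    {g : MvPolynomial σ R} (hg : g.totalDegree ≤ E) :
    g = ∑ b ∈ box σ E, monomial b (coeff b g) := by
  conv_lhs => rw [g.as_sum]
  refine Finset.sum_subset (mem_box_of_totalDegree hg) fun b _ hb => ?_
  rw [notMem_support_iff.1 hb, monomial_zero]

lemma trim {K V : Type*} [Field K] [AddCommGroup V] [Module K V] (T : Finset V) (S : Set V)
    (hS : S ⊆ Submodule.span K (T : Set V)) (hsmul : ∀ c : K, ∀ s ∈ S, c • s ∈ S)
    (h0 : (0 : V) ∈ S) {x : V} (hx : x ∈ Submodule.span K S) {J : ℕ} (hJ : T.card ≤ J) :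
    ∃ s : Fin J → V, (∀ j, s j ∈ S) ∧ x = ∑ j, s j := by
  classical
  have hle : Submodule.span K S ≤ Submodule.span K (T : Set V) := Submodule.span_le.2 hS
  have hfd : FiniteDimensional K (Submodule.span K S) :=
    Submodule.finiteDimensional_of_le hle
  obtain ⟨b, hbS, hbc, hspan, -⟩ := Submodule.exists_finset_span_eq_linearIndepOn K S
  have hbJ : b.card ≤ J := by
    rw [hbc]
    exact ((Submodule.finrank_mono hle).trans (finrank_span_finset_le_card T)).trans hJ
  rw [← hspan, Submodule.mem_span_finset] at hx
  obtain ⟨c, -, rfl⟩ := hx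
  obtain ⟨k, rfl⟩ := Nat.exists_eq_add_of_le hbJ
  refine ⟨Fin.addCases (fun j => c (b.equivFin.symm j) • (b.equivFin.symm j : V)) (fun _ => 0),
    fun j => ?_, ?_⟩
  · refine Fin.addCases (fun j => ?_) (fun j => ?_) j
    · simp only [Fin.addCases_left]
      exact hsmul _ _ (hbS (b.equivFin.symm j).2)
    · simp only [Fin.addCases_right]; exact h0
  · rw [Fin.sum_univ_add]
    simp only [Fin.addCases_left, Fin.addCases_right, Finset.sum_const_zero, add_zero]
    rw [Equiv.sum_comp b.equivFin.symm (fun v : b => c v • (v : V))]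
    exact (Finset.sum_coe_sort b (fun v => c v • v)).symm

lemma rep_of_span {σ K : Type*} [Fintype σ] [Field K] (I : Ideal (MvPolynomial σ K)) (r D : ℕ)
    (hr : 1 ≤ r) {f : MvPolynomial σ K} (hf : f ∈ Submodule.span K (Prods I r D)) :
    ∃ g : Fin (box σ (r * D)).card → Fin r → MvPolynomial σ K,
      (∀ j l, g j l ∈ I ∧ (g j l).totalDegree ≤ D) ∧ f = ∑ j, ∏ l, g j l := by
  classical
  obtain ⟨s, hs, hfs⟩ := trim ((box σ (r * D)).image fun b => monomial b (1 : K)) (Prods I r D)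
    (by
      rintro h ⟨g, hg, rfl⟩
      have hd : (∏ l, g l).totalDegree ≤ r * D := by
        refine (totalDegree_finsetProd _ _).trans ?_
        exact (Finset.sum_le_card_nsmul _ _ D fun l _ => (hg l).2).trans (by simp)
      rw [eq_sum_box hd]
      refine Submodule.sum_mem _ fun b hb => ?_
      have hm : monomial b (coeff b (∏ l, g l)) = coeff b (∏ l, g l) • monomial b (1 : K) := by
        rw [smul_monomial, smul_eq_mul, mul_one]
      rw [hm]
      refine Submodule.smul_mem _ _ (Submodule.subset_span ?_)
      simp only [Finset.coe_image]
      exact ⟨b, hb, rfl⟩)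
    (by
      rintro c h ⟨g, hg, rfl⟩
      refine ⟨fun l => (if l = ⟨0, hr⟩ then C c else 1) * g l, fun l => ⟨?_, ?_⟩, ?_⟩
      · exact Ideal.mul_mem_left _ _ (hg l).1
      · refine (totalDegree_mul _ _).trans ?_
        have : (if l = ⟨0, hr⟩ then C c else (1 : MvPolynomial σ K)).totalDegree = 0 := by
          split_ifs <;> simp
        rw [this, zero_add]; exact (hg l).2
      · rw [Finset.prod_mul_distrib, Finset.prod_ite_eq']
        simp [smul_eq_C_mul])
    ⟨fun _ => 0, fun l => ⟨Ideal.zero_mem _, by simp⟩, by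
      rw [Finset.prod_const, Finset.card_univ, Fintype.card_fin, zero_pow (by omega)]⟩
    hf Finset.card_image_le
  choose g hg hg2 using hs
  exact ⟨g, hg, by rw [hfs]; exact Finset.sum_congr rfl fun j _ => hg2 j⟩
section Psi
variable {σ A : Type*} [CommRing A]

def lin (a : σ → A) (j : σ) (l : {l : σ // l ≠ j}) : MvPolynomial σ A :=
  X (l : σ) - C (a l) * X j

def Psi (a : σ → A) (j : σ) : MvPolynomial σ A →+* Polynomial (MvPolynomial σ A) :=
  eval₂Hom (Polynomial.C.comp C)
    (fun l => Polynomial.C (C (a l) * X j) + Polynomial.X * Polynomial.C (X l - C (a l) * X j))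

lemma Psi_X (a : σ → A) (j l : σ) : Psi a j (X l) =
    Polynomial.C (C (a l) * X j) + Polynomial.X * Polynomial.C (X l - C (a l) * X j) := by
  simp [Psi]

lemma Psi_C (a : σ → A) (j : σ) (c : A) : Psi a j (C c) = Polynomial.C (C c) := by
  simp [Psi]

lemma Psi_map {B : Type*} [CommRing B] (φ : A →+* B) (a : σ → A) (j : σ) (f : MvPolynomial σ A) :
    Psi (fun l => φ (a l)) j (map φ f) = (Psi a j f).map (map φ) := by
  have : (Psi (fun l => φ (a l)) j).comp (map φ) =
      (Polynomial.mapRingHom (map φ)).comp (Psi a j) := by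
    apply MvPolynomial.ringHom_ext
    · intro c; simp [Psi_C]
    · intro l; simp [Psi_X]
  exact RingHom.congr_fun this f

lemma mem_pow_iff (a : σ → A) (j : σ) (ha : a j = 1) (f : MvPolynomial σ A) (k : ℕ) :
    f ∈ Ideal.span (Set.range (lin a j)) ^ k ↔ ∀ i < k, (Psi a j f).coeff i = 0 := by
  rw [← Polynomial.X_pow_dvd_iff]
  constructor
  · intro h
    have h1 := Ideal.mem_map_of_mem (Psi a j) h
    rw [Ideal.map_pow] at h1
    have h2 : (Ideal.span (Set.range (lin a j))).map (Psi a j) ≤ Ideal.span {Polynomial.X} := by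
      rw [Ideal.map_span, Ideal.span_le]
      rintro _ ⟨_, ⟨l, rfl⟩, rfl⟩
      rw [SetLike.mem_coe, Ideal.mem_span_singleton]
      refine ⟨Polynomial.C (lin a j l), ?_⟩
      rw [lin, map_sub, map_mul, Psi_C, Psi_X, Psi_X, ha]
      simp
    have h3 := Ideal.pow_right_mono h2 k h1
    rwa [Ideal.span_singleton_pow, Ideal.mem_span_singleton] at h3
  · intro h
    rw [Polynomial.X_pow_dvd_iff] at h
    set Q := Ideal.span (Set.range (lin a j)) with hQ
    have h1 : ∀ f : MvPolynomial σ A, Psi a j f ∈ reesAlgebra Q := by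
      intro f
      induction f using MvPolynomial.induction_on with
      | C c => rw [Psi_C]; exact (reesAlgebra Q).algebraMap_mem _
      | add f g hf hg => rw [map_add]; exact add_mem hf hg
      | mul_X f l hf =>
        rw [map_mul]
        refine mul_mem hf ?_
        rw [Psi_X]
        refine add_mem ((reesAlgebra Q).algebraMap_mem _) ?_
        rw [mul_comm, ← Polynomial.monomial_one_one_eq_X, Polynomial.C_mul_monomial, mul_one,
          ]
        apply reesAlgebra.monomial_mem.2
        rw [pow_one]
        by_cases hl : l = j
        · subst hl; rw [ha]; simp
        · exact Ideal.subset_span ⟨⟨l, hl⟩, rfl⟩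
    have h2 : f = (Psi a j f).eval 1 := by
      have : (Polynomial.evalRingHom 1).comp (Psi a j) = RingHom.id _ := by
        apply MvPolynomial.ringHom_ext
        · intro c; simp [Psi_C]
        · intro l; simp [Psi_X]
      exact (RingHom.congr_fun this f).symm
    rw [h2, Polynomial.eval_eq_sum, Polynomial.sum]
    refine Ideal.sum_mem _ fun i _ => ?_
    rw [one_pow, mul_one]
    by_cases hi : i < k
    · rw [h i hi]; exact Ideal.zero_mem _
    · exact Ideal.pow_le_pow_right (not_lt.1 hi) ((mem_reesAlgebra_iff Q _).1 (h1 f) i)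

lemma coneIdeal_eq {K : Type*} [Field K] [Infinite K] {n : ℕ} (a : Fin n → K) (j : Fin n)
    (ha : a j = 1) : coneIdeal K a = Ideal.span (Set.range (lin a j)) := by
  ext f
  rw [← pow_one (Ideal.span _), mem_pow_iff a j ha]
  have h0 : ∀ x : Fin n → K, eval x ((Psi a j f).coeff 0) = eval (x j • a) f := by
    intro x
    have : ((eval x).comp (Polynomial.constantCoeff)).comp (Psi a j) = eval (x j • a) := by
      apply MvPolynomial.ringHom_ext
      · intro c; simp [Psi_C]
      · intro l; simp [Psi_X, mul_comm]
    exact RingHom.congr_fun this f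
  constructor
  · intro h i hi
    obtain rfl : i = 0 := by omega
    apply MvPolynomial.funext
    intro x
    rw [h0, map_zero]
    exact h _
  · intro h t
    have := h0 (fun _ => t)
    rw [h 0 one_pos, map_zero] at this
    exact this.symm

lemma coneIdeal_smul {K : Type*} [Field K] {n : ℕ} (a : Fin n → K) (c : K) (hc : c ≠ 0) :
    coneIdeal K (c • a) = coneIdeal K a := by
  ext f
  constructor
  · intro h t
    have := h (t * c⁻¹)
    rwa [smul_smul, mul_assoc, inv_mul_cancel₀ hc, mul_one] at this
  · intro h t
    have := h (t * c)
    rwa [← smul_smul] at this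
end Psi

section Transfer

universe u v w

lemma int_jacobson : IsJacobsonRing ℤ := by
  rw [isJacobsonRing_iff_prime_eq]
  intro P hP
  by_cases h : P = ⊥
  · subst h
    rw [eq_bot_iff]
    intro x hx
    rw [Ideal.mem_jacobson_bot] at hx
    have := hx (3 * x)
    rw [Int.isUnit_iff] at this
    rw [Ideal.mem_bot]
    rcases this with h | h <;> nlinarith
  · have := IsPrime.to_maximal_ideal h
    exact Ideal.jacobson_eq_self_of_isMaximal

lemma exists_prime_char {B k0 : Type*} [CommRing B] [Field k0] [Algebra ℤ B] [Algebra.FiniteType ℤ B]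
    (f : B →+* k0) (hf : Function.Surjective f) : ∃ p : ℕ, p.Prime ∧ CharP k0 p := by
  have hft : Algebra.FiniteType ℤ k0 :=
    Algebra.FiniteType.of_surjective (AlgHom.mk f (fun n => by simp) : B →ₐ[ℤ] k0) hf
  have := int_jacobson
  have hfin : Module.Finite ℤ k0 := finite_of_finite_type_of_isJacobsonRing ℤ k0
  obtain ⟨p, hp⟩ := CharP.exists k0
  have hp0 : p ≠ 0 := by
    rintro rfl
    have : CharZero k0 := CharP.charP_to_charZero _
    exact Int.not_isField (isField_of_isIntegral_of_isField
      (S := k0) Int.cast_injective (Field.toIsField _))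
  exact ⟨p, (CharP.char_is_prime_or_zero k0 p).resolve_right hp0, hp⟩

lemma exists_lift {F L K : Type*} [Field F] [Field L] [Field K] [IsAlgClosed K] [Algebra F L]
    [Algebra F K] [Algebra.FiniteType F L] : Nonempty (L →ₐ[F] K) := by
  have : Module.Finite F L := finite_of_finite_type_of_isJacobsonRing F L
  exact ⟨IsAlgClosed.lift⟩

lemma exists_charp {A : Type u} [CommRing A] [IsDomain A] [Algebra.FiniteType ℤ A] (s : A)
    (hs : s ≠ 0) : ∃ (k : Type u) (_ : Field k) (_ : IsAlgClosed k) (φ : A →+* k) (p : ℕ),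
      p.Prime ∧ CharP k p ∧ φ s ≠ 0 := by
  have hnt : Nontrivial (Localization.Away s) :=
    (IsLocalization.injective (Localization.Away s)
      (powers_le_nonZeroDivisors_of_noZeroDivisors hs)).nontrivial
  have hft : Algebra.FiniteType A (Localization.Away s) :=
    IsLocalization.finiteType_of_monoid_fg (Submonoid.powers s) _
  have hft2 : Algebra.FiniteType ℤ (Localization.Away s) :=
    Algebra.FiniteType.trans (S := A) inferInstance inferInstance
  obtain ⟨M, hM⟩ := Ideal.exists_maximal (Localization.Away s)
  let _ : Field (Localization.Away s ⧸ M) := Ideal.Quotient.field M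
  let k := AlgebraicClosure (Localization.Away s ⧸ M)
  obtain ⟨p, hpp, hp⟩ := exists_prime_char (Ideal.Quotient.mk M) Ideal.Quotient.mk_surjective
  refine ⟨k, inferInstance, inferInstance,
    (algebraMap (Localization.Away s ⧸ M) k).comp
      ((Ideal.Quotient.mk M).comp (algebraMap A (Localization.Away s))), p, hpp,
      charP_of_injective_algebraMap (algebraMap (Localization.Away s ⧸ M) k).injective p, ?_⟩
  have hu : IsUnit (algebraMap A (Localization.Away s) s) :=
    IsLocalization.Away.algebraMap_isUnit s
  exact (hu.map ((algebraMap (Localization.Away s ⧸ M) k).comp (Ideal.Quotient.mk M))).ne_zero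

lemma transfer {A : Type u} {K : Type v} [CommRing A] [IsDomain A] [Field K] [IsAlgClosed K]
    [Algebra A K] [FaithfulSMul A K] [Algebra.FiniteType ℤ A] {β : Type w} [Finite β]
    (E : Set (MvPolynomial β A))
    (H : ∀ (k : Type u) [Field k] [IsAlgClosed k] (φ : A →+* k) (p : ℕ), p.Prime → CharP k p →
      ∃ z : β → k, ∀ e ∈ E, eval₂ φ z e = 0) :
    ∃ z : β → K, ∀ e ∈ E, aeval z e = 0 := by
  by_cases hs : ∃ s : A, s ≠ 0 ∧ C s ∈ Ideal.span E
  · exfalso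
    obtain ⟨s, hs0, hsE⟩ := hs
    obtain ⟨k, _, _, φ, p, hp, hcp, hφ⟩ := exists_charp s hs0
    obtain ⟨z, hz⟩ := H k φ p hp hcp
    apply hφ
    have : Ideal.span E ≤ RingHom.ker (eval₂Hom φ z) := Ideal.span_le.2 fun e he => by
      rw [SetLike.mem_coe, RingHom.mem_ker]; exact hz e he
    have h2 := this hsE
    rw [RingHom.mem_ker] at h2
    simpa using h2
  · push Not at hs
    let F := FractionRing A
    let _ : Algebra F K := FractionRing.liftAlgebra A K
    have : IsScalarTower A F K := FractionRing.isScalarTower_liftAlgebra A K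
    let _ : Algebra (MvPolynomial β A) (MvPolynomial β F) := algebraMvPolynomial
    have hE : (Ideal.span E).map (algebraMap (MvPolynomial β A) (MvPolynomial β F)) ≠ ⊤ := by
      rw [IsLocalization.map_algebraMap_ne_top_iff_disjoint ((nonZeroDivisors A).map (C (σ := β)))]
      rw [Set.disjoint_left]
      rintro _ ⟨s, hs1, rfl⟩ h
      exact hs s (nonZeroDivisors.ne_zero hs1) h
    obtain ⟨M, hM, hle⟩ := Ideal.exists_le_maximal _ hE
    let _ : Field (MvPolynomial β F ⧸ M) := Ideal.Quotient.field M
    obtain ⟨ψ⟩ : Nonempty ((MvPolynomial β F ⧸ M) →ₐ[F] K) := exists_lift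
    let ψ2 : MvPolynomial β F →ₐ[F] K := ψ.comp (Ideal.Quotient.mkₐ F M)
    refine ⟨fun b => ψ2 (X b), fun e he => ?_⟩
    have h1 : ψ2 (map (algebraMap A F) e) = 0 := by
      have : map (algebraMap A F) e ∈ M := hle (Ideal.mem_map_of_mem _ (Ideal.subset_span he))
      have h3 : Ideal.Quotient.mkₐ F M (map (algebraMap A F) e) = 0 :=
        Ideal.Quotient.eq_zero_iff_mem.2 this
      change ψ (Ideal.Quotient.mkₐ F M (map (algebraMap A F) e)) = 0
      rw [h3, map_zero]
    rw [← h1]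
    conv_rhs => rw [aeval_unique ψ2]
    rw [aeval_map_algebraMap]
    rfl

end Transfer

section Core

lemma charp_rep {σ K ι : Type*} [Fintype σ] [DecidableEq σ] [Field K] [IsAlgClosed K] (p : ℕ)
    (hp : p.Prime) (hcp : CharP K p) (a : ι → σ → K) (j : ι → σ) (ha : ∀ i, a i (j i) = 1)
    (m : ι → ℕ) (r t N d : ℕ) (hr : 1 ≤ r) (hσ : Fintype.card σ = N + 1) (hN : 1 ≤ N)
    (f : MvPolynomial σ K) (hd : f.totalDegree ≤ d)
    (hf : ∀ i, f ∈ Ideal.span (Set.range (lin (a i) (j i))) ^ (r * (t + N - 1) * m i)) :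
    ∃ g : Fin (box σ (r * (r * Fintype.card σ + 1 + 2 * d))).card → Fin r → MvPolynomial σ K,
      (∀ x l, (∀ i, g x l ∈ Ideal.span (Set.range (lin (a i) (j i))) ^ (t * m i)) ∧
        (g x l).totalDegree ≤ r * Fintype.card σ + 1 + 2 * d) ∧ f = ∑ x, ∏ l, g x l := by
  have : Fact p.Prime := ⟨hp⟩
  have h := charp p (fun i => lin (a i) (j i)) m r t N d hr
    (fun i => by rw [Fintype.card_subtype_compl, hσ]; simp) hN f hd hf
  obtain ⟨g, hg, hfg⟩ := rep_of_span _ r _ hr h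
  exact ⟨g, fun x l => ⟨fun i => (Ideal.mem_iInf.1 (hg x l).1) i, (hg x l).2⟩, hfg⟩

/-- polynomial with prescribed coefficients on a box -/
def gen {σ B : Type*} [Fintype σ] [CommRing B] (D : ℕ) (z : box σ D → B) : MvPolynomial σ B :=
  ∑ b : box σ D, monomial (b : σ →₀ ℕ) (z b)

lemma map_gen {σ B B' : Type*} [Fintype σ] [CommRing B] [CommRing B'] (φ : B →+* B') (D : ℕ)
    (z : box σ D → B) : map φ (gen D z) = gen D (fun b => φ (z b)) := by
  simp [gen]

lemma gen_coeff {σ B : Type*} [Fintype σ] [CommRing B] {D : ℕ} {g : MvPolynomial σ B}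
    (hg : g.totalDegree ≤ D) : gen D (fun b => coeff (b : σ →₀ ℕ) g) = g := by
  conv_rhs => rw [eq_sum_box hg]
  exact Finset.sum_coe_sort (box σ D) (fun b => monomial b (coeff b g))

def eqs {σ ι A : Type*} [Fintype σ] [CommRing A] (a : ι → σ → A) (j : ι → σ) (M : ι → ℕ)
    (J r D : ℕ) (f : MvPolynomial σ A) : Set (MvPolynomial (Fin J × Fin r × box σ D) A) :=
  {e | ∃ x l i n c, n < M i ∧ e = coeff c ((Psi (fun s => C (a i s)) (j i)
      (gen D fun b => X (x, l, b))).coeff n)} ∪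
  {e | ∃ c, e = coeff c (map C f - ∑ x, ∏ l, gen D fun b => X (x, l, b))}

lemma eqs_iff {σ ι A k : Type*} [Fintype σ] [CommRing A] [Field k] (a : ι → σ → A) (j : ι → σ)
    (M : ι → ℕ) (J r D : ℕ) (f : MvPolynomial σ A) (φ : A →+* k)
    (z : Fin J × Fin r × box σ D → k) :
    (∀ e ∈ eqs a j M J r D f, eval₂ φ z e = 0) ↔
      (∀ x l i, ∀ n < M i, (Psi (fun s => φ (a i s)) (j i)
        (gen D fun b => z (x, l, b))).coeff n = 0) ∧
      map φ f = ∑ x, ∏ l, gen D fun b => z (x, l, b) := by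
  have hg : ∀ x l, map (eval₂Hom φ z) (gen D fun b => X (x, l, b)) =
      gen D fun b => z (x, l, b) := by
    intro x l; rw [map_gen]; simp
  have h1 : ∀ x l i n c, eval₂ φ z (coeff c ((Psi (fun s => C (a i s)) (j i)
      (gen D fun b => X (x, l, b))).coeff n)) =
      coeff c ((Psi (fun s => φ (a i s)) (j i) (gen D fun b => z (x, l, b))).coeff n) := by
    intro x l i n c
    have := Psi_map (eval₂Hom φ z) (fun s => C (a i s)) (j i) (gen D fun b => X (x, l, b))
    rw [hg] at this
    simp only [coe_eval₂Hom, eval₂_C] at this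
    rw [this, Polynomial.coeff_map, coeff_map]
    rfl
  have h2 : ∀ c, eval₂ φ z (coeff c (map C f - ∑ x, ∏ l, gen D fun b => X (x, l, b))) =
      coeff c (map φ f - ∑ x, ∏ l, gen D fun b => z (x, l, b)) := by
    intro c
    have : map (eval₂Hom φ z) (map C f - ∑ x, ∏ l, gen D fun b => X (x, l, b)) =
        map φ f - ∑ x, ∏ l, gen D fun b => z (x, l, b) := by
      rw [map_sub, map_sum, map_map]
      congr 1
      · have hcomp : (eval₂Hom φ z).comp C = φ := by
          apply RingHom.ext
          intro x
          simp
        rw [hcomp]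
      · refine Finset.sum_congr rfl fun x _ => ?_
        rw [map_prod]
        exact Finset.prod_congr rfl fun l _ => hg x l
    rw [← this, coeff_map]
    rfl
  constructor
  · intro h
    constructor
    · intro x l i n hn
      ext c
      rw [← h1, coeff_zero]
      exact h _ (Or.inl ⟨x, l, i, n, c, hn, rfl⟩)
    · rw [← sub_eq_zero]
      ext c
      rw [← h2, coeff_zero]
      exact h _ (Or.inr ⟨c, rfl⟩)
  · rintro ⟨h, h'⟩ e (⟨x, l, i, n, c, hn, rfl⟩ | ⟨c, rfl⟩)
    · rw [h1, h x l i n hn, coeff_zero]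
    · rw [h2, h', sub_self, coeff_zero]

lemma totalDegree_map_le' {σ A B : Type*} [CommSemiring A] [CommSemiring B] (φ : A →+* B)
    (f : MvPolynomial σ A) : (map φ f).totalDegree ≤ f.totalDegree :=
  Finset.sup_mono (support_map_subset φ f)

theorem core {σ ι : Type*} {K : Type u} [Fintype σ] [DecidableEq σ] [Finite ι] [Field K]
    [IsAlgClosed K]
    (a : ι → σ → K) (j : ι → σ) (ha : ∀ i, a i (j i) = 1)
    (m : ι → ℕ) (r t N : ℕ) (hr : 1 ≤ r) (hσ : Fintype.card σ = N + 1) (hN : 1 ≤ N)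
    (f : MvPolynomial σ K)
    (hf : ∀ i, f ∈ Ideal.span (Set.range (lin (a i) (j i))) ^ (r * (t + N - 1) * m i)) :
    f ∈ (⨅ i, Ideal.span (Set.range (lin (a i) (j i))) ^ (t * m i)) ^ r := by
  classical
  suffices h : ∃ (J : ℕ) (g : Fin J → Fin r → MvPolynomial σ K),
      (∀ x l i, g x l ∈ Ideal.span (Set.range (lin (a i) (j i))) ^ (t * m i)) ∧
      f = ∑ x, ∏ l, g x l by
    obtain ⟨J, g, hg, rfl⟩ := h
    refine Ideal.sum_mem _ fun x _ => ?_
    have := Ideal.prod_mem_prod (s := Finset.univ)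
      (I := fun _ : Fin r => ⨅ i, Ideal.span (Set.range (lin (a i) (j i))) ^ (t * m i))
      (x := g x) (fun l _ => Ideal.mem_iInf.2 fun i => hg x l i)
    simpa using this
  -- finitely generated subring
  cases nonempty_fintype ι
  let S : Finset K := (Finset.univ.image fun q : ι × σ => a q.1 q.2) ∪
    f.support.image fun b => coeff b f
  let A := Algebra.adjoin ℤ (S : Set K)
  have hft : Algebra.FiniteType ℤ A :=
    (Subalgebra.fg_iff_finiteType _).1 (Subalgebra.fg_adjoin_finset S)
  have haA : ∀ i s, a i s ∈ A := fun i s => Algebra.subset_adjoin (by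
    simp only [S, Finset.coe_union, Finset.coe_image]
    exact Or.inl ⟨(i, s), by simp, rfl⟩)
  have hfA : ∀ b, coeff b f ∈ A := fun b => by
    by_cases hb : b ∈ f.support
    · exact Algebra.subset_adjoin (by
        simp only [S, Finset.coe_union, Finset.coe_image]
        exact Or.inr ⟨b, hb, rfl⟩)
    · rw [notMem_support_iff.1 hb]; exact A.zero_mem
  let aA : ι → σ → A := fun i s => ⟨a i s, haA i s⟩
  let fA : MvPolynomial σ A := ∑ b ∈ f.support, monomial b ⟨coeff b f, hfA b⟩
  have hmap : map (algebraMap A K) fA = f := by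
    conv_rhs => rw [f.as_sum]
    simp only [fA, map_sum, map_monomial]
    rfl
  have haj : ∀ i, aA i (j i) = 1 := fun i => Subtype.ext (ha i)
  have hinj : Function.Injective (map (σ := σ) (algebraMap A K)) :=
    map_injective _ (FaithfulSMul.algebraMap_injective A K)
  have hPsi : ∀ i, ∀ n < r * (t + N - 1) * m i, (Psi (aA i) (j i) fA).coeff n = 0 := by
    intro i n hn
    apply hinj
    rw [map_zero, ← Polynomial.coeff_map, ← Psi_map, hmap]
    exact (mem_pow_iff (a i) (j i) (ha i) f _).1 (hf i) n hn
  set d := fA.totalDegree with hd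
  set D := r * Fintype.card σ + 1 + 2 * d with hD
  set J := (box σ (r * D)).card with hJ
  obtain ⟨z, hz⟩ := transfer (K := K) (eqs aA j (fun i => t * m i) J r D fA) (by
    intro k _ _ φ p hp hcp
    obtain ⟨g, hg, hfg⟩ := charp_rep p hp hcp (fun i s => φ (aA i s)) j
      (fun i => by rw [haj, map_one]) m r t N d hr hσ hN (map φ fA)
      (by rw [hd]; exact totalDegree_map_le' _ _) (fun i => by
        rw [mem_pow_iff _ _ (by rw [haj, map_one])]
        intro n hn
        rw [Psi_map, Polynomial.coeff_map, hPsi i n hn, map_zero])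
    refine ⟨fun q => coeff (q.2.2 : σ →₀ ℕ) (g q.1 q.2.1), ?_⟩
    rw [eqs_iff]
    have hgen : ∀ x l, (gen D fun b => coeff (b : σ →₀ ℕ) (g x l)) = g x l :=
      fun x l => gen_coeff (hg x l).2
    simp only [hgen]
    refine ⟨fun x l i => ?_, hfg⟩
    exact (mem_pow_iff _ _ (by rw [haj, map_one]) _ _).1 ((hg x l).1 i))
  have hz' := (eqs_iff aA j (fun i => t * m i) J r D fA (algebraMap A K) z).1 hz
  refine ⟨J, fun x l => gen D fun b => z (x, l, b), fun x l i => ?_, ?_⟩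
  · rw [mem_pow_iff _ _ (ha i)]
    exact hz'.1 x l i
  · rw [← hmap]; exact hz'.2

end Core
end ELS

set_option maxHeartbeats 1000000 in
/-- **Ein–Lazarsfeld–Smith / Hochster–Huneke containment** for fat point ideals:
for `I = I(Z)` with `Z ⊆ ℙ^N` a fat point subscheme and all `r, t ≥ 1`,
`I^{(r(t+N−1))} ⊆ (I^{(t)})^r`; in particular `I^{(k)} ⊆ I^r` whenever `k ≥ rN`. -/
theorem ELS_HH_containment (K : Type*) [Field K] [IsAlgClosed K]
    (N n : ℕ) (hN : 1 ≤ N)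
    (p : Fin n → (Fin (N + 1) → K)) (hp : ProjDistinct K p)
    (m : Fin n → ℕ) (hm : ∃ i, 0 < m i) :
    (∀ r t : ℕ, 1 ≤ r → 1 ≤ t →
      symbPow K p m (r * (t + N - 1)) ≤ (symbPow K p m t) ^ r) ∧
    (∀ r k : ℕ, 1 ≤ r → r * N ≤ k →
      symbPow K p m k ≤ (fatIdeal K p m) ^ r) := by
  have hinf : Infinite K := IsAlgClosed.instInfinite
  have key : ∀ r t : ℕ, 1 ≤ r → 1 ≤ t →
      symbPow K p m (r * (t + N - 1)) ≤ (symbPow K p m t) ^ r := by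
    intro r t hr ht
    have hex : ∀ i, ∃ l, p i l ≠ 0 := fun i => by
      by_contra h
      push Not at h
      exact hp.1 i (funext h)
    choose j hj using hex
    let a : Fin n → Fin (N + 1) → K := fun i => (p i (j i))⁻¹ • p i
    have ha : ∀ i, a i (j i) = 1 := fun i => by simp [a, hj i]
    have hc : ∀ i, coneIdeal K (p i) = Ideal.span (Set.range (ELS.lin (a i) (j i))) := fun i => by
      rw [← ELS.coneIdeal_eq (a i) (j i) (ha i), ELS.coneIdeal_smul _ _ (inv_ne_zero (hj i))]
    intro f hf
    have := ELS.core a j ha m r t N hr (by simp) hN f (fun i => by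
      rw [← hc i]
      exact (Ideal.mem_iInf.1 hf) i)
    simp only [← hc] at this
    exact this
  refine ⟨key, fun r k hr hk => ?_⟩
  have h1 := key r 1 hr le_rfl
  have e1 : r * (1 + N - 1) = r * N := by congr 1; omega
  have e2 : symbPow K p m 1 = fatIdeal K p m := by simp [symbPow]
  rw [e1, e2] at h1
  refine le_trans ?_ h1
  exact iInf_mono fun i => Ideal.pow_le_pow_right (Nat.mul_le_mul_right _ hk)

end
end

section
/- Let I = I(Z) for a fat point subscheme Z ⊆ ℙ^N, and define satdeg(I^r) to be the least t such that [I^r]_j = [I^{(r)}]_j for all j ≥ t. If m ≥ max( satdeg(I^r)/α̂(I(Z)), r ), then I^{(m)} ⊆ I^r. -/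
open MvPolynomial

noncomputable section

/-- `satdeg(I^r)` : the least `t` such that `[I^r]_j = [I^{(r)}]_j` for all `j ≥ t`. -/
def satDeg (K : Type*) [Field K] {n s : ℕ} (p : Fin s → (Fin n → K)) (m : Fin s → ℕ)
    (r : ℕ) : ℕ :=
  sInf {t : ℕ | ∀ j : ℕ, t ≤ j →
    homComp K ((fatIdeal K p m) ^ r) j = homComp K (symbPow K p m r) j}


attribute [local instance] MvPolynomial.gradedAlgebra

theorem aux_sup_mul_inf {R : Type*} [CommRing R] (A B : Ideal R) :
    (A ⊔ B) * (A ⊓ B) ≤ A * B := by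
  rw [Ideal.sup_mul]
  refine sup_le (Ideal.mul_mono le_rfl inf_le_right) ?_
  rw [mul_comm A B]
  exact Ideal.mul_mono le_rfl inf_le_left

theorem aux_sup_mul_sup {R : Type*} [CommRing R] (A B C : Ideal R) :
    (A ⊔ B) * (A ⊔ C) ≤ A ⊔ B * C := by
  rw [Ideal.sup_mul]
  refine sup_le (Ideal.mul_le_left.trans le_sup_left) ?_
  rw [Ideal.mul_sup]
  exact sup_le (Ideal.mul_le_right.trans le_sup_left) le_sup_right

theorem aux_sup_prod {R ι : Type*} [CommRing R] (M A : Ideal R) (B : ι → Ideal R)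
    (T : Finset ι) (h : ∀ j ∈ T, ∃ c, M ^ c ≤ A ⊔ B j) : ∃ c, M ^ c ≤ A ⊔ ∏ j ∈ T, B j := by
  classical
  induction T using Finset.induction_on with
  | empty => exact ⟨0, by simp⟩
  | insert a T ha ih =>
    obtain ⟨c, hc⟩ := ih (fun j hj => h j (Finset.mem_insert_of_mem hj))
    obtain ⟨d, hd⟩ := h a (Finset.mem_insert_self _ _)
    refine ⟨d + c, ?_⟩
    rw [Finset.prod_insert ha, pow_add]
    exact (Ideal.mul_mono hd hc).trans (aux_sup_mul_sup _ _ _)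

theorem aux_inf_prod {R ι : Type*} [CommRing R] (M : Ideal R) (B : ι → Ideal R)
    (T : Finset ι) (h : ∀ i ∈ T, ∀ j ∈ T, i ≠ j → ∃ c, M ^ c ≤ B i ⊔ B j) :
    ∃ c, M ^ c * T.inf B ≤ ∏ j ∈ T, B j := by
  classical
  induction T using Finset.induction_on with
  | empty => exact ⟨0, by simp⟩
  | insert a T ha ih =>
    obtain ⟨c, hc⟩ := ih (fun i hi j hj =>
      h i (Finset.mem_insert_of_mem hi) j (Finset.mem_insert_of_mem hj))
    obtain ⟨d, hd⟩ := aux_sup_prod M (B a) B T (fun j hj =>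
      h a (Finset.mem_insert_self _ _) j (Finset.mem_insert_of_mem hj)
        (fun e => ha (e ▸ hj)))
    refine ⟨d + c, ?_⟩
    rw [Finset.prod_insert ha, pow_add, mul_assoc, Finset.inf_insert]
    refine le_trans (Ideal.mul_mono hd ?_) (aux_sup_mul_inf _ _)
    exact le_inf ((Ideal.mul_le_right (I := M ^ c)).trans inf_le_left)
      ((Ideal.mul_mono le_rfl inf_le_right).trans hc)

theorem aux_pow_hom {K : Type*} [Field K] {n : ℕ} {I : Ideal (MvPolynomial (Fin n) K)}
    (h : I.IsHomogeneous (homogeneousSubmodule (Fin n) K)) (a : ℕ) :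
    (I ^ a).IsHomogeneous (homogeneousSubmodule (Fin n) K) := by
  induction a with
  | zero =>
    rw [pow_zero, Ideal.one_eq_top]
    exact Ideal.IsHomogeneous.top _
  | succ a ih => rw [pow_succ]; exact ih.mul h

theorem aux_M_hom (K : Type*) [Field K] (n : ℕ) :
    (idealOfVars (Fin n) K).IsHomogeneous (homogeneousSubmodule (Fin n) K) := by
  apply Ideal.homogeneous_span
  rintro _ ⟨i, rfl⟩
  exact ⟨1, isHomogeneous_X K i⟩

theorem aux_eval_smul {K : Type*} [Field K] {n d : ℕ} {f : MvPolynomial (Fin n) K}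
    (hf : f.IsHomogeneous d) (p : Fin n → K) (t : K) :
    eval (t • p) f = t ^ d * eval p f := by
  rw [eval_eq, eval_eq, Finset.mul_sum]
  refine Finset.sum_congr rfl fun x hx => ?_
  have h1 := hf (mem_support_iff.mp hx)
  replace h1 : x.degree = d := (DFunLike.congr_fun Finsupp.degree_eq_weight_one x).trans h1
  rw [Finsupp.degree_apply] at h1
  simp only [Pi.smul_apply, smul_eq_mul, mul_pow, Finset.prod_mul_distrib]
  rw [Finset.prod_pow_eq_pow_sum, ← h1]
  ring

theorem aux_mem_of_hom {K : Type*} [Field K] {n d : ℕ} {f : MvPolynomial (Fin n) K}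
    (hf : f.IsHomogeneous d) (p : Fin n → K) (h : eval p f = 0) : f ∈ coneIdeal K p := by
  intro t
  rw [aux_eval_smul hf, h, mul_zero]

theorem aux_cone_hom {K : Type*} [Field K] [Infinite K] {n : ℕ} (p : Fin n → K) :
    (coneIdeal K p).IsHomogeneous (homogeneousSubmodule (Fin n) K) := by
  intro i f hf
  change (decomposition.decompose' f i : MvPolynomial (Fin n) K) ∈ _
  rw [decomposition.decompose'_apply]
  refine aux_mem_of_hom (homogeneousComponent_isHomogeneous i f) p ?_
  let q : Polynomial K := ∑ j ∈ Finset.range (f.totalDegree + 1),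
    Polynomial.C (eval p (homogeneousComponent j f)) * Polynomial.X ^ j
  have hq : q = 0 := by
    apply Polynomial.funext
    intro t
    have h1 : eval (t • p) f = 0 := hf t
    rw [← sum_homogeneousComponent f, map_sum] at h1
    simp only [q, Polynomial.eval_finsetSum, Polynomial.eval_mul, Polynomial.eval_C,
      Polynomial.eval_pow, Polynomial.eval_X, Polynomial.eval_zero]
    rw [← h1]
    refine Finset.sum_congr rfl fun j _ => ?_
    rw [aux_eval_smul (homogeneousComponent_isHomogeneous j f), mul_comm]
  by_cases hi : f.totalDegree < i
  · rw [homogeneousComponent_eq_zero _ _ hi, map_zero]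
  · have h2 : q.coeff i = 0 := by rw [hq]; simp
    simp only [q, Polynomial.finsetSum_coeff, Polynomial.coeff_C_mul_X_pow] at h2
    rw [Finset.sum_ite_eq] at h2
    rw [if_pos (by simp; omega)] at h2
    exact h2

theorem aux_fat_hom {K : Type*} [Field K] [Infinite K] {n s : ℕ} (p : Fin s → Fin n → K)
    (m : Fin s → ℕ) :
    (fatIdeal K p m).IsHomogeneous (homogeneousSubmodule (Fin n) K) :=
  Ideal.IsHomogeneous.iInf fun i => aux_pow_hom (aux_cone_hom (p i)) _

theorem aux_cone_le {K : Type*} [Field K] {n : ℕ} (p : Fin n → K) :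
    coneIdeal K p ≤ idealOfVars (Fin n) K := by
  intro f hf
  rw [← pow_one (idealOfVars (Fin n) K), mem_pow_idealOfVars_iff']
  intro x hx
  have hx0 : x = 0 := by
    rw [← Finsupp.degree_eq_zero_iff]; omega
  subst hx0
  have h := hf 0
  rw [zero_smul] at h
  have h3 := MvPolynomial.eval_zero' (R := K) (σ := Fin n)
  rw [← constantCoeff_eq]
  rw [← h]
  simp [MvPolynomial.eval_zero]

theorem aux_minor {K : Type*} [Field K] {n : ℕ} (p : Fin n → K) (a b : Fin n) :
    (C (p a) * X b - C (p b) * X a : MvPolynomial (Fin n) K) ∈ coneIdeal K p := by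
  intro t
  simp
  ring

theorem aux_cone_ne_bot {K : Type*} [Field K] {N : ℕ} (hN : 1 ≤ N) (p : Fin (N + 1) → K)
    (hp : p ≠ 0) : coneIdeal K p ≠ ⊥ := by
  obtain ⟨a, ha⟩ := Function.ne_iff.mp hp
  have : Nontrivial (Fin (N + 1)) := Fin.nontrivial_iff_two_le.mpr (by omega)
  obtain ⟨b, hb⟩ := exists_ne a
  intro h
  have h1 := aux_minor p a b
  rw [h, Ideal.mem_bot] at h1
  have h2 := congrArg (eval (Pi.single b (1 : K))) h1
  simp [Pi.single_apply, hb.symm] at h2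
  exact ha h2

theorem aux_M_le {K : Type*} [Field K] {n : ℕ} (p q : Fin n → K)
    (hp : p ≠ 0) (hpq : ∀ c : K, q ≠ c • p) :
    idealOfVars (Fin n) K ≤ coneIdeal K p ⊔ coneIdeal K q := by
  obtain ⟨a, ha⟩ := Function.ne_iff.mp hp
  simp only [Pi.zero_apply] at ha
  have hb : ∃ b, p a * q b - p b * q a ≠ 0 := by
    by_contra! hcon
    apply hpq (q a / p a)
    funext b
    have := hcon b
    simp only [Pi.smul_apply, smul_eq_mul]
    field_simp
    linear_combination this
  obtain ⟨b, hb⟩ := hb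
  set D := p a * q b - p b * q a with hD
  rw [Ideal.span_le]
  rintro _ ⟨l, rfl⟩
  have e : (X l : MvPolynomial (Fin n) K) =
      C (q l / D) * (C (p a) * X b - C (p b) * X a) +
      (X l - C (q l / D) * (C (p a) * X b - C (p b) * X a)) := by ring
  rw [e]
  refine Submodule.add_mem_sup (Ideal.mul_mem_left _ _ (aux_minor p a b)) ?_
  intro t
  simp
  have : p a * (t * q b) - p b * (t * q a) = t * D := by rw [hD]; ring
  rw [this]
  field_simp
  ring

theorem aux_tail {K : Type*} [Field K] {n : ℕ} (J : Ideal (MvPolynomial (Fin n) K))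
    (hJ : J.IsHomogeneous (homogeneousSubmodule (Fin n) K)) (t : ℕ) :
    ∃ d, ∀ f ∈ J, ∀ j, d ≤ j → homogeneousComponent j f ∈ idealOfVars (Fin n) K ^ t * J := by
  obtain ⟨S, hS⟩ := (IsNoetherian.noetherian J : J.FG)
  have hMJ := (aux_pow_hom (aux_M_hom K n) t).mul hJ
  refine ⟨t + S.sup totalDegree, fun f hf j hj => ?_⟩
  rw [← hS] at hf
  refine Submodule.span_induction (p := fun f _ =>
    ∀ h : MvPolynomial (Fin n) K, homogeneousComponent j (h * f) ∈ idealOfVars (Fin n) K ^ t * J)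
    ?_ ?_ ?_ ?_ hf 1 |> fun h => by simpa using h
  · intro g hg h
    have hgJ : g ∈ J := hS ▸ Submodule.subset_span hg
    have hdeg : g.totalDegree ≤ S.sup totalDegree := Finset.le_sup hg
    induction h using MvPolynomial.induction_on' with
    | monomial u a =>
      by_cases hu : t ≤ u.degree
      · refine homogeneousComponent_mem_of_mem hMJ ?_ j
        refine Ideal.mul_mem_mul ?_ hgJ
        rw [mem_pow_idealOfVars_iff]
        intro x hx
        have := support_monomial_subset hx
        simp at this
        rw [this]; exact hu
      · rw [homogeneousComponent_eq_zero]
        · exact zero_mem _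
        · have h1 := totalDegree_mul (monomial u a) g
          have h2 : (monomial u a).totalDegree ≤ u.degree := totalDegree_monomial_le _ _
          omega
    | add h1 h2 i1 i2 => rw [add_mul, map_add]; exact add_mem i1 i2
  · intro h; simp
  · intro x y _ _ hx hy h
    rw [mul_add, map_add]; exact add_mem (hx h) (hy h)
  · intro a x _ hx h
    rw [smul_eq_mul, ← mul_assoc]; exact hx _

theorem aux_pow_le_symb {K : Type*} [Field K] {n s : ℕ} (p : Fin s → Fin n → K)
    (m : Fin s → ℕ) (r : ℕ) : fatIdeal K p m ^ r ≤ symbPow K p m r := by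
  refine le_iInf fun i => ?_
  change _ ≤ coneIdeal K (p i) ^ (r * m i)
  rw [mul_comm, pow_mul]
  exact Ideal.pow_right_mono (iInf_le _ i) r

theorem aux_sat {K : Type*} [Field K] [Infinite K] {n s : ℕ} (p : Fin s → Fin n → K)
    (hp : ProjDistinct K p) (m : Fin s → ℕ) (r : ℕ) :
    ∃ t, ∀ j : ℕ, t ≤ j →
      homComp K ((fatIdeal K p m) ^ r) j = homComp K (symbPow K p m r) j := by
  obtain ⟨c, hc⟩ := aux_inf_prod (idealOfVars (Fin n) K)
    (fun i => coneIdeal K (p i) ^ (r * m i)) Finset.univ (fun i _ j _ hij =>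
      ⟨r * m i + r * m j, (Ideal.pow_right_mono
        (aux_M_le (p i) (p j) (hp.1 i) (hp.2 j i hij.symm)) _).trans
        Ideal.sup_pow_add_le_pow_sup_pow⟩)
  rw [Finset.inf_univ_eq_iInf] at hc
  have hle : idealOfVars (Fin n) K ^ c * symbPow K p m r ≤ fatIdeal K p m ^ r := by
    refine hc.trans ?_
    have : ∏ j, coneIdeal K (p j) ^ (r * m j) = (∏ j, coneIdeal K (p j) ^ (m j)) ^ r := by
      rw [← Finset.prod_pow]
      refine Finset.prod_congr rfl fun j _ => ?_
      rw [mul_comm, pow_mul]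
    rw [this]
    refine Ideal.pow_right_mono ?_ r
    refine Ideal.prod_le_inf.trans ?_
    rw [Finset.inf_univ_eq_iInf]
    rfl
  obtain ⟨d, hd⟩ := aux_tail (symbPow K p m r) (aux_fat_hom p _) c
  refine ⟨d, fun j hj => le_antisymm ?_ ?_⟩
  · exact inf_le_inf_right _ (fun x hx => aux_pow_le_symb p m r hx)
  · rintro f ⟨h1, h2⟩
    refine ⟨?_, h2⟩
    have h3 := hle (hd f h1 j hj)
    rw [homogeneousComponent_of_mem h2, if_pos rfl] at h3
    exact h3

theorem aux_alpha {K : Type*} [Field K] [Infinite K] {N s : ℕ} (hN : 1 ≤ N)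
    (p : Fin s → Fin (N + 1) → K) (hp : ProjDistinct K p) (m : Fin s → ℕ) (k : ℕ) (i : Fin s) :
    k * m i ≤ alphaDeg K (symbPow K p m k) := by
  have hne : {t : ℕ | homComp K (symbPow K p m k) t ≠ ⊥}.Nonempty := by
    have h1 : symbPow K p m k ≠ ⊥ := by
      intro h
      have h2 : ∏ j, coneIdeal K (p j) ^ (k * m j) ≤ ⊥ := by
        rw [← h]
        refine Ideal.prod_le_inf.trans ?_
        rw [Finset.inf_univ_eq_iInf]
        rfl
      have h3 : ∏ j, coneIdeal K (p j) ^ (k * m j) ≠ 0 :=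
        Finset.prod_ne_zero_iff.mpr fun j _ => pow_ne_zero _ (aux_cone_ne_bot hN _ (hp.1 j))
      exact h3 (le_bot_iff.mp h2)
    obtain ⟨f, hf, hf0⟩ := Submodule.exists_mem_ne_zero_of_ne_bot h1
    have : ∃ j, homogeneousComponent j f ≠ 0 := by
      by_contra! hcon
      apply hf0
      rw [← sum_homogeneousComponent f]
      exact Finset.sum_eq_zero fun j _ => hcon j
    obtain ⟨j, hj⟩ := this
    refine ⟨j, fun hb => hj ?_⟩
    have : homogeneousComponent j f ∈ homComp K (symbPow K p m k) j :=
      ⟨homogeneousComponent_mem_of_mem (aux_fat_hom p _) hf j, homogeneousComponent_mem j f⟩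
    rw [hb] at this
    simpa using this
  refine le_csInf hne fun t ht => ?_
  obtain ⟨f, ⟨hf, hfh⟩, hf0⟩ := Submodule.exists_mem_ne_zero_of_ne_bot ht
  have h1 : f ∈ idealOfVars (Fin (N + 1)) K ^ (k * m i) := by
    have : f ∈ ⨅ i, coneIdeal K (p i) ^ (k * m i) := hf
    exact Ideal.pow_right_mono (aux_cone_le (p i)) _ ((Submodule.mem_iInf _).mp this i)
  obtain ⟨x, hx⟩ := support_nonempty.mpr hf0
  have h2 := (mem_pow_idealOfVars_iff _ _).mp h1 x hx
  have h3 : f.IsHomogeneous t := hfh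
  have h4 := h3 (mem_support_iff.mp hx)
  replace h4 : x.degree = t := (DFunLike.congr_fun Finsupp.degree_eq_weight_one x).trans h4
  omega

set_option maxHeartbeats 1000000 in
/-- If `k ≥ max(satdeg(I^r)/α̂(I(Z)), r)`, then `I^{(k)} ⊆ I^r`. -/
theorem satdeg_containment (K : Type*) [Field K] [IsAlgClosed K]
    (N s : ℕ) (hN : 1 ≤ N)
    (p : Fin s → (Fin (N + 1) → K)) (hp : ProjDistinct K p)
    (m : Fin s → ℕ) (hm : ∃ i, 0 < m i)
    (k r : ℕ) (hr : 0 < r)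
    (hk : max ((satDeg K p m r : ℝ) / waldschmidt K p m) (r : ℝ) ≤ (k : ℝ)) :
    symbPow K p m k ≤ (fatIdeal K p m) ^ r := by
  have : Infinite K := IsAlgClosed.instInfinite
  obtain ⟨i0, hi0⟩ := hm
  have hkr : r ≤ k := by exact_mod_cast (le_max_right _ _).trans hk
  have hsat := Nat.sInf_mem (aux_sat p hp m r)
  change ∀ j : ℕ, satDeg K p m r ≤ j → _ at hsat
  have hw : 0 < waldschmidt K p m := by
    refine lt_of_lt_of_le zero_lt_one (le_ciInf fun a => ?_)
    have ha : (0 : ℝ) < ((a : ℕ) : ℝ) := by exact_mod_cast a.pos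
    rw [le_div_iff₀ ha, one_mul]
    have h1 := aux_alpha hN p hp m a i0
    have h2 : (a : ℕ) ≤ a * m i0 := Nat.le_mul_of_pos_right _ hi0
    exact_mod_cast h2.trans h1
  have hk0 : 0 < k := by omega
  have hle : satDeg K p m r ≤ alphaDeg K (symbPow K p m k) := by
    have h1 := (le_max_left _ _).trans hk
    rw [div_le_iff₀ hw] at h1
    have hkp : (0 : ℝ) < k := by exact_mod_cast hk0
    have h2 : waldschmidt K p m ≤ (alphaDeg K (symbPow K p m k) : ℝ) / (k : ℝ) := by
      refine ciInf_le (f := fun k : ℕ+ => (alphaDeg K (symbPow K p m k) : ℝ) / (k : ℝ)) ?_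
        (⟨k, hk0⟩ : ℕ+)
      refine ⟨0, ?_⟩
      rintro _ ⟨a, rfl⟩
      positivity
    rw [le_div_iff₀ hkp] at h2
    have : (satDeg K p m r : ℝ) ≤ alphaDeg K (symbPow K p m k) := by linarith
    exact_mod_cast this
  intro f hf
  rw [← sum_homogeneousComponent f]
  refine Ideal.sum_mem _ fun j _ => ?_
  have hfj : homogeneousComponent j f ∈ symbPow K p m k :=
    homogeneousComponent_mem_of_mem (aux_fat_hom p _) hf j
  by_cases hj : satDeg K p m r ≤ j
  · have hmono : symbPow K p m k ≤ symbPow K p m r :=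
      iInf_mono fun i => Ideal.pow_le_pow_right (Nat.mul_le_mul_right _ hkr)
    have : homogeneousComponent j f ∈ homComp K (symbPow K p m r) j :=
      ⟨hmono hfj, homogeneousComponent_mem j f⟩
    rw [← hsat j hj] at this
    exact this.1
  · have hb : homComp K (symbPow K p m k) j = ⊥ := by
      by_contra hne
      have : alphaDeg K (symbPow K p m k) ≤ j := Nat.sInf_le hne
      omega
    have : homogeneousComponent j f ∈ homComp K (symbPow K p m k) j :=
      ⟨hfj, homogeneousComponent_mem j f⟩
    rw [hb, Submodule.mem_bot] at this
    rw [this]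
    exact zero_mem _

end
end

section
/- Let I = I(Z) for a nonempty fat point subscheme Z = m_1p_1+⋯+m_sp_s ⊆ ℙ^N, and let ρ(I) = sup{ m/r : I^{(m)} ⊄ I^r } be the resurgence of I. Then: (a) 1 ≤ ρ(I) ≤ N; (b) if m/r < α(I)/α̂(I), then I^{(mt)} ⊄ I^{rt} for all sufficiently large positive integers t; (c) if m/r ≥ reg(I)/α̂(I), then I^{(m)} ⊆ I^r; and (d) α(I)/α̂(I) ≤ ρ(I) ≤ reg(I)/α̂(I); in particular ρ(I) = α(I)/α̂(I) whenever α(I) = reg(I). -/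
open MvPolynomial

noncomputable section

/-- The resurgence `ρ(I) = sup { a/r : I^{(a)} ⊄ I^r }`. -/
def resurgence (K : Type*) [Field K] {n s : ℕ} (p : Fin s → (Fin n → K))
    (m : Fin s → ℕ) : ℝ :=
  sSup {x : ℝ | ∃ a r : ℕ, 0 < a ∧ 0 < r ∧
    ¬ symbPow K p m a ≤ (fatIdeal K p m) ^ r ∧ x = (a : ℝ) / (r : ℝ)}

/-- The regularity of a fat point ideal: `reg(I) − 1` is the least `t` such that
`dim [I]_t = C(t+N,N) − Σ_i C(m_i+N−1,N)`. -/
noncomputable def regIdeal (K : Type*) [Field K] {N s : ℕ}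
    (p : Fin s → (Fin (N + 1) → K)) (m : Fin s → ℕ) : ℕ :=
  1 + sInf {t : ℕ | (Module.finrank K ↥(homComp K (fatIdeal K p m) t) : ℤ)
      = ((t + N).choose N : ℤ) - ∑ i, ((m i + N - 1).choose N : ℤ)}

/-- Generators of the ideal of a point normalised by `q c = 1`. -/
def ptGen {S : Type*} [CommRing S] {n : ℕ} (q : Fin n → S) (c j : Fin n) :
    MvPolynomial (Fin n) S := X j - C (q j) * X c

def ptIdeal {S : Type*} [CommRing S] {n : ℕ} (q : Fin n → S) (c : Fin n) :
    Ideal (MvPolynomial (Fin n) S) := Ideal.span (Set.range (ptGen q c))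

/-- Deformation to the normal cone. -/
def ptTheta {S : Type*} [CommRing S] {n : ℕ} (q : Fin n → S) (c : Fin n) :
    MvPolynomial (Fin n) S →+* Polynomial (MvPolynomial (Fin n) S) :=
  eval₂Hom (Polynomial.C.comp C) (fun j => Polynomial.C (C (q j) * X c) +
    Polynomial.C (ptGen q c j) * Polynomial.X)

section
variable {S : Type*} [CommRing S] {n : ℕ} (q : Fin n → S) (c : Fin n)

lemma ptGen_self (hq : q c = 1) : ptGen q c c = 0 := by simp [ptGen, hq]

lemma ptTheta_X (j : Fin n) : ptTheta q c (X j) = Polynomial.C (C (q j) * X c) +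
    Polynomial.C (ptGen q c j) * Polynomial.X := by simp [ptTheta]

lemma ptTheta_C (a : S) : ptTheta q c (C a) = Polynomial.C (C a) := by simp [ptTheta]

lemma ptTheta_gen (hq : q c = 1) (j : Fin n) :
    ptTheta q c (ptGen q c j) = Polynomial.C (ptGen q c j) * Polynomial.X := by
  conv_lhs => rw [ptGen]
  rw [map_sub, map_mul, ptTheta_X, ptTheta_C, ptTheta_X, ptGen_self q c hq]
  simp [hq]

lemma ptTheta_eval_one (f : MvPolynomial (Fin n) S) :
    Polynomial.eval 1 (ptTheta q c f) = f := by
  have : (Polynomial.evalRingHom (1 : MvPolynomial (Fin n) S)).comp (ptTheta q c)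
      = RingHom.id _ := by
    apply MvPolynomial.ringHom_ext
    · intro a; simp [ptTheta_C]
    · intro j; simp [ptTheta_X, ptGen]
  exact congrArg (fun g => g f) this

lemma ptTheta_mem_rees (f : MvPolynomial (Fin n) S) :
    ptTheta q c f ∈ reesAlgebra (ptIdeal q c) := by
  induction f using MvPolynomial.induction_on with
  | C a => 
    rw [ptTheta_C]
    exact (reesAlgebra (ptIdeal q c)).algebraMap_mem (C a)
  | add f g hf hg => rw [map_add]; exact add_mem hf hg
  | mul_X f j hf =>
    rw [map_mul]
    refine mul_mem hf ?_
    rw [ptTheta_X]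
    refine add_mem ((reesAlgebra (ptIdeal q c)).algebraMap_mem _) ?_
    rw [Polynomial.C_mul_X_eq_monomial, reesAlgebra.monomial_mem, pow_one]
    exact Ideal.subset_span ⟨j, rfl⟩

lemma mem_ptIdeal_pow_iff (hq : q c = 1) (M : ℕ) (f : MvPolynomial (Fin n) S) :
    f ∈ ptIdeal q c ^ M ↔ Polynomial.X ^ M ∣ ptTheta q c f := by
  constructor
  · intro h
    have h1 : (ptIdeal q c).map (ptTheta q c) ≤ Ideal.span {Polynomial.X} := by
      rw [ptIdeal, Ideal.map_span, Ideal.span_le]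
      rintro _ ⟨_, ⟨j, rfl⟩, rfl⟩
      rw [ptTheta_gen q c hq]
      exact Ideal.mem_span_singleton.2 (Dvd.intro_left _ rfl)
    have h2 := Ideal.mem_map_of_mem (ptTheta q c) h
    rw [Ideal.map_pow] at h2
    have h3 := Ideal.pow_right_mono h1 M h2
    rwa [Ideal.span_singleton_pow, Ideal.mem_span_singleton] at h3
  · intro h
    rw [Polynomial.X_pow_dvd_iff] at h
    rw [← ptTheta_eval_one q c f, Polynomial.eval_eq_sum, Polynomial.sum]
    refine Ideal.sum_mem _ fun k hk => ?_
    rw [one_pow, mul_one]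
    have : M ≤ k := by
      by_contra hlt
      exact (Polynomial.mem_support_iff.1 hk) (h k (by omega))
    exact Ideal.pow_le_pow_right this ((mem_reesAlgebra_iff _ _).1 (ptTheta_mem_rees q c f) k)

variable {S' : Type*} [CommRing S'] (φ : S →+* S')

lemma map_ptGen (j : Fin n) : map φ (ptGen q c j) = ptGen (φ ∘ q) c j := by simp [ptGen]

lemma map_ptIdeal_pow {M : ℕ} {f : MvPolynomial (Fin n) S} (h : f ∈ ptIdeal q c ^ M) :
    map φ f ∈ ptIdeal (φ ∘ q) c ^ M := by
  have h2 := Ideal.mem_map_of_mem (map φ) h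
  rw [Ideal.map_pow] at h2
  refine Ideal.pow_right_mono ?_ M h2
  rw [ptIdeal, Ideal.map_span, Ideal.span_le]
  rintro _ ⟨_, ⟨j, rfl⟩, rfl⟩
  rw [map_ptGen]
  exact Ideal.subset_span ⟨j, rfl⟩

lemma map_ptTheta (f : MvPolynomial (Fin n) S) :
    Polynomial.map (map φ) (ptTheta q c f) = ptTheta (φ ∘ q) c (map φ f) := by
  have : (Polynomial.mapRingHom (map φ)).comp (ptTheta q c)
      = (ptTheta (φ ∘ q) c).comp (map φ) := by
    apply MvPolynomial.ringHom_ext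
    · intro a; simp [ptTheta_C]
    · intro j; simp [ptTheta_X, map_ptGen]
  exact congrArg (fun g => g f) this

/-- Membership in powers of point ideals can be checked on a jointly injective family. -/
lemma mem_ptIdeal_pow_of_family {ι : Type*} {T : ι → Type*} [∀ i, CommRing (T i)]
    (φ : ∀ i, S →+* T i) (hφ : ∀ a : S, (∀ i, φ i a = 0) → a = 0) (hq : q c = 1) (M : ℕ)
    (f : MvPolynomial (Fin n) S) (h : ∀ i, map (φ i) f ∈ ptIdeal (φ i ∘ q) c ^ M) :
    f ∈ ptIdeal q c ^ M := by
  rw [mem_ptIdeal_pow_iff q c hq, Polynomial.X_pow_dvd_iff]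
  intro d hd
  ext μ
  rw [coeff_zero]
  apply hφ
  intro i
  have := (mem_ptIdeal_pow_iff (φ i ∘ q) c (by simp [hq]) M _).1 (h i)
  rw [Polynomial.X_pow_dvd_iff] at this
  have := this d hd
  rw [← map_ptTheta, Polynomial.coeff_map] at this
  rw [← coeff_map, this, coeff_zero]

lemma ptIdeal_nzd [IsDomain S] (hq : q c = 1) (M : ℕ) {l g : MvPolynomial (Fin n) S}
    (hl : l ∉ ptIdeal q c) (h : l * g ∈ ptIdeal q c ^ M) : g ∈ ptIdeal q c ^ M := by
  rw [mem_ptIdeal_pow_iff q c hq] at h ⊢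
  rw [map_mul] at h
  refine Polynomial.prime_X.pow_dvd_of_dvd_mul_left M ?_ h
  intro h'
  apply hl
  have := (mem_ptIdeal_pow_iff q c hq 1 l).2 (by simpa using h')
  simpa using this

end

lemma coneIdeal_eq {K : Type*} [Field K] [Infinite K] {n : ℕ} (p : Fin n → K) (c : Fin n)
    (hc : p c ≠ 0) : coneIdeal K p = ptIdeal ((p c)⁻¹ • p) c := by
  set q : Fin n → K := (p c)⁻¹ • p with hqdef
  have hq : q c = 1 := by simp [hqdef, hc]
  have hpq : p = p c • q := by
    rw [hqdef, smul_smul, mul_inv_cancel₀ hc, one_smul]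
  apply le_antisymm
  · intro f hf
    have hf' : ∀ t : K, eval (t • q) f = 0 := by
      intro t
      have := hf (t * (p c)⁻¹)
      rwa [mul_smul] at this
    -- reduce modulo the ideal
    have key : f - aeval (fun j => C (q j) * X c) f ∈ ptIdeal q c := by
      rw [← Ideal.Quotient.eq]
      have : (Ideal.Quotient.mkₐ K (ptIdeal q c)) =
          (Ideal.Quotient.mkₐ K (ptIdeal q c)).comp (aeval (fun j => C (q j) * X c)) := by
        apply MvPolynomial.algHom_ext
        intro j
        simp only [AlgHom.comp_apply, aeval_X]
        exact Ideal.Quotient.eq.2 (Ideal.subset_span ⟨j, rfl⟩)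
      exact congrArg (fun g => g f) this
    have hz : aeval (fun j => C (q j) * X c) f = (0 : MvPolynomial (Fin n) K) := by
      apply MvPolynomial.funext
      intro v
      have := hf' (v c)
      rw [map_zero, ← this]
      have e : (aeval v).comp (aeval (fun j => C (q j) * X c)) = (aeval (v c • q) :
          MvPolynomial (Fin n) K →ₐ[K] K) := by
        apply MvPolynomial.algHom_ext
        intro j
        simp [mul_comm]
      have := congrArg (fun g => g f) e
      simpa [aeval_eq_eval] using this
    rwa [hz, sub_zero] at key
  · rw [ptIdeal, Ideal.span_le]
    rintro _ ⟨j, rfl⟩ t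
    have h2 : p j = q j * p c := by rw [mul_comm]; exact congrFun hpq j
    simp only [ptGen, map_sub, eval_X, map_mul, eval_C, Pi.smul_apply, smul_eq_mul]
    rw [h2]; ring

section
variable {k : Type*} [Field k] {n : ℕ} (p : ℕ) [ExpChar k p] [PerfectRing k p] (E : ℕ)

/-- Cartier-type operator. -/
def cartier (e : Fin n →₀ ℕ) (f : MvPolynomial (Fin n) k) : MvPolynomial (Fin n) k :=
  ∑ μ ∈ f.support.image (fun ν => ν.mapRange (· / p ^ E) (by simp)),
    monomial μ ((iterateFrobeniusEquiv k p E).symm (coeff (p ^ E • μ + e) f))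

lemma coeff_cartier (e : Fin n →₀ ℕ) (he : ∀ i, e i < p ^ E) (f : MvPolynomial (Fin n) k)
    (μ : Fin n →₀ ℕ) : coeff μ (cartier p E e f) =
      (iterateFrobeniusEquiv k p E).symm (coeff (p ^ E • μ + e) f) := by
  classical
  have hq : 0 < p ^ E := pow_pos (expChar_pos k p) E
  rw [cartier, coeff_sum]
  simp only [coeff_monomial]
  rw [Finset.sum_ite_eq']
  split_ifs with h
  · rfl
  · have : coeff (p ^ E • μ + e) f = 0 := by
      by_contra h0
      apply h
      rw [Finset.mem_image]
      refine ⟨p ^ E • μ + e, mem_support_iff.2 h0, ?_⟩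
      ext i
      simp only [Finsupp.mapRange_apply, Finsupp.add_apply, Finsupp.smul_apply, smul_eq_mul]
      rw [Nat.mul_add_div hq, Nat.div_eq_of_lt (he i), add_zero]
    rw [this, map_zero]

lemma cartier_add (e : Fin n →₀ ℕ) (he : ∀ i, e i < p ^ E) (f g : MvPolynomial (Fin n) k) :
    cartier p E e (f + g) = cartier p E e f + cartier p E e g := by
  ext μ; simp [coeff_cartier p E e he]

lemma cartier_zero (e : Fin n →₀ ℕ) : cartier p E e (0 : MvPolynomial (Fin n) k) = 0 := by
  simp [cartier]

lemma cartier_pow_mul (e : Fin n →₀ ℕ) (he : ∀ i, e i < p ^ E) (h f : MvPolynomial (Fin n) k) :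
    cartier p E e (h ^ p ^ E * f) = h * cartier p E e f := by
  classical
  have hq : 0 < p ^ E := pow_pos (expChar_pos k p) E
  have : ExpChar (MvPolynomial (Fin n) k) p := inferInstance
  induction h using MvPolynomial.monomial_add_induction_on with
  | C a =>
    ext μ
    rw [← map_pow, coeff_cartier p E e he, coeff_C_mul, coeff_C_mul, map_mul, coeff_cartier p E e he]
    congr 1
    rw [RingEquiv.symm_apply_eq, iterateFrobeniusEquiv_apply, iterateFrobenius_def]
  | monomial_add μ a f' _ _ ih =>
    rw [add_pow_expChar_pow, add_mul, cartier_add p E e he, ih, add_mul]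
    congr 1
    ext μ'
    rw [monomial_pow, coeff_cartier p E e he, coeff_monomial_mul', coeff_monomial_mul',
      coeff_cartier p E e he]
    by_cases hle : μ ≤ μ'
    · have h1 : p ^ E • μ ≤ p ^ E • μ' + e := by
        intro i
        have := hle i
        simp only [Finsupp.add_apply, Finsupp.smul_apply, smul_eq_mul]
        exact le_trans (Nat.mul_le_mul_left _ this) (Nat.le_add_right _ _)
      have h2 : p ^ E • μ' + e - p ^ E • μ = p ^ E • (μ' - μ) + e := by
        ext i
        have := Nat.mul_le_mul_left (p ^ E) (hle i)
        simp only [Finsupp.add_apply, Finsupp.smul_apply, smul_eq_mul, Finsupp.tsub_apply,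
          Nat.mul_sub]
        omega
      rw [if_pos hle, if_pos h1, h2, map_mul]
      congr 1
      rw [RingEquiv.symm_apply_eq, iterateFrobeniusEquiv_apply, iterateFrobenius_def]
    · have h1 : ¬ p ^ E • μ ≤ p ^ E • μ' + e := by
        intro h1
        apply hle
        intro i
        have := h1 i
        simp only [Finsupp.add_apply, Finsupp.smul_apply, smul_eq_mul] at this
        have h3 : p ^ E * μ i < p ^ E * (μ' i + 1) := by
          have := he i; rw [Nat.mul_add]; omega
        have := Nat.lt_of_mul_lt_mul_left h3
        omega
      rw [if_neg hle, if_neg h1, map_zero]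

lemma cartier_sum (f : MvPolynomial (Fin n) k) :
    f = ∑ e : Fin n → Fin (p ^ E), monomial (Finsupp.equivFunOnFinite.symm fun i => (e i : ℕ)) 1 *
      (cartier p E (Finsupp.equivFunOnFinite.symm fun i => (e i : ℕ)) f) ^ p ^ E := by
  classical
  have hq : 0 < p ^ E := pow_pos (expChar_pos k p) E
  have : ExpChar (MvPolynomial (Fin n) k) p := inferInstance
  have he : ∀ e : Fin n → Fin (p ^ E), ∀ i, (Finsupp.equivFunOnFinite.symm fun i => (e i : ℕ)) i < p ^ E :=
    fun e i => by simp
  induction f using MvPolynomial.induction_on' with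
  | monomial ν b =>
    rw [Finset.sum_eq_single (fun i => ⟨ν i % p ^ E, Nat.mod_lt _ hq⟩)]
    · have : cartier p E (Finsupp.equivFunOnFinite.symm fun i => ν i % p ^ E) (monomial ν b)
        = monomial (ν.mapRange (· / p ^ E) (by simp)) ((iterateFrobeniusEquiv k p E).symm b) := by
        ext μ
        rw [coeff_cartier _ _ _ (fun i => by simpa using Nat.mod_lt _ hq), coeff_monomial, coeff_monomial]
        have : ν = p ^ E • μ + (Finsupp.equivFunOnFinite.symm fun i => ν i % p ^ E) ↔
          (ν.mapRange (· / p ^ E) (by simp)) = μ := by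
          rw [Finsupp.ext_iff, Finsupp.ext_iff]
          apply forall_congr'
          intro i
          simp only [Finsupp.add_apply, Finsupp.smul_apply, smul_eq_mul,
            Finsupp.equivFunOnFinite_symm_apply_apply, Finsupp.mapRange_apply]
          have h1 := Nat.div_add_mod (ν i) (p ^ E)
          constructor
          · intro h
            have : p ^ E * (ν i / p ^ E) = p ^ E * μ i := by omega
            exact Nat.eq_of_mul_eq_mul_left hq this
          · intro h; rw [← h]; exact h1.symm
        rw [apply_ite (iterateFrobeniusEquiv k p E).symm, map_zero]
        exact if_congr this rfl rfl
      simp only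
      rw [this, monomial_pow, monomial_mul, one_mul]
      congr 1
      · congr 1
        ext i
        simp only [Finsupp.add_apply, Finsupp.smul_apply, smul_eq_mul,
            Finsupp.equivFunOnFinite_symm_apply_apply, Finsupp.mapRange_apply]
        exact (Nat.mod_add_div _ _).symm
      · rw [← iterateFrobenius_def, ← iterateFrobeniusEquiv_apply, RingEquiv.apply_symm_apply]
    · intro e _ hne
      have : cartier p E (Finsupp.equivFunOnFinite.symm fun i => (e i : ℕ)) (monomial ν b) = 0 := by
        ext μ
        rw [coeff_cartier _ _ _ (he e), coeff_monomial, if_neg, map_zero, coeff_zero]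
        intro h
        apply hne
        ext i
        have := DFunLike.congr_fun h i
        simp only [Finsupp.add_apply, Finsupp.smul_apply, smul_eq_mul,
            Finsupp.equivFunOnFinite_symm_apply_apply] at this
        simp only [this]
        rw [Nat.mul_add_mod, Nat.mod_eq_of_lt (e i).2]
      rw [this, zero_pow hq.ne', mul_zero]
    · simp
  | add f g hf hg =>
    conv_lhs => rw [hf, hg]
    rw [← Finset.sum_add_distrib]
    refine Finset.sum_congr rfl fun e _ => ?_
    rw [cartier_add _ _ _ (he e), add_pow_expChar_pow, mul_add]

/-- Bracket power. -/
def brk (Q : ℕ) {A : Type*} [CommRing A] (J : Ideal A) : Ideal A := Ideal.span ((· ^ Q) '' (J : Set A))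

lemma mem_brk_iff (J : Ideal (MvPolynomial (Fin n) k)) (f : MvPolynomial (Fin n) k) :
    f ∈ brk (p ^ E) J ↔ ∀ e : Fin n →₀ ℕ, (∀ i, e i < p ^ E) → cartier p E e f ∈ J := by
  constructor
  · intro h e he
    refine Submodule.span_induction (p := fun f _ => ∀ g, cartier p E e (g * f) ∈ J)
      ?_ ?_ ?_ ?_ h 1 |> fun h => by simpa using h
    · rintro _ ⟨x, hx, rfl⟩ g
      simp only
      rw [mul_comm, cartier_pow_mul _ _ _ he]
      exact J.mul_mem_right _ hx
    · intro g; simp [cartier_zero]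
    · intro x y _ _ hx hy g
      rw [mul_add, cartier_add _ _ _ he]
      exact add_mem (hx g) (hy g)
    · intro a x _ hx g
      rw [smul_eq_mul, ← mul_assoc]; exact hx _
  · intro h
    rw [cartier_sum p E f]
    refine sum_mem fun e _ => Ideal.mul_mem_left _ _ (Ideal.subset_span ⟨_, h _ ?_, rfl⟩)
    intro i; simp

lemma mem_brk_iInf {ι : Type*} (J : ι → Ideal (MvPolynomial (Fin n) k)) (f : MvPolynomial (Fin n) k)
    (h : ∀ i, f ∈ brk (p ^ E) (J i)) : f ∈ brk (p ^ E) (⨅ i, J i) := by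
  rw [mem_brk_iff]
  intro e he
  rw [Ideal.mem_iInf]
  exact fun i => (mem_brk_iff p E _ _).1 (h i) e he

lemma mem_of_pow_mem_brk (J : Ideal (MvPolynomial (Fin n) k)) (f : MvPolynomial (Fin n) k)
    (h : f ^ p ^ E ∈ brk (p ^ E) J) : f ∈ J := by
  have hq : 0 < p ^ E := pow_pos (expChar_pos k p) E
  have h1 := (mem_brk_iff p E _ _).1 h 0 (fun _ => by simpa using hq)
  rw [← mul_one (f ^ p ^ E), cartier_pow_mul _ _ _ (fun _ => by simpa using hq)] at h1
  have : cartier p E 0 (1 : MvPolynomial (Fin n) k) = 1 := by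
    classical
    ext μ
    rw [coeff_cartier _ _ _ (fun _ => by simpa using hq), coeff_one, coeff_one, apply_ite (iterateFrobeniusEquiv k p E).symm]
    simp only [map_one, map_zero, add_zero]
    refine if_congr ?_ rfl rfl
    constructor
    · intro h
      ext i
      have := DFunLike.congr_fun h i
      simp at this
      rcases this with h | h 
      · exact absurd h.1 (expChar_pos k p).ne'
      · simp [h]
    · rintro rfl; simp
  rwa [this, mul_one] at h1
end

lemma pigeon {A : Type*} [CommRing A] {N : ℕ} (hN : 1 ≤ N) (g : Fin N → A) (Q m : ℕ) (hQ : 0 < Q) :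
    Ideal.span (Set.range g) ^ (N * Q * m) ≤ brk Q (Ideal.span (Set.range g) ^ m) := by
  classical
  rcases Nat.eq_zero_or_pos m with rfl | hm
  · have : brk Q (Ideal.span (Set.range g) ^ 0) = ⊤ := by
      rw [Ideal.eq_top_iff_one]
      exact Ideal.subset_span ⟨1, by simp, by simp⟩
    rw [this]; exact le_top
  rw [Ideal.span, Submodule.span_pow]
  rw [← Ideal.span, Ideal.span_le]
  intro a ha
  obtain ⟨w, hw⟩ := Set.mem_pow.1 ha
  choose v hv using fun l => (w l).2
  set ν : Fin N → ℕ := fun j => (Finset.univ.filter (fun l => v l = j)).card with hν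
  have h1 : a = ∏ j, g j ^ ν j := by
    rw [← hw, List.prod_ofFn]
    simp only [← hv]
    rw [Finset.prod_comp g v]
    refine Finset.prod_subset (Finset.subset_univ _) ?_
    intro j _ hj
    have : ν j = 0 := by
      rw [hν]; simp only [Finset.card_eq_zero]
      rw [Finset.filter_eq_empty_iff]
      intro l _ h
      exact hj (Finset.mem_image.2 ⟨l, Finset.mem_univ _, h⟩)
    simp only [hν] at this
    rw [this, pow_zero]
  have h2 : ∑ j, ν j = N * Q * m := by
    have := Finset.card_eq_sum_card_fiberwise (f := v) (s := Finset.univ) (t := Finset.univ) (by simp)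
    simp only [Finset.card_univ, Fintype.card_fin] at this
    rw [this]
  have h3 : m ≤ ∑ j, ν j / Q := by
    by_contra hlt
    push Not at hlt
    have h4 : ∑ j, ν j = Q * ∑ j, ν j / Q + ∑ j, ν j % Q := by
      rw [Finset.mul_sum, ← Finset.sum_add_distrib]
      exact Finset.sum_congr rfl fun j _ => (Nat.div_add_mod _ _).symm
    have h5 : ∑ j, ν j % Q < N * Q := by
      calc ∑ j, ν j % Q < ∑ j : Fin N, Q := by
            apply Finset.sum_lt_sum_of_nonempty
            · exact ⟨⟨0, hN⟩, Finset.mem_univ _⟩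
            · intro j _; exact Nat.mod_lt _ hQ
        _ = N * Q := by simp
    have h6 : Q * ∑ j, ν j / Q ≤ Q * (m - 1) := Nat.mul_le_mul_left _ (by omega)
    obtain ⟨m', rfl⟩ : ∃ m', m = m' + 1 := ⟨m - 1, by omega⟩
    simp only [Nat.add_sub_cancel] at h6
    have : N * Q * (m' + 1) = N * Q * m' + N * Q := by ring
    have : Q * m' ≤ N * Q * m' := by
      apply Nat.mul_le_mul_right; nlinarith
    omega
  rw [h1]
  have h7 : ∏ j, g j ^ ν j = (∏ j, g j ^ (ν j / Q)) ^ Q * ∏ j, g j ^ (ν j % Q) := by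
    rw [← Finset.prod_pow, ← Finset.prod_mul_distrib]
    refine Finset.prod_congr rfl fun j _ => ?_
    rw [← pow_mul, ← pow_add, mul_comm, Nat.div_add_mod]
  rw [h7]
  refine Ideal.mul_mem_right _ _ (Ideal.subset_span ⟨_, ?_, rfl⟩)
  refine Ideal.pow_le_pow_right h3 ?_
  rw [← Finset.prod_pow_eq_pow_sum]
  exact Ideal.prod_mem_prod fun j _ => Ideal.pow_mem_pow
    (Ideal.subset_span (Set.mem_range_self j)) _

lemma ptIdeal_eq_span {S : Type*} [CommRing S] {N : ℕ} (q : Fin (N+1) → S) (c : Fin (N+1)) (hq : q c = 1) :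
    ptIdeal q c = Ideal.span (Set.range fun j : Fin N => ptGen q c (c.succAbove j)) := by
  apply le_antisymm
  · rw [ptIdeal, Ideal.span_le]
    rintro _ ⟨j, rfl⟩
    rcases Fin.eq_self_or_eq_succAbove c j with rfl | ⟨j, rfl⟩
    · rw [ptGen_self q _ hq]; exact Ideal.zero_mem _
    · exact Ideal.subset_span ⟨j, rfl⟩
  · rw [ptIdeal]
    apply Ideal.span_mono
    rintro _ ⟨j, rfl⟩; exact ⟨_, rfl⟩

/-- Containment theorem in positive characteristic. -/
lemma charp_containment {k : Type*} [Field k] (p : ℕ) [Fact p.Prime] [CharP k p] [PerfectRing k p]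
    {N s : ℕ} (hN : 1 ≤ N) (q : Fin s → Fin (N+1) → k) (c : Fin s → Fin (N+1))
    (hq : ∀ i, q i (c i) = 1) (m : Fin s → ℕ) (a r : ℕ) (hr : 0 < r) (har : N * r < a)
    (f : MvPolynomial (Fin (N+1)) k)
    (hf : ∀ i, f ∈ ptIdeal (q i) (c i) ^ (a * m i)) :
    f ∈ (⨅ i, ptIdeal (q i) (c i) ^ m i) ^ r := by
  have hp : p.Prime := Fact.out
  have : ExpChar k p := ExpChar.prime hp
  obtain ⟨E, hE⟩ : ∃ E, N * r * r ≤ p ^ E := ⟨N * r * r, (Nat.lt_pow_self hp.one_lt).le⟩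
  set Q := p ^ E with hQ
  have hQ0 : 0 < Q := pow_pos hp.pos _
  set u := Q / r with hu
  have hu1 : u * r ≤ Q := Nat.div_mul_le_self _ _
  have hu2 : N * Q ≤ a * u := by
    have h1 : Q < r * u + r := by
      have := Nat.div_add_mod Q r
      rw [← hu] at this
      have := Nat.mod_lt Q hr
      omega
    have h3 : N * r ≤ u := by
      rw [hu, Nat.le_div_iff_mul_le hr]; exact hE
    nlinarith
  set I := ⨅ i, ptIdeal (q i) (c i) ^ m i with hI
  have h1 : f ^ u ∈ brk Q I := by
    rw [hI, hQ]
    apply mem_brk_iInf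
    intro i
    rw [← hQ]
    have h2 := pigeon hN (fun j : Fin N => ptGen (q i) (c i) ((c i).succAbove j)) Q (m i) hQ0
    rw [← ptIdeal_eq_span _ _ (hq i)] at h2
    apply h2
    have h3 := Ideal.pow_mem_pow (hf i) u
    rw [← pow_mul] at h3
    refine Ideal.pow_le_pow_right ?_ h3
    calc N * Q * m i ≤ a * u * m i := Nat.mul_le_mul_right _ hu2
      _ = _ := by ring
  apply mem_of_pow_mem_brk p E
  rw [← hQ]
  have h2 : brk Q I ^ r ≤ brk Q (I ^ r) := by
    rw [brk, Ideal.span, Submodule.span_pow, ← Ideal.span, Ideal.span_le]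
    intro x hx
    obtain ⟨w, hw⟩ := Set.mem_pow.1 hx
    choose v hv using fun l => (w l).2
    rw [← hw, List.prod_ofFn]
    refine Ideal.subset_span ⟨∏ l, v l, ?_, ?_⟩
    · have : ∏ l : Fin r, v l ∈ ∏ l : Fin r, I := Ideal.prod_mem_prod fun l _ => (hv l).1
      simpa using this
    · simp only
      rw [← Finset.prod_pow]
      exact Finset.prod_congr rfl fun l _ => (hv l).2
  have h3 : f ^ Q = (f ^ u) ^ r * f ^ (Q - u * r) := by
    rw [← pow_mul, ← pow_add]; congr 1; omega
  rw [h3]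
  exact Ideal.mul_mem_right _ _ (h2 (Ideal.pow_mem_pow h1 r))

section
variable {S : Type*} [CommRing S] {n : ℕ}

/-- Homogeneous ideals. -/
def HomI (I : Ideal (MvPolynomial (Fin n) S)) : Prop :=
  ∀ f ∈ I, ∀ d, homogeneousComponent d f ∈ I

attribute [local instance] MvPolynomial.gradedAlgebra

lemma homI_iff (I : Ideal (MvPolynomial (Fin n) S)) :
    HomI I ↔ I.IsHomogeneous (homogeneousSubmodule (Fin n) S) := by
  constructor
  · intro h d f hf
    have := h f hf d
    rw [← MvPolynomial.decomposition.decompose'_apply] at this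
    exact this
  · intro h f hf d
    have := h d hf
    rw [← MvPolynomial.decomposition.decompose'_apply]
    exact this

lemma HomI.mul {I J : Ideal (MvPolynomial (Fin n) S)} (hI : HomI I) (hJ : HomI J) : HomI (I * J) := by
  rw [homI_iff] at *; exact hI.mul hJ

lemma HomI.top : HomI (⊤ : Ideal (MvPolynomial (Fin n) S)) := fun _ _ _ => trivial

lemma HomI.pow {I : Ideal (MvPolynomial (Fin n) S)} (hI : HomI I) (r : ℕ) : HomI (I ^ r) := by
  induction r with
  | zero => rw [pow_zero, Ideal.one_eq_top]; exact HomI.top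
  | succ r ih => rw [pow_succ]; exact ih.mul hI

lemma HomI.iInf {ι : Type*} {I : ι → Ideal (MvPolynomial (Fin n) S)} (hI : ∀ i, HomI (I i)) :
    HomI (⨅ i, I i) := by
  intro f hf d
  rw [Ideal.mem_iInf] at *
  exact fun i => hI i f (hf i) d

lemma HomI.inf {I J : Ideal (MvPolynomial (Fin n) S)} (hI : HomI I) (hJ : HomI J) :
    HomI (I ⊓ J) := fun f hf d => ⟨hI f hf.1 d, hJ f hf.2 d⟩

lemma HomI.sup {I J : Ideal (MvPolynomial (Fin n) S)} (hI : HomI I) (hJ : HomI J) :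
    HomI (I ⊔ J) := by
  rw [homI_iff] at *; exact hI.sup hJ

lemma HomI.span {s : Set (MvPolynomial (Fin n) S)} (h : ∀ f ∈ s, ∃ d, f.IsHomogeneous d) :
    HomI (Ideal.span s) := by
  rw [homI_iff]
  apply Ideal.homogeneous_span
  intro f hf
  obtain ⟨d, hd⟩ := h f hf
  exact ⟨d, hd⟩

lemma ptGen_hom (q : Fin n → S) (c j : Fin n) : (ptGen q c j).IsHomogeneous 1 := by
  unfold ptGen
  refine IsHomogeneous.sub (isHomogeneous_X _ _) ?_
  have := (isHomogeneous_C (Fin n) (q j)).mul (isHomogeneous_X S c)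
  simpa using this

lemma ptIdeal_homI (q : Fin n → S) (c : Fin n) : HomI (ptIdeal q c) := by
  apply HomI.span
  rintro _ ⟨j, rfl⟩
  exact ⟨1, ptGen_hom q c j⟩

lemma mem_of_homComps {I : Ideal (MvPolynomial (Fin n) S)} {f : MvPolynomial (Fin n) S}
    (h : ∀ d, homogeneousComponent d f ∈ I) : f ∈ I := by
  rw [← sum_homogeneousComponent f]
  exact sum_mem fun d _ => h d

/-- The irrelevant ideal. -/
abbrev irr (S : Type*) [CommRing S] (n : ℕ) : Ideal (MvPolynomial (Fin n) S) :=
  idealOfVars (Fin n) S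

lemma irr_homI : HomI (irr S n) := by
  apply HomI.span
  rintro _ ⟨j, rfl⟩
  exact ⟨1, isHomogeneous_X _ _⟩

lemma mem_irr_pow_of_hom {f : MvPolynomial (Fin n) S} {d t : ℕ} (hf : f.IsHomogeneous d) (h : t ≤ d) :
    f ∈ irr S n ^ t := by
  rw [mem_pow_idealOfVars_iff']
  intro μ hμ
  exact hf.coeff_eq_zero (by omega)

lemma homComp_eq_zero_of_mem_irr {f : MvPolynomial (Fin n) S} {d t : ℕ} (hf : f ∈ irr S n ^ t) (h : d < t) :
    homogeneousComponent d f = 0 := by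
  rw [mem_pow_idealOfVars_iff'] at hf
  ext μ
  rw [coeff_homogeneousComponent, coeff_zero]
  split_ifs with h1
  · exact hf μ (by omega)
  · rfl

lemma ptIdeal_le_irr (q : Fin n → S) (c : Fin n) : ptIdeal q c ≤ irr S n := by
  rw [ptIdeal, Ideal.span_le]
  rintro _ ⟨j, rfl⟩
  have : ptGen q c j ∈ irr S n ^ 1 := mem_irr_pow_of_hom (ptGen_hom q c j) le_rfl
  simpa using this

lemma homComp_mul_hom {g h : MvPolynomial (Fin n) S} {d : ℕ} (hh : h.IsHomogeneous d) (t : ℕ) :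
    homogeneousComponent (t + d) (g * h) = homogeneousComponent t g * h := by
  conv_lhs => rw [← sum_homogeneousComponent g, Finset.sum_mul, map_sum]
  have h1 : ∀ i, homogeneousComponent (t + d) (homogeneousComponent i g * h) =
      if i = t then homogeneousComponent t g * h else 0 := by
    intro i
    rw [homogeneousComponent_of_mem (m := t + d) (n := i + d) ((homogeneousComponent_isHomogeneous i g).mul hh)]
    split_ifs with h1 h2 h2
    · rw [h2]
    · omega
    · omega
    · rfl
  simp only [h1]
  rw [Finset.sum_ite_eq']
  split_ifs with h2
  · rfl
  · rw [homogeneousComponent_eq_zero, zero_mul]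
    simp at h2; omega
end

section
variable {k : Type*} [Field k] {n : ℕ}

lemma finrank_hom (N t : ℕ) : Module.finrank k (homogeneousSubmodule (Fin (N+1)) k t) = (t + N).choose N := by
  classical
  rw [homogeneousSubmodule_eq_finsupp_supported]
  have hs : {d : Fin (N+1) →₀ ℕ | d.degree = t} = ↑((Finset.univ : Finset (Fin (N+1))).finsuppAntidiag t) := by
    ext d
    simp [Finset.mem_finsuppAntidiag, Finsupp.degree_eq_sum]
  rw [hs]
  have e : (AddMonoidAlgebra.supported k k
    (↑((Finset.univ : Finset (Fin (N+1))).finsuppAntidiag t) : Set (Fin (N+1) →₀ ℕ))) ≃ₗ[k]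
     (((Finset.univ : Finset (Fin (N+1))).finsuppAntidiag t) →₀ k) :=
    AddMonoidAlgebra.supportedEquivFinsupp _
  rw [e.finrank_eq, Module.finrank_finsupp_self, Fintype.card_coe, Finset.card_finsuppAntidiag_nat_eq_choose]
  simp
  rw [add_comm N t]
  exact Nat.choose_symm_add

instance finDim_hom (t : ℕ) : FiniteDimensional k (homogeneousSubmodule (Fin n) k t) :=
  Module.Finite.iff_fg.2 (homogeneousSubmodule_fg _ _ _)

lemma comp_span (I : Ideal (MvPolynomial (Fin n) k)) (hI : HomI I) (r : ℕ) :
    ∀ F ∈ I ^ (r + 1), ∀ t, homogeneousComponent t F ∈ Submodule.span k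
      {g : MvPolynomial (Fin n) k | g.IsHomogeneous t ∧ ∃ b : Fin (r + 1) → MvPolynomial (Fin n) k,
        (∀ l, b l ∈ I ∧ (b l).totalDegree ≤ t) ∧ g = ∏ l, b l} := by
  induction r with
  | zero =>
    intro F hF t
    apply Submodule.subset_span
    refine ⟨homogeneousComponent_isHomogeneous _ _, fun _ => homogeneousComponent t F, fun _ => ⟨?_, ?_⟩, by simp⟩
    · exact hI F (by simpa using hF) t
    · exact (homogeneousComponent_isHomogeneous _ _).totalDegree_le
  | succ r ih =>
    intro F hF t
    rw [pow_succ] at hF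
    refine Submodule.mul_induction_on hF ?_ ?_
    · intro u hu v hv
      rw [← sum_homogeneousComponent v, Finset.mul_sum, map_sum]
      refine sum_mem fun d _ => ?_
      have hvd := homogeneousComponent_isHomogeneous d v
      rcases le_or_gt d t with hd | hd
      · obtain ⟨e, rfl⟩ := Nat.exists_eq_add_of_le' hd
        rw [homComp_mul_hom hvd]
        refine Submodule.span_induction (p := fun x _ => x * (homogeneousComponent d v) ∈ _) ?_ ?_ ?_ ?_ (ih u hu e)
        · rintro x ⟨hx, b, hb, rfl⟩
          apply Submodule.subset_span
          refine ⟨hx.mul hvd, Fin.snoc b (homogeneousComponent d v), ?_, ?_⟩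
          · intro l
            refine Fin.lastCases ?_ (fun l => ?_) l
            · simp only [Fin.snoc_last]
              exact ⟨hI v hv d, hvd.totalDegree_le.trans (by omega)⟩
            · simp only [Fin.snoc_castSucc]
              exact ⟨(hb l).1, (hb l).2.trans (by omega)⟩
          · rw [Fin.prod_snoc]
        · simp
        · intro x y _ _ hx hy; rw [add_mul]; exact add_mem hx hy
        · intro a x _ hx; rw [smul_mul_assoc]; exact Submodule.smul_mem _ _ hx
      · have : homogeneousComponent t (u * homogeneousComponent d v) = 0 := by
          apply homComp_eq_zero_of_mem_irr (t := d) _ hd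
          exact Ideal.mul_mem_left _ _ (mem_irr_pow_of_hom hvd le_rfl)
        rw [this]; exact zero_mem _
    · intro x y hx hy
      rw [map_add]; exact add_mem hx hy

lemma bounded_sol {N : ℕ} (I : Ideal (MvPolynomial (Fin (N+1)) k)) (hI : HomI I) (r : ℕ) (hr : 0 < r)
    (f : MvPolynomial (Fin (N+1)) k) (t : ℕ) (hf : f.IsHomogeneous t) (hfI : f ∈ I ^ r) :
    ∃ (b : Fin ((t + N).choose N) → Fin r → MvPolynomial (Fin (N+1)) k) (cc : Fin ((t + N).choose N) → k),
      (∀ j l, b j l ∈ I ∧ (b j l).totalDegree ≤ t) ∧ f = ∑ j, C (cc j) * ∏ l, b j l := by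
  classical
  obtain ⟨r, rfl⟩ : ∃ r', r = r' + 1 := ⟨r - 1, by omega⟩
  have h1 := comp_span I hI r f hfI t
  rw [homogeneousComponent_eq_self hf] at h1
  set Sset := {g : MvPolynomial (Fin (N+1)) k | g.IsHomogeneous t ∧ ∃ b : Fin (r + 1) → MvPolynomial (Fin (N+1)) k,
        (∀ l, b l ∈ I ∧ (b l).totalDegree ≤ t) ∧ g = ∏ l, b l} with hS
  obtain ⟨B, hBS, hspan, hli⟩ := exists_linearIndependent k Sset
  rw [← hspan] at h1
  set D := (t + N).choose N
  have hW : ∀ x : B, x.1 ∈ homogeneousSubmodule (Fin (N+1)) k t := fun x => (hBS x.2).1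
  have hli' : LinearIndependent k (fun x : B => (⟨x.1, hW x⟩ : homogeneousSubmodule (Fin (N+1)) k t)) := by
    apply LinearIndependent.of_comp (homogeneousSubmodule (Fin (N+1)) k t).subtype
    exact hli
  have hfin : Finite B := hli'.finite
  have : Fintype B := Fintype.ofFinite B
  have hcard : Fintype.card B ≤ D := by
    have := hli'.fintype_card_le_finrank
    rwa [finrank_hom] at this
  obtain ⟨e⟩ : Nonempty (B ↪ Fin D) := by
    apply Function.Embedding.nonempty_of_card_le; simpa using hcard
  choose b hb1 hb2 using fun x : B => (hBS x.2).2
  obtain ⟨c, hc⟩ : ∃ c : B → k, ∑ x, c x • x.1 = f := by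
    rw [← Submodule.mem_span_range_iff_exists_fun]
    simpa using h1
  refine ⟨fun j l => if h : ∃ x, e x = j then b h.choose l else 0,
    fun j => if h : ∃ x, e x = j then c h.choose else 0, ?_, ?_⟩
  · intro j l
    dsimp only
    split_ifs with h
    · exact hb1 _ _
    · simp
  · rw [← hc]
    have key : ∀ x : B, (⟨x, rfl⟩ : ∃ y, e y = e x).choose = x := fun x =>
      e.injective (⟨x, rfl⟩ : ∃ y, e y = e x).choose_spec
    rw [← Finset.sum_subset (Finset.subset_univ (Finset.univ.map e))]
    · rw [Finset.sum_map]
      refine Finset.sum_congr rfl fun x _ => ?_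
      have hx : ∃ y, e y = e x := ⟨x, rfl⟩
      simp only [dif_pos hx]
      rw [key x, ← hb2, smul_eq_C_mul]
    · intro j _ hj
      have : ¬ ∃ x, e x = j := by simpa using hj
      simp [this]
end

lemma jac_int : IsJacobsonRing ℤ := by
  rw [isJacobsonRing_iff_prime_eq]
  intro P hP
  by_cases h : P = ⊥
  · subst h
    rw [eq_bot_iff]
    intro x hx
    rw [Ideal.mem_jacobson_iff] at hx
    by_contra hx0
    have hx0 : x ≠ 0 := hx0
    obtain ⟨z, hz⟩ := hx (2 * x)
    simp only [Ideal.mem_bot] at hz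
    have h1 : z * (2 * x * x + 1) = 1 := by linarith
    have h2 := Int.isUnit_iff.1 (IsUnit.of_mul_eq_one _ (by rw [mul_comm]; exact h1) : IsUnit (2 * x * x + 1))
    have h3 : 0 < x * x := mul_self_pos.2 hx0
    rcases h2 with h2 | h2 <;> nlinarith
  · have := hP.isMaximal h
    exact Ideal.jacobson_eq_self_of_isMaximal

lemma char_ne_zero_of_ft (F : Type*) [Field F] (f : ℤ →+* F) (hF : f.FiniteType) (p : ℕ) [CharP F p] : p ≠ 0 := by
  have := jac_int
  rintro rfl
  have : CharZero F := CharP.charP_to_charZero F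
  have hF' : Algebra.FiniteType ℤ F := by
    rw [Subsingleton.elim f (algebraMap ℤ F)] at hF
    rwa [RingHom.finiteType_algebraMap] at hF
  have hfin : Module.Finite ℤ F := finite_of_finite_type_of_isJacobsonRing ℤ F
  have hint : Algebra.IsIntegral ℤ F := inferInstance
  have := isField_of_isIntegral_of_isField (R := ℤ) (S := F) (RingHom.injective_int _) (Field.toIsField F)
  exact Int.not_isField this

universe uA in
lemma exists_charp {A : Type uA} [CommRing A] [IsDomain A] (hft : Algebra.FiniteType ℤ A) (h : A) (h0 : h ≠ 0) :
    ∃ (k : Type uA) (_ : Field k) (p : ℕ) (_ : Fact p.Prime) (_ : CharP k p) (_ : PerfectRing k p)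
      (φ : A →+* k), φ h ≠ 0 := by
  have := jac_int
  let B := Localization.Away h
  have hB : Algebra.FiniteType A B := IsLocalization.finiteType_of_monoid_fg (Submonoid.powers h) B
  have hB' : Algebra.FiniteType ℤ B := Algebra.FiniteType.trans hft hB
  have hnt : Nontrivial B := by
    have : Function.Injective (algebraMap A B) := IsLocalization.injective B
      (powers_le_nonZeroDivisors_of_noZeroDivisors h0)
    exact this.nontrivial
  obtain ⟨M, hM⟩ := Ideal.exists_maximal B
  let F := B ⧸ M
  let : Field F := Ideal.Quotient.field M
  obtain ⟨p, hp⟩ := CharP.exists F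
  have hp0 : p ≠ 0 := by
    have h1 : (algebraMap ℤ B).FiniteType := RingHom.finiteType_algebraMap.2 hB'
    exact char_ne_zero_of_ft F ((Ideal.Quotient.mk M).comp (algebraMap ℤ B))
      ((RingHom.FiniteType.of_surjective _ Ideal.Quotient.mk_surjective).comp h1) p
  have : Fact p.Prime := ⟨(CharP.char_is_prime_or_zero F p).resolve_right hp0⟩
  have : CharP (AlgebraicClosure F) p := charP_of_injective_algebraMap (algebraMap F _).injective p
  refine ⟨AlgebraicClosure F, inferInstance, p, inferInstance, inferInstance, ?_, 
    (algebraMap F (AlgebraicClosure F)).comp ((Ideal.Quotient.mk M).comp (algebraMap A B)), ?_⟩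
  · have : ExpChar (AlgebraicClosure F) p := ExpChar.prime Fact.out
    exact PerfectField.toPerfectRing p
  · have hu : IsUnit (algebraMap A B h) := IsLocalization.Away.algebraMap_isUnit h
    exact ((hu.map (Ideal.Quotient.mk M)).map (algebraMap F (AlgebraicClosure F))).ne_zero

lemma exists_hom {A : Type*} [CommRing A] [IsDomain A] {K : Type*} [Field K] [IsAlgClosed K] [Algebra A K]
    (hAK : Function.Injective (algebraMap A K)) {B : Type*} [CommRing B] [Algebra A B]
    (hB : Algebra.FiniteType A B) (hAB : Function.Injective (algebraMap A B)) :
    Nonempty (B →ₐ[A] K) := by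
  let E := FractionRing A
  let : Algebra E K := (IsFractionRing.lift hAK : E →+* K).toAlgebra
  have : IsScalarTower A E K := by
    apply IsScalarTower.of_algebraMap_eq
    intro x
    exact (IsFractionRing.lift_algebraMap hAK x).symm
  have : Module.Flat A E := IsLocalization.flat E (nonZeroDivisors A)
  have : Module.Flat A K := Module.Flat.trans A E K
  have hinj := Algebra.TensorProduct.includeLeft_injective (R := A) (S := A) (A := K) hAB
  have : Nontrivial (TensorProduct A K B) := hinj.nontrivial
  obtain ⟨M, hM⟩ := Ideal.exists_maximal (TensorProduct A K B)
  let F := TensorProduct A K B ⧸ M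
  let : Field F := Ideal.Quotient.field M
  have hF : Algebra.FiniteType K F := inferInstanceAs (Algebra.FiniteType K (TensorProduct A K B ⧸ M))
  have hfin : Module.Finite K F := finite_of_finite_type_of_isJacobsonRing K F
  have : Algebra.IsAlgebraic K F := inferInstance
  let ψ : F →ₐ[K] K := IsAlgClosed.lift
  exact ⟨((ψ.restrictScalars A).comp ((Ideal.Quotient.mkₐ A M))).comp Algebra.TensorProduct.includeRight⟩

lemma lift_poly {A B : Type*} [CommRing A] [CommRing B] (φ : A →+* B) {n : ℕ} (f : MvPolynomial (Fin n) B)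
    (h : ∀ μ, coeff μ f ∈ φ.range) : ∃ g, map φ g = f := by
  choose a ha using h
  refine ⟨∑ μ ∈ f.support, monomial μ (a μ), ?_⟩
  rw [map_sum]
  conv_rhs => rw [f.as_sum]
  exact Finset.sum_congr rfl fun μ _ => by rw [map_monomial, ha]

lemma tdeg_map_le {A B : Type*} [CommRing A] [CommRing B] (φ : A →+* B) {n : ℕ} (f : MvPolynomial (Fin n) A) :
    (map φ f).totalDegree ≤ f.totalDegree := Finset.sup_mono (support_map_subset φ f)

lemma tdeg_map_inj {A B : Type*} [CommRing A] [CommRing B] {φ : A →+* B} (hφ : Function.Injective φ)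
    {n : ℕ} (f : MvPolynomial (Fin n) A) :
    (map φ f).totalDegree = f.totalDegree := by
  rw [totalDegree, totalDegree, support_map_of_injective _ hφ]

lemma pi_poly {ι : Type*} {k : ι → Type*} [∀ i, CommRing (k i)] {n : ℕ} (t : ℕ)
    (b : ∀ i, MvPolynomial (Fin n) (k i)) (hb : ∀ i, (b i).totalDegree ≤ t) :
    ∃ g : MvPolynomial (Fin n) (∀ i, k i), g.totalDegree ≤ t ∧ ∀ i, map (Pi.evalRingHom k i) g = b i := by
  classical
  let S : Finset (Fin n →₀ ℕ) := (Finset.range (t+1)).biUnion fun d => Finset.univ.finsuppAntidiag d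
  have hS : ∀ μ : Fin n →₀ ℕ, μ ∈ S ↔ μ.degree ≤ t := by
    intro μ
    simp [S, Finset.mem_finsuppAntidiag, Finsupp.degree_eq_sum]
  refine ⟨∑ μ ∈ S, monomial μ (fun i => coeff μ (b i)), ?_, ?_⟩
  · refine totalDegree_finsetSum_le fun μ hμ => ?_
    refine (totalDegree_monomial_le _ _).trans ?_
    exact (hS μ).1 hμ
  · intro i
    ext μ
    rw [coeff_map, coeff_sum]
    simp only [coeff_monomial]
    rw [Finset.sum_ite_eq']
    split_ifs with h
    · rfl
    · rw [map_zero]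
      symm
      apply coeff_eq_zero_of_totalDegree_lt
      have : ¬ μ.degree ≤ t := fun h' => h ((hS μ).2 h')
      have h2 := hb i
      simp only [Finsupp.degree] at this
      change (b i).totalDegree < ∑ x ∈ μ.support, μ x
      have h3 : μ.degree = ∑ x ∈ μ.support, μ x := rfl
      change ¬ μ.degree ≤ t at this
      omega

/-- Bounded solutions. -/
def Sol {T : Type*} [CommRing T] {N s : ℕ} (q : Fin s → Fin (N+1) → T) (c : Fin s → Fin (N+1))
    (m : Fin s → ℕ) (r t D : ℕ) (f : MvPolynomial (Fin (N+1)) T) : Prop :=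
  ∃ (b : Fin D → Fin r → MvPolynomial (Fin (N+1)) T) (cc : Fin D → T),
    (∀ j l i, b j l ∈ ptIdeal (q i) (c i) ^ m i) ∧ (∀ j l, (b j l).totalDegree ≤ t) ∧
    f = ∑ j, C (cc j) * ∏ l, b j l

lemma Sol.map {T T' : Type*} [CommRing T] [CommRing T'] (φ : T →+* T') {N s : ℕ}
    {q : Fin s → Fin (N+1) → T} {c : Fin s → Fin (N+1)}
    {m : Fin s → ℕ} {r t D : ℕ} {f : MvPolynomial (Fin (N+1)) T} (h : Sol q c m r t D f) :
    Sol (fun i => φ ∘ q i) c m r t D (MvPolynomial.map φ f) := by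
  obtain ⟨b, cc, h1, h2, h3⟩ := h
  refine ⟨fun j l => MvPolynomial.map φ (b j l), fun j => φ (cc j), ?_, ?_, ?_⟩
  · intro j l i
    exact map_ptIdeal_pow _ _ φ (h1 j l i)
  · intro j l
    exact (tdeg_map_le _ _).trans (h2 j l)
  · rw [h3]; simp [map_sum, map_prod]

lemma Sol.pi {ι : Type*} {k : ι → Type*} [∀ i, CommRing (k i)] {N s : ℕ}
    {q : Fin s → Fin (N+1) → (∀ i, k i)} {c : Fin s → Fin (N+1)} (hq : ∀ i, q i (c i) = 1)
    {m : Fin s → ℕ} {r t D : ℕ} {f : MvPolynomial (Fin (N+1)) (∀ i, k i)}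
    (h : ∀ x, Sol (fun i => Pi.evalRingHom k x ∘ q i) c m r t D (MvPolynomial.map (Pi.evalRingHom k x) f)) :
    Sol q c m r t D f := by
  choose b cc h1 h2 h3 using h
  choose B hB1 hB2 using fun j l => pi_poly t (fun x => b x j l) (fun x => h2 x j l)
  refine ⟨B, fun j x => cc x j, ?_, hB1, ?_⟩
  · intro j l i
    apply mem_ptIdeal_pow_of_family (q i) (c i) (fun x => Pi.evalRingHom k x) _ (hq i)
    · intro x
      rw [hB2]; exact h1 x j l i
    · intro a ha
      ext x; exact ha x
  · ext μ x
    have := congrArg (coeff μ) (h3 x)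
    rw [coeff_map] at this
    change Pi.evalRingHom k x (coeff μ f) = Pi.evalRingHom k x (coeff μ _)
    rw [this, ← coeff_map]
    congr 1
    simp only [map_sum, map_mul, map_prod, map_C, hB2]
    rfl

lemma Sol.descend {A : Type*} [CommRing A] [IsDomain A] {K : Type*} [Field K] [IsAlgClosed K] [Algebra A K]
    (hAK : Function.Injective (algebraMap A K)) {P : Type*} [CommRing P] (ψ : A →+* P)
    (hψ : Function.Injective ψ) {N s : ℕ} {q : Fin s → Fin (N+1) → A} {c : Fin s → Fin (N+1)}
    (hq : ∀ i, q i (c i) = 1)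
    {m : Fin s → ℕ} {r t D : ℕ} {f : MvPolynomial (Fin (N+1)) A}
    (h : Sol (fun i => ψ ∘ q i) c m r t D (MvPolynomial.map ψ f)) :
    Sol (fun i => algebraMap A K ∘ q i) c m r t D (MvPolynomial.map (algebraMap A K) f) := by
  classical
  let : Algebra A P := ψ.toAlgebra
  obtain ⟨b, cc, h1, h2, h3⟩ := h
  let S : Set P := (⋃ j, ⋃ l, (fun μ => coeff μ (b j l)) '' ((b j l).support : Set _)) ∪ Set.range cc
  have hSf : S.Finite := by
    refine Set.Finite.union ?_ (Set.finite_range _)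
    refine Set.finite_iUnion fun j => Set.finite_iUnion fun l => ?_
    exact (Finset.finite_toSet _).image _
  let B := Algebra.adjoin A S
  have hB : Algebra.FiniteType A B := by
    rw [← Subalgebra.fg_iff_finiteType]
    exact ⟨hSf.toFinset, by simp [B]⟩
  have hval : Function.Injective (B.val : B →+* P) := Subtype.val_injective
  have hAB : Function.Injective (algebraMap A B) := by
    intro x y hxy
    apply hψ
    exact congrArg Subtype.val hxy
  obtain ⟨χ⟩ := exists_hom hAK hB hAB
  have hcomp : (B.val : B →+* P).comp (algebraMap A B) = ψ := rfl
  have hSol : Sol (fun i => algebraMap A B ∘ q i) c m r t D (MvPolynomial.map (algebraMap A B) f) := by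
    have hlift : ∀ j l, ∃ g, MvPolynomial.map (B.val : B →+* P) g = b j l := by
      intro j l
      apply lift_poly
      intro μ
      by_cases hμ : μ ∈ (b j l).support
      · refine ⟨⟨coeff μ (b j l), Algebra.subset_adjoin ?_⟩, rfl⟩
        left
        simp only [Set.mem_iUnion]
        exact ⟨j, l, μ, hμ, rfl⟩
      · rw [notMem_support_iff.1 hμ]; exact zero_mem _
    choose b' hb' using hlift
    refine ⟨b', fun j => ⟨cc j, Algebra.subset_adjoin (Or.inr ⟨j, rfl⟩)⟩, ?_, ?_, ?_⟩
    · intro j l i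
      apply mem_ptIdeal_pow_of_family _ (c i) (fun _ : Unit => (B.val : B →+* P))
      · intro a ha
        exact hval (by rw [ha (), map_zero])
      · simp [hq i]
      · intro _
        rw [hb']
        exact h1 j l i
    · intro j l
      rw [← tdeg_map_inj hval, hb']
      exact h2 j l
    · apply map_injective _ hval
      rw [map_map, hcomp, h3]
      simp only [map_sum, map_mul, map_prod, map_C, hb']
      rfl
  have := hSol.map (χ : B →+* K)
  rw [map_map] at this
  have e : (χ : B →+* K).comp (algebraMap A B) = algebraMap A K := χ.comp_algebraMap
  rw [e] at this
  convert this using 3 with i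
  rw [← e]; rfl

lemma char0_containment_hom {K : Type*} [Field K] [IsAlgClosed K]
    {N s : ℕ} (hN : 1 ≤ N) (q : Fin s → Fin (N+1) → K) (c : Fin s → Fin (N+1))
    (hq : ∀ i, q i (c i) = 1) (m : Fin s → ℕ) (a r : ℕ) (hr : 0 < r) (har : N * r < a)
    (f : MvPolynomial (Fin (N+1)) K) (t : ℕ) (hft : f.IsHomogeneous t)
    (hf : ∀ i, f ∈ ptIdeal (q i) (c i) ^ (a * m i)) :
    f ∈ (⨅ i, ptIdeal (q i) (c i) ^ m i) ^ r := by
  classical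
  let S : Set K := ((fun μ => coeff μ f) '' (f.support : Set _)) ∪ Set.range (fun x : Fin s × Fin (N+1) => q x.1 x.2)
  have hSf : S.Finite := ((Finset.finite_toSet _).image _).union (Set.finite_range _)
  let A := Algebra.adjoin ℤ S
  have hA : Algebra.FiniteType ℤ A := by
    rw [← Subalgebra.fg_iff_finiteType]
    exact ⟨hSf.toFinset, by simp [A]⟩
  have hAK : Function.Injective (algebraMap A K) := Subtype.val_injective
  obtain ⟨f0, hf0⟩ : ∃ g, MvPolynomial.map (algebraMap A K) g = f := by
    apply lift_poly
    intro μ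
    by_cases hμ : μ ∈ f.support
    · exact ⟨⟨coeff μ f, Algebra.subset_adjoin (Or.inl ⟨μ, hμ, rfl⟩)⟩, rfl⟩
    · rw [notMem_support_iff.1 hμ]; exact zero_mem _
  let q0 : Fin s → Fin (N+1) → A := fun i j => ⟨q i j, Algebra.subset_adjoin (Or.inr ⟨(i, j), rfl⟩)⟩
  have hq0 : ∀ i, q0 i (c i) = 1 := fun i => Subtype.ext (hq i)
  have hq0K : ∀ i, algebraMap A K ∘ q0 i = q i := fun i => rfl
  have hf0t : f0.IsHomogeneous t := by
    apply IsHomogeneous.of_map hAK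
    rwa [hf0]
  have hf0m : ∀ i, f0 ∈ ptIdeal (q0 i) (c i) ^ (a * m i) := by
    intro i
    apply mem_ptIdeal_pow_of_family _ (c i) (fun _ : Unit => algebraMap A K)
    · intro a ha
      exact hAK (by rw [ha (), map_zero])
    · exact hq0 i
    · intro _
      rw [hf0]; exact hf i
  choose k hk p hp1 hp2 hp3 φ hφ using fun h : {h : A // h ≠ 0} => exists_charp hA h.1 h.2
  let ψ : A →+* (∀ h, k h) := RingHom.pi φ
  have hψ : Function.Injective ψ := by
    rw [injective_iff_map_eq_zero]
    intro x hx
    by_contra h0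
    exact hφ ⟨x, h0⟩ (congrFun hx ⟨x, h0⟩)
  have hSolP : Sol (fun i => ψ ∘ q0 i) c m r t ((t + N).choose N) (MvPolynomial.map ψ f0) := by
    apply Sol.pi
    · intro i
      simp [hq0 i]
    · intro x
      rw [map_map]
      have e : (Pi.evalRingHom k x).comp ψ = φ x := rfl
      rw [e]
      have h1 := charp_containment (p x) hN (fun i => φ x ∘ q0 i) c (fun i => by simp [hq0 i]) m a r hr har
        (MvPolynomial.map (φ x) f0) (fun i => map_ptIdeal_pow _ _ _ (hf0m i))
      obtain ⟨b, cc, h2, h3⟩ := bounded_sol _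
        (HomI.iInf fun i => (ptIdeal_homI _ _).pow _) r hr _ t (hf0t.map (φ x)) h1
      refine ⟨b, cc, ?_, fun j l => (h2 j l).2, h3⟩
      intro j l i
      exact (Ideal.mem_iInf.1 (h2 j l).1) i
  obtain ⟨b, cc, h1, h2, h3⟩ := Sol.descend hAK ψ hψ hq0 hSolP
  rw [hf0] at h3
  rw [h3]
  refine sum_mem fun j _ => Ideal.mul_mem_left _ _ ?_
  have : ∏ l, b j l ∈ ∏ l : Fin r, (⨅ i, ptIdeal (q i) (c i) ^ m i) :=
    Ideal.prod_mem_prod fun l _ => Ideal.mem_iInf.2 fun i => h1 j l i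
  simpa using this

lemma containment {K : Type*} [Field K] [IsAlgClosed K]
    {N s : ℕ} (hN : 1 ≤ N) (q : Fin s → Fin (N+1) → K) (c : Fin s → Fin (N+1))
    (hq : ∀ i, q i (c i) = 1) (m : Fin s → ℕ) (a r : ℕ) (hr : 0 < r) (har : N * r < a) :
    (⨅ i, ptIdeal (q i) (c i) ^ (a * m i)) ≤ (⨅ i, ptIdeal (q i) (c i) ^ m i) ^ r := by
  intro f hf
  apply mem_of_homComps
  intro d
  apply char0_containment_hom hN q c hq m a r hr har _ d (homogeneousComponent_isHomogeneous _ _)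
  intro i
  exact (ptIdeal_homI _ _).pow _ _ (Ideal.mem_iInf.1 hf i) d

section
variable {K : Type*} [Field K] {n : ℕ}

lemma X_mem_irr (j : Fin n) : (X j : MvPolynomial (Fin n) K) ∈ irr K n :=
  Ideal.subset_span ⟨j, rfl⟩

lemma irr_le_sup (q q' : Fin n → K) (c d : Fin n)
    (hne : ∀ a : K, q ≠ a • q') :
    irr K n ≤ ptIdeal q c ⊔ ptIdeal q' d := by
  set J := ptIdeal q c ⊔ ptIdeal q' d with hJ
  have h1 : ∀ k, ptGen q c k ∈ J := fun k => Ideal.mem_sup_left (Ideal.subset_span ⟨k, rfl⟩)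
  have h2 : ∀ k, ptGen q' d k ∈ J := fun k => Ideal.mem_sup_right (Ideal.subset_span ⟨k, rfl⟩)
  obtain ⟨k, hk⟩ : ∃ k, q k - q' k * q d ≠ 0 := by
    by_contra h
    push Not at h
    apply hne (q d)
    ext k
    have := h k
    simp only [Pi.smul_apply, smul_eq_mul]
    linear_combination this
  have h3 : (X c : MvPolynomial (Fin n) K) ∈ J := by
    have h4 : C (q k - q' k * q d) * X c ∈ J := by
      have : C (q k - q' k * q d) * X c = - ptGen q c k + ptGen q' d k + C (q' k) * ptGen q c d := by
        simp only [ptGen, map_sub, map_mul]; ring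
      rw [this]
      exact add_mem (add_mem (neg_mem (h1 k)) (h2 k)) (Ideal.mul_mem_left _ _ (h1 d))
    have := Ideal.mul_mem_left J (C (q k - q' k * q d)⁻¹) h4
    rwa [← mul_assoc, ← map_mul, inv_mul_cancel₀ hk, map_one, one_mul] at this
  rw [irr, idealOfVars, Ideal.span_le]
  rintro _ ⟨j, rfl⟩
  have : X j = ptGen q c j + C (q j) * X c := by simp [ptGen]
  rw [this]
  exact add_mem (h1 j) (Ideal.mul_mem_left _ _ h3)

lemma eval_of_mem_ptIdeal (q : Fin n → K) (c : Fin n) (hq : q c = 1) {f : MvPolynomial (Fin n) K}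
    (hf : f ∈ ptIdeal q c) : eval q f = 0 := by
  have : ptIdeal q c ≤ RingHom.ker (eval q) := by
    rw [ptIdeal, Ideal.span_le]
    rintro _ ⟨j, rfl⟩
    simp [ptGen, RingHom.mem_ker, hq]
  exact this hf

lemma exists_lin [Infinite K] {s : ℕ} (q : Fin s → Fin n → K) (c : Fin s → Fin n)
    (hq : ∀ i, q i (c i) = 1) : ∃ l : MvPolynomial (Fin n) K, l.IsHomogeneous 1 ∧
      ∀ i, l ∉ ptIdeal (q i) (c i) := by
  obtain ⟨φ, hφ⟩ := Module.exists_dual_forall_apply_ne_zero (K := K) q (fun i h => by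
    have := hq i; rw [h] at this; simp at this)
  refine ⟨∑ j, C (φ (Pi.single j 1)) * X j, ?_, ?_⟩
  · exact IsHomogeneous.sum _ _ _ fun j _ => isHomogeneous_C_mul_X _ _
  · intro i hi
    have := eval_of_mem_ptIdeal _ _ (hq i) hi
    apply hφ i
    rw [map_sum] at this
    simp only [map_mul, eval_C, eval_X] at this
    conv_lhs => rw [← Finset.univ_sum_single (q i), map_sum]
    rw [← this]
    refine Finset.sum_congr rfl fun j _ => ?_
    have : Pi.single j (q i j) = q i j • (Pi.single j 1 : Fin n → K) := by
      rw [← Pi.single_smul]; simp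
    rw [this, map_smul, smul_eq_mul, mul_comm]

/-- Product versus intersection away from the irrelevant ideal. -/
lemma irr_pow_le_sup_inf {R : Type*} [CommRing R] {ι : Type*} (S : Finset ι) (A M : Ideal R)
    (B : ι → Ideal R)
    (h : ∀ j ∈ S, ∃ k, M ^ k ≤ A ⊔ B j) : ∃ k, M ^ k ≤ A ⊔ ⨅ j ∈ S, B j := by
  classical
  induction S using Finset.induction_on with
  | empty => exact ⟨0, by simp⟩
  | insert j S hj ih =>
    obtain ⟨k, hk⟩ := ih fun j hj => h j (Finset.mem_insert_of_mem hj)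
    obtain ⟨k', hk'⟩ := h j (Finset.mem_insert_self _ _)
    refine ⟨k' + k, ?_⟩
    rw [pow_add, Finset.iInf_insert]
    refine (Ideal.mul_mono hk' hk).trans ?_
    generalize (⨅ j ∈ S, B j) = D
    rw [Ideal.sup_mul, Ideal.mul_sup, Ideal.mul_sup]
    refine sup_le (sup_le ?_ ?_) (sup_le ?_ ?_)
    · exact le_sup_of_le_left Ideal.mul_le_right
    · exact le_sup_of_le_left Ideal.mul_le_left
    · exact le_sup_of_le_left Ideal.mul_le_right
    · exact le_sup_of_le_right Ideal.mul_le_inf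

lemma irr_pow_mul_inf_le {R : Type*} [CommRing R] {ι : Type*} [DecidableEq ι] (S : Finset ι) (M : Ideal R)
    (B : ι → Ideal R)
    (h : ∀ i ∈ S, ∀ j ∈ S, i ≠ j → ∃ k, M ^ k ≤ B i ⊔ B j) :
    ∃ k, M ^ k * (⨅ j ∈ S, B j) ≤ ∏ j ∈ S, B j := by
  induction S using Finset.induction_on with
  | empty => exact ⟨0, by simp⟩
  | insert j S hj ih =>
    obtain ⟨k, hk⟩ := ih fun i hi j hj => h i (Finset.mem_insert_of_mem hi) j (Finset.mem_insert_of_mem hj)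
    obtain ⟨k', hk'⟩ := irr_pow_le_sup_inf S (B j) M B fun i hi =>
      h j (Finset.mem_insert_self _ _) i (Finset.mem_insert_of_mem hi) (by rintro rfl; exact hj hi)
    refine ⟨k + k', ?_⟩
    rw [Finset.prod_insert hj, Finset.iInf_insert, pow_add, mul_assoc]
    have h1 : M ^ k' * (B j ⊓ ⨅ x ∈ S, B x) ≤ B j * ⨅ x ∈ S, B x := by
      refine (Ideal.mul_mono_left hk').trans ?_
      rw [Ideal.sup_mul]
      refine sup_le (Ideal.mul_mono_right inf_le_right) ?_
      rw [mul_comm]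
      exact Ideal.mul_mono_left inf_le_left
    refine (Ideal.mul_mono_right h1).trans ?_
    rw [mul_left_comm]
    exact Ideal.mul_mono_right hk
end

section
variable {K : Type*} [Field K] {n : ℕ}

lemma mem_homComp {I : Ideal (MvPolynomial (Fin n) K)} {t : ℕ} {f : MvPolynomial (Fin n) K} :
    f ∈ homComp K I t ↔ f ∈ I ∧ f.IsHomogeneous t := by
  simp [homComp]

lemma homComp_le (I : Ideal (MvPolynomial (Fin n) K)) (t : ℕ) :
    homComp K I t ≤ homogeneousSubmodule (Fin n) K t := inf_le_right

instance finDim_homComp (I : Ideal (MvPolynomial (Fin n) K)) (t : ℕ) :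
    FiniteDimensional K (homComp K I t) :=
  Submodule.finiteDimensional_of_le (homComp_le I t)

lemma homComp_inf (I J : Ideal (MvPolynomial (Fin n) K)) (t : ℕ) :
    homComp K (I ⊓ J) t = homComp K I t ⊓ homComp K J t := by
  ext f
  simp only [Submodule.mem_inf, mem_homComp]
  tauto

/-- `l * R_t`. -/
def lmulW (l : MvPolynomial (Fin n) K) (V : Submodule K (MvPolynomial (Fin n) K)) :
    Submodule K (MvPolynomial (Fin n) K) := V.map (LinearMap.mulLeft K l)

lemma finrank_lmulW {l : MvPolynomial (Fin n) K} (hl : l ≠ 0) (V : Submodule K (MvPolynomial (Fin n) K)) :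
    Module.finrank K (lmulW l V) = Module.finrank K V := by
  have hinj : Function.Injective (LinearMap.mulLeft K l) := by
    intro x y hxy
    exact mul_left_cancel₀ hl hxy
  exact (Submodule.equivMapOfInjective _ hinj V).finrank_eq.symm

lemma lmulW_le {l : MvPolynomial (Fin n) K} (hl : l.IsHomogeneous 1) (t : ℕ) :
    lmulW l (homogeneousSubmodule (Fin n) K t) ≤ homogeneousSubmodule (Fin n) K (t + 1) := by
  rintro _ ⟨x, hx, rfl⟩
  rw [add_comm]
  exact hl.mul hx

lemma finrank_U {l : MvPolynomial (Fin n) K} (hl : l.IsHomogeneous 1) (hl0 : l ≠ 0)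
    (I : Ideal (MvPolynomial (Fin n) K)) (hI : ∀ g, l * g ∈ I → g ∈ I) (t : ℕ) :
    Module.finrank K ↥(homComp K I (t+1) ⊔ lmulW l (homogeneousSubmodule (Fin n) K t)) +
      Module.finrank K (homComp K I t) = Module.finrank K (homComp K I (t+1)) +
      Module.finrank K (homogeneousSubmodule (Fin n) K t) := by
  have h1 : FiniteDimensional K (lmulW l (homogeneousSubmodule (Fin n) K t)) :=
    Submodule.finiteDimensional_of_le (lmulW_le hl t)
  have := Submodule.finrank_sup_add_finrank_inf_eq (homComp K I (t+1)) (lmulW l (homogeneousSubmodule (Fin n) K t))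
  rw [finrank_lmulW hl0] at this
  have h9 : lmulW l (homComp K I t) = homComp K I (t + 1) ⊓ lmulW l (homogeneousSubmodule (Fin n) K t) := by
    ext f
    constructor
    · rintro ⟨x, hx, rfl⟩
      obtain ⟨h1, h2⟩ := mem_homComp.1 hx
      refine ⟨mem_homComp.2 ⟨I.mul_mem_left _ h1, lmulW_le hl t ⟨x, h2, rfl⟩⟩, ⟨x, h2, rfl⟩⟩
    · rintro ⟨hf, x, hx, rfl⟩
      exact ⟨x, mem_homComp.2 ⟨hI x (mem_homComp.1 hf).1, hx⟩, rfl⟩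
  rw [← this, ← finrank_lmulW hl0 (homComp K I t), h9]

lemma U_le {l : MvPolynomial (Fin n) K} (hl : l.IsHomogeneous 1)
    (I : Ideal (MvPolynomial (Fin n) K)) (t : ℕ) :
    homComp K I (t+1) ⊔ lmulW l (homogeneousSubmodule (Fin n) K t) ≤ homogeneousSubmodule (Fin n) K (t+1) :=
  sup_le (homComp_le _ _) (lmulW_le hl t)

lemma U_eq {l : MvPolynomial (Fin n) K} (hl : l.IsHomogeneous 1)
    (I : Ideal (MvPolynomial (Fin n) K)) (hI : HomI I) (t : ℕ)
    (h : irr K n ^ (t+1) ≤ I ⊔ Ideal.span {l}) :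
    homComp K I (t+1) ⊔ lmulW l (homogeneousSubmodule (Fin n) K t) = homogeneousSubmodule (Fin n) K (t+1) := by
  refine le_antisymm (U_le hl I t) ?_
  intro f hf
  have h1 := h (mem_irr_pow_of_hom hf le_rfl)
  obtain ⟨u, hu, v, hv, rfl⟩ := Submodule.mem_sup.1 h1
  obtain ⟨w, rfl⟩ := Ideal.mem_span_singleton'.1 hv
  rw [← homogeneousComponent_eq_self hf, map_add, homComp_mul_hom hl]
  refine Submodule.add_mem_sup (mem_homComp.2 ⟨hI u hu _, homogeneousComponent_isHomogeneous _ _⟩) ?_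
  exact ⟨_, homogeneousComponent_isHomogeneous t w, by simp [mul_comm]⟩

lemma sup_homComp_eq {A B : Ideal (MvPolynomial (Fin n) K)} (hA : HomI A) (hB : HomI B) (t : ℕ)
    (h : irr K n ^ t ≤ A ⊔ B) : homComp K A t ⊔ homComp K B t = homogeneousSubmodule (Fin n) K t := by
  refine le_antisymm (sup_le (homComp_le _ _) (homComp_le _ _)) ?_
  intro f hf
  have h1 := h (mem_irr_pow_of_hom hf le_rfl)
  obtain ⟨u, hu, v, hv, rfl⟩ := Submodule.mem_sup.1 h1
  rw [← homogeneousComponent_eq_self hf, map_add]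
  exact Submodule.add_mem_sup (mem_homComp.2 ⟨hA u hu _, homogeneousComponent_isHomogeneous _ _⟩)
    (mem_homComp.2 ⟨hB v hv _, homogeneousComponent_isHomogeneous _ _⟩)

lemma homComp_top (t : ℕ) : homComp K (⊤ : Ideal (MvPolynomial (Fin n) K)) t = homogeneousSubmodule (Fin n) K t := by
  ext f; simp [mem_homComp]

end

section
variable {K : Type*} [Field K] {N : ℕ}

lemma X_not_mem_ptIdeal (q : Fin (N+1) → K) (c : Fin (N+1)) (hq : q c = 1) :
    (X c : MvPolynomial (Fin (N+1)) K) ∉ ptIdeal q c := by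
  intro h
  have := eval_of_mem_ptIdeal q c hq h
  simp [hq] at this

lemma irr_pow_le_ptIdeal (q : Fin (N+1) → K) (c : Fin (N+1)) (m : ℕ) :
    irr K (N+1) ^ m ≤ ptIdeal q c ^ m ⊔ Ideal.span {X c} := by
  have h1 : irr K (N+1) ≤ ptIdeal q c ⊔ Ideal.span {X c} := by
    rw [irr, idealOfVars, Ideal.span_le]
    rintro _ ⟨j, rfl⟩
    have : X j = ptGen q c j + C (q j) * X c := by simp [ptGen]
    rw [this]
    exact add_mem (Ideal.mem_sup_left (Ideal.subset_span ⟨j, rfl⟩))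
      (Ideal.mem_sup_right (Ideal.mul_mem_left _ _ (Ideal.mem_span_singleton_self _)))
  rcases Nat.eq_zero_or_pos m with rfl | hm
  · simp
  obtain ⟨m, rfl⟩ : ∃ m', m = m' + 1 := ⟨m - 1, by omega⟩
  induction m with
  | zero => simpa using h1
  | succ m ih =>
    have h2 := Ideal.mul_mono (ih (by omega)) h1
    rw [← pow_succ] at h2
    refine h2.trans ?_
    rw [Ideal.sup_mul, Ideal.mul_sup, ← pow_succ]
    refine sup_le (sup_le le_sup_left ?_) ?_
    · exact le_sup_of_le_right Ideal.mul_le_right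
    · exact le_sup_of_le_right Ideal.mul_le_left

lemma hilb_pt (hN : 1 ≤ N) (q : Fin (N+1) → K) (c : Fin (N+1)) (hq : q c = 1) (m : ℕ) :
    (∀ t, m ≤ t + 1 → Module.finrank K (homComp K (ptIdeal q c ^ m) t) + (m + N - 1).choose N = (t + N).choose N) ∧
    (∀ t, (t + N).choose N ≤ Module.finrank K (homComp K (ptIdeal q c ^ m) t) + (m + N - 1).choose N) := by
  rcases Nat.eq_zero_or_pos m with rfl | hm
  · have h0 : (0 + N - 1).choose N = 0 := Nat.choose_eq_zero_of_lt (by omega)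
    have h1 : ∀ t, Module.finrank K (homComp K (ptIdeal q c ^ 0) t) = (t + N).choose N := by
      intro t
      rw [pow_zero, Ideal.one_eq_top, homComp_top, finrank_hom]
    rw [h0]
    exact ⟨fun t _ => by rw [h1]; rfl, fun t => by rw [h1]; rfl⟩
  obtain ⟨m, rfl⟩ : ∃ m', m = m' + 1 := ⟨m - 1, by omega⟩
  have e1 : m + 1 + N - 1 = m + N := by omega
  have hz : ∀ t, t ≤ m → Module.finrank K (homComp K (ptIdeal q c ^ (m+1)) t) = 0 := by
    intro t ht
    have : homComp K (ptIdeal q c ^ (m+1)) t = ⊥ := by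
      rw [eq_bot_iff]
      intro f hf
      obtain ⟨h1, h2⟩ := mem_homComp.1 hf
      have h3 := homComp_eq_zero_of_mem_irr (Ideal.pow_right_mono (ptIdeal_le_irr q c) _ h1) (d := t) (by omega)
      rwa [homogeneousComponent_eq_self h2] at h3
    rw [this]; simp
  have hstep : ∀ k, Module.finrank K (homComp K (ptIdeal q c ^ (m+1)) (m + k)) + (m + N).choose N = (m + k + N).choose N := by
    intro k
    induction k with
    | zero => rw [hz _ (by omega)]; simp
    | succ k ih =>
      have hU := finrank_U (isHomogeneous_X K c) (X_ne_zero c) (ptIdeal q c ^ (m+1))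
        (fun g hg => ptIdeal_nzd q c hq _ (X_not_mem_ptIdeal q c hq) hg) (m + k)
      rw [U_eq (isHomogeneous_X K c) _ ((ptIdeal_homI q c).pow _), finrank_hom, finrank_hom] at hU
      · rw [← add_assoc m k 1]; omega
      · exact (Ideal.pow_le_pow_right (by omega)).trans (irr_pow_le_ptIdeal q c (m+1))
  rw [e1]
  refine ⟨fun t ht => ?_, fun t => ?_⟩
  · obtain ⟨k, rfl⟩ := Nat.exists_eq_add_of_le (show m ≤ t by omega)
    exact hstep k
  · rcases le_or_gt m t with h | h
    · obtain ⟨k, rfl⟩ := Nat.exists_eq_add_of_le h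
      exact (hstep k).symm.le
    · have := Nat.choose_le_choose N (show t + N ≤ m + N by omega)
      omega

variable {s : ℕ} (q : Fin s → Fin (N+1) → K) (c : Fin s → Fin (N+1)) (hq : ∀ i, q i (c i) = 1)
  (hne : ∀ i j, i ≠ j → ∀ a : K, q i ≠ a • q j)

lemma pow_sup (i j : Fin s) (hij : i ≠ j) (hne : ∀ i j, i ≠ j → ∀ a : K, q i ≠ a • q j) (a b : ℕ) :
    ∃ k, irr K (N+1) ^ k ≤ ptIdeal (q i) (c i) ^ a ⊔ ptIdeal (q j) (c j) ^ b :=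
  ⟨a + b, (Ideal.pow_right_mono (irr_le_sup _ _ _ _ (hne i j hij)) _).trans
    Ideal.sup_pow_add_le_pow_sup_pow⟩

lemma hilb_fat (hN : 1 ≤ N) (hq : ∀ i, q i (c i) = 1)
    (hne : ∀ i j, i ≠ j → ∀ a : K, q i ≠ a • q j) (m : Fin s → ℕ) (S : Finset (Fin s)) :
    (∃ T, ∀ t, T ≤ t → Module.finrank K (homComp K (⨅ i ∈ S, ptIdeal (q i) (c i) ^ m i) t) +
      ∑ i ∈ S, (m i + N - 1).choose N = (t + N).choose N) ∧
    (∀ t, (t + N).choose N ≤ Module.finrank K (homComp K (⨅ i ∈ S, ptIdeal (q i) (c i) ^ m i) t) +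
      ∑ i ∈ S, (m i + N - 1).choose N) := by
  classical
  induction S using Finset.induction_on with
  | empty =>
    have : (⨅ i ∈ (∅ : Finset (Fin s)), ptIdeal (q i) (c i) ^ m i) = ⊤ := by simp
    rw [this]
    refine ⟨⟨0, fun t _ => ?_⟩, fun t => ?_⟩ <;> rw [homComp_top, finrank_hom] <;> simp
  | insert j S hj ih =>
    obtain ⟨⟨T, hT⟩, h2⟩ := ih
    obtain ⟨h3, h4⟩ := hilb_pt hN (q j) (c j) (hq j) (m j)
    rw [Finset.iInf_insert, Finset.sum_insert hj]
    obtain ⟨k, hk⟩ := irr_pow_le_sup_inf S (ptIdeal (q j) (c j) ^ m j) (irr K (N+1))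
      (fun i => ptIdeal (q i) (c i) ^ m i)
      fun i hi => pow_sup q c j i (by rintro rfl; exact hj hi) hne _ _
    have hA := (ptIdeal_homI (q j) (c j)).pow (m j)
    have hB : HomI (⨅ i ∈ S, ptIdeal (q i) (c i) ^ m i) := by
      intro f hf d
      simp only [Ideal.mem_iInf] at hf ⊢
      exact fun i hi => (ptIdeal_homI _ _).pow _ f (hf i hi) d
    generalize (⨅ i ∈ S, ptIdeal (q i) (c i) ^ m i) = B at *
    generalize ptIdeal (q j) (c j) ^ m j = A at *
    have key : ∀ t, Module.finrank K ↥(homComp K A t ⊔ homComp K B t) + Module.finrank K ↥(homComp K (A ⊓ B) t) =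
        Module.finrank K (homComp K A t) + Module.finrank K (homComp K B t) := fun t => by
      rw [homComp_inf]
      exact Submodule.finrank_sup_add_finrank_inf_eq (homComp K A t) (homComp K B t)
    refine ⟨⟨T + k + m j, fun t ht => ?_⟩, fun t => ?_⟩
    · have h5 := key t
      rw [sup_homComp_eq hA hB t ((Ideal.pow_le_pow_right (by omega)).trans hk), finrank_hom] at h5
      have := hT t (by omega)
      have := h3 t (by omega)
      omega
    · have h5 := key t
      have h6 : Module.finrank K ↥(homComp K A t ⊔ homComp K B t) ≤ (t + N).choose N := by
        rw [← finrank_hom (k := K)]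
        exact Submodule.finrank_mono (sup_le (homComp_le _ _) (homComp_le _ _))
      have := h2 t
      have := h4 t
      omega
end

section
variable {n : ℕ}

lemma conn {Q : Type*} (f : (Fin n →₀ ℕ) → (Fin n →₀ ℕ) → Q) (σ ρ : ℕ)
    (hf : ∀ α β j, σ ≤ α.degree → ρ ≤ β.degree →
      f (α + Finsupp.single j 1) β = f α (β + Finsupp.single j 1)) :
    ∀ (k : ℕ) (α β α' β' : Fin n →₀ ℕ), (α - α').degree = k → α + β = α' + β' → α.degree = σ → α'.degree = σ →
      ρ + 1 ≤ β.degree → f α β = f α' β' := by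
  intro k
  induction k with
  | zero =>
    intro α β α' β' hk hab h1 h2 h3
    rw [Finsupp.degree_eq_zero_iff, tsub_eq_zero_iff_le] at hk
    obtain ⟨γ, rfl⟩ := exists_add_of_le hk
    rw [map_add] at h2
    have : γ = 0 := by
      rw [← Finsupp.degree_eq_zero_iff]; omega
    subst this
    rw [add_zero] at *
    rw [add_left_cancel hab]
  | succ k ih =>
    intro α β α' β' hk hab h1 h2 h3
    obtain ⟨i, hi⟩ : ∃ i, α' i < α i := by
      by_contra h
      push Not at h
      have : α - α' = 0 := by rw [tsub_eq_zero_iff_le]; exact h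
      rw [this] at hk; simp at hk
    obtain ⟨j, hj⟩ : ∃ j, α j < α' j := by
      by_contra h
      push Not at h
      have h5 : α' ≤ α := h
      obtain ⟨γ, rfl⟩ := exists_add_of_le h5
      rw [map_add] at h1
      have : γ = 0 := by
        rw [← Finsupp.degree_eq_zero_iff]; omega
      subst this
      simp at hi
    have hβj : 0 < β j := by
      have := DFunLike.congr_fun hab j
      simp at this; omega
    have hij : i ≠ j := by rintro rfl; omega
    obtain ⟨γ, rfl⟩ : ∃ γ, α = γ + Finsupp.single i 1 :=
      ⟨α - Finsupp.single i 1, (tsub_add_cancel_of_le (by simp; omega)).symm⟩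
    obtain ⟨δ, rfl⟩ : ∃ γ, β = γ + Finsupp.single j 1 :=
      ⟨β - Finsupp.single j 1, (tsub_add_cancel_of_le (by simp; omega)).symm⟩
    simp only [map_add, Finsupp.degree_single] at h1 h3
    rw [← hf _ _ _ (by simp; omega) (by omega), add_right_comm, hf _ _ _ (by simp; omega) (by omega)]
    apply ih
    · have : (γ + Finsupp.single i 1 - α') = (γ + Finsupp.single j 1 - α') + Finsupp.single i 1 := by
        ext x
        simp only [Finsupp.tsub_apply, Finsupp.add_apply, Finsupp.single_apply] at hi hj ⊢
        rw [if_neg hij] at hj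
        simp only [if_true] at hi
        split_ifs with h6 h7 h7
        · omega
        · subst h6; omega
        · subst h7; omega
        · omega
      rw [this] at hk
      simp at hk; exact hk
    · rw [← hab]; abel
    · simp; omega
    · exact h2
    · simp; omega

lemma conn' {Q : Type*} (f : (Fin n →₀ ℕ) → (Fin n →₀ ℕ) → Q) (σ ρ : ℕ)
    (hf : ∀ α β j, σ ≤ α.degree → ρ ≤ β.degree →
      f (α + Finsupp.single j 1) β = f α (β + Finsupp.single j 1)) :
    ∀ (k : ℕ) (α β α' β' : Fin n →₀ ℕ), α + β = α' + β' → α.degree = σ + k → α'.degree = σ →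
      ρ + 1 ≤ β.degree → f α β = f α' β' := by
  intro k
  induction k with
  | zero =>
    intro α β α' β' h1 h2 h3 h4
    exact conn f σ ρ hf _ α β α' β' rfl h1 h2 h3 h4
  | succ k ih =>
    intro α β α' β' h1 h2 h3 h4
    obtain ⟨j, hj⟩ : ∃ j, α j ≠ 0 := by
      by_contra h
      push Not at h
      have : α = 0 := by ext j; exact h j
      rw [this] at h2; simp at h2
    obtain ⟨γ, rfl⟩ : ∃ γ, α = γ + Finsupp.single j 1 :=
      ⟨α - Finsupp.single j 1, (tsub_add_cancel_of_le (by simp; omega)).symm⟩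
    simp only [map_add, Finsupp.degree_single] at h2
    rw [hf _ _ _ (by omega) (by omega)]
    apply ih
    · rw [← h1]; abel
    · omega
    · exact h3
    · simp; omega
end

section
variable {K : Type*} [Field K] {n : ℕ}

lemma irr_le_submodule (t : ℕ) (V : Submodule K (MvPolynomial (Fin n) K))
    (h : ∀ ω : Fin n →₀ ℕ, t ≤ ω.degree → monomial ω (1:K) ∈ V) {f : MvPolynomial (Fin n) K}
    (hf : f ∈ irr K n ^ t) : f ∈ V := by
  rw [mem_pow_idealOfVars_iff] at hf
  rw [f.as_sum]
  refine V.sum_mem fun ω hω => ?_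
  have : monomial ω (coeff ω f) = coeff ω f • monomial ω (1:K) := by simp [smul_monomial]
  rw [this]
  exact V.smul_mem _ (h ω (hf ω hω))

lemma lin_sub_mem (t : ℕ) (A : Ideal (MvPolynomial (Fin n) K))
    (Φ Ψ : MvPolynomial (Fin n) K →ₗ[K] MvPolynomial (Fin n) K)
    (h : ∀ ω : Fin n →₀ ℕ, t ≤ ω.degree → Φ (monomial ω (1:K)) - Ψ (monomial ω 1) ∈ A)
    {f : MvPolynomial (Fin n) K}
    (hf : f ∈ irr K n ^ t) : Φ f - Ψ f ∈ A := by
  have := irr_le_submodule t ((A.restrictScalars K).comap (Φ - Ψ)) (fun ω hω => by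
    simpa using h ω hω) hf
  simpa using this

lemma mon_mem_irr {t : ℕ} {ω : Fin n →₀ ℕ} (h : t ≤ ω.degree) : monomial ω (1:K) ∈ irr K n ^ t := by
  rw [monomial_mem_pow_idealOfVars_iff _ _ one_ne_zero]; exact h

lemma X_mul_mon (j : Fin n) (ω : Fin n →₀ ℕ) :
    (X j : MvPolynomial (Fin n) K) * monomial ω 1 = monomial (ω + Finsupp.single j 1) 1 := by
  rw [X, monomial_mul, add_comm]; simp

/-- The inductive property used for the comparison of powers. -/
def PP (J : Ideal (MvPolynomial (Fin n) K)) (l : MvPolynomial (Fin n) K) (σ r : ℕ)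
    (H : MvPolynomial (Fin n) K →ₗ[K] MvPolynomial (Fin n) K) : Prop :=
  (∀ a ∈ irr K n ^ (r * σ), H a ∈ J ^ r) ∧
  (∀ a ∈ irr K n ^ (r * σ), ∀ j, X j * H a - H (X j * a) ∈ Ideal.span {l} * J ^ r) ∧
  (∀ u ∈ J ^ r, ∀ j, X j * u - H (X j * u) ∈ Ideal.span {l} * J ^ r)

lemma mul_mem_A {J J' : Ideal (MvPolynomial (Fin n) K)} {l u v : MvPolynomial (Fin n) K}
    (hu : u ∈ J) (hv : v ∈ Ideal.span {l} * J') : u * v ∈ Ideal.span {l} * (J * J') := by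
  rw [← mul_assoc, mul_comm (Ideal.span {l}) J, mul_assoc]
  exact Ideal.mul_mem_mul hu hv

lemma mul_mem_A' {J J' : Ideal (MvPolynomial (Fin n) K)} {l u v : MvPolynomial (Fin n) K}
    (hu : u ∈ Ideal.span {l} * J) (hv : v ∈ J') : u * v ∈ Ideal.span {l} * (J * J') := by
  rw [← mul_assoc]
  exact Ideal.mul_mem_mul hu hv

lemma PP.step {J : Ideal (MvPolynomial (Fin n) K)} {l : MvPolynomial (Fin n) K} {σ r : ℕ}
    {H1 H : MvPolynomial (Fin n) K →ₗ[K] MvPolynomial (Fin n) K} (hJ : J ≤ irr K n ^ σ)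
    (h1 : PP J l σ 1 H1) (h : PP J l σ r H) : ∃ H', PP J l σ (r+1) H' := by
  classical
  obtain ⟨i1, ii1, iii1⟩ := h1
  obtain ⟨i2, ii2, iii2⟩ := h
  simp only [one_mul, pow_one] at i1 ii1 iii1
  obtain ⟨A, hA⟩ : ∃ A, A = Ideal.span {l} * (J * J ^ r) := ⟨_, rfl⟩
  have hmA : ∀ u v, u ∈ J → v ∈ Ideal.span {l} * J ^ r → u * v ∈ A := fun u v h1 h2 => hA ▸ mul_mem_A h1 h2
  have hmA' : ∀ u v, u ∈ Ideal.span {l} * J → v ∈ J ^ r → u * v ∈ A := fun u v h1 h2 => hA ▸ mul_mem_A' h1 h2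
  have hJr : J ^ r ≤ irr K n ^ (r * σ) := by
    rw [mul_comm, pow_mul]; exact Ideal.pow_right_mono hJ r
  have hex : ∀ ω : Fin n →₀ ℕ, ∃ α β, (r+1) * σ ≤ ω.degree → α + β = ω ∧ α.degree = σ := by
    intro ω
    by_cases hω : (r+1)*σ ≤ ω.degree
    · obtain ⟨α, hα, hd⟩ := Finsupp.exists_le_degree_eq ω σ (by nlinarith)
      obtain ⟨β, rfl⟩ := exists_add_of_le hα
      exact ⟨α, β, fun _ => ⟨rfl, hd⟩⟩
    · exact ⟨0, 0, fun h => absurd h hω⟩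
  choose α β hαβ using hex
  have hα : ∀ ω, (r+1)*σ ≤ ω.degree → α ω + β ω = ω := fun ω hω => (hαβ ω hω).1
  have hdα : ∀ ω, (r+1)*σ ≤ ω.degree → (α ω).degree = σ := fun ω hω => (hαβ ω hω).2
  have hdβ : ∀ ω, (r+1)*σ ≤ ω.degree → (β ω).degree + σ = ω.degree := fun ω hω => by
    have h5 := congrArg Finsupp.degree (hα ω hω)
    rw [map_add, hdα ω hω] at h5; omega
  let B : (Fin n →₀ ℕ) → (Fin n →₀ ℕ) → MvPolynomial (Fin n) K ⧸ A :=
    fun a b => Ideal.Quotient.mk A (H1 (monomial a 1) * H (monomial b 1))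
  have hB1 : ∀ a b j, σ ≤ a.degree → r * σ ≤ b.degree →
      X j * (H1 (monomial a 1) * H (monomial b 1)) - H1 (monomial a 1) * H (monomial (b + Finsupp.single j 1) 1) ∈ A := by
    intro a b j ha hb
    have := hmA _ _ (i1 _ (mon_mem_irr ha)) (ii2 _ (mon_mem_irr hb) j)
    rw [X_mul_mon] at this
    convert this using 1; ring
  have hB2 : ∀ a b j, σ ≤ a.degree → r * σ ≤ b.degree →
      X j * (H1 (monomial a 1) * H (monomial b 1)) - H1 (monomial (a + Finsupp.single j 1) 1) * H (monomial b 1) ∈ A := by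
    intro a b j ha hb
    have := hmA' _ _ (ii1 _ (mon_mem_irr ha) j) (i2 _ (mon_mem_irr hb))
    rw [X_mul_mon] at this
    convert this using 1; ring
  have hB : ∀ a b j, σ ≤ a.degree → r * σ ≤ b.degree →
      B (a + Finsupp.single j 1) b = B a (b + Finsupp.single j 1) := by
    intro a b j ha hb
    have e1 := Ideal.Quotient.eq.2 (hB1 a b j ha hb)
    have e2 := Ideal.Quotient.eq.2 (hB2 a b j ha hb)
    exact e2.symm.trans e1
  let H' : MvPolynomial (Fin n) K →ₗ[K] MvPolynomial (Fin n) K :=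
    (basisMonomials (Fin n) K).constr K fun ω => H1 (monomial (α ω) 1) * H (monomial (β ω) 1)
  have hH' : ∀ ω, H' (monomial ω 1) = H1 (monomial (α ω) 1) * H (monomial (β ω) 1) := by
    intro ω
    have := (basisMonomials (Fin n) K).constr_basis K (fun ω => H1 (monomial (α ω) 1) * H (monomial (β ω) 1)) ω
    rwa [coe_basisMonomials] at this
  have hbil0 : ∀ a b, σ ≤ a.degree → r * σ + 1 ≤ b.degree →
      H1 (monomial a 1) * H (monomial b 1) - H' (monomial (a + b) 1) ∈ A := by
    intro a b ha hb
    rw [hH', ← Ideal.Quotient.eq]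
    obtain ⟨k, hk⟩ := Nat.exists_eq_add_of_le ha
    have hd : (r+1)*σ ≤ (a+b).degree := by rw [map_add]; nlinarith
    exact conn' B σ (r*σ) hB k a b _ _ (hα _ hd).symm hk (hdα _ hd) hb
  have hbil : ∀ a ∈ irr K n ^ σ, ∀ b ∈ irr K n ^ (r * σ + 1), H1 a * H b - H' (a * b) ∈ A := by
    intro a ha b hb
    refine lin_sub_mem σ A (LinearMap.mulRight K (H b) ∘ₗ H1) (H' ∘ₗ LinearMap.mulRight K b) (fun ω hω => ?_) ha
    refine lin_sub_mem (r*σ+1) A (LinearMap.mulLeft K (H1 (monomial ω 1)) ∘ₗ H)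
      (H' ∘ₗ LinearMap.mulLeft K (monomial ω 1)) (fun ω' hω' => ?_) hb
    have := hbil0 ω ω' hω hω'
    simp only [LinearMap.comp_apply, LinearMap.mulLeft_apply]
    rw [monomial_mul, one_mul]
    exact this
  refine ⟨H', ?_, ?_, ?_⟩
  · intro a ha
    refine irr_le_submodule _ (((J^(r+1)).restrictScalars K).comap H') (fun ω hω => ?_) ha
    change H' (monomial ω 1) ∈ J ^ (r+1)
    rw [hH', pow_succ']
    have := hdβ ω hω
    exact Ideal.mul_mem_mul (i1 _ (mon_mem_irr (hdα ω hω).ge)) (i2 _ (mon_mem_irr (by nlinarith)))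
  · intro a ha j
    rw [pow_succ', ← hA]
    refine lin_sub_mem _ A (LinearMap.mulLeft K (X j) ∘ₗ H') (H' ∘ₗ LinearMap.mulLeft K (X j)) (fun ω hω => ?_) ha
    simp only [LinearMap.comp_apply, LinearMap.mulLeft_apply]
    have hd := hdβ ω hω
    have hd2 : r * σ ≤ (β ω).degree := by nlinarith
    have e1 := hB1 (α ω) (β ω) j (hdα ω hω).ge hd2
    have e2 := hbil0 (α ω) (β ω + Finsupp.single j 1) (hdα ω hω).ge (by simp; omega)
    rw [← add_assoc, hα ω hω] at e2
    rw [X_mul_mon, hH' ω]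
    have := add_mem e1 e2
    rwa [sub_add_sub_cancel] at this
  · intro u hu j
    rw [pow_succ', ← hA]
    rw [pow_succ'] at hu
    induction hu using Submodule.mul_induction_on' with
    | mem_mul_mem g hg g' hg' =>
      have e1 := hmA' _ _ (iii1 g hg j) hg'
      have e2 := hmA' _ _ (ii1 g (hJ hg) j) hg'
      have e3 := hmA _ _ (i1 g (hJ hg)) (iii2 g' hg' j)
      have e4 := hbil g (hJ hg) (X j * g') (by
        rw [pow_succ']; exact Ideal.mul_mem_mul (X_mem_irr j) (hJr hg'))
      have := add_mem (add_mem (sub_mem e1 e2) e3) e4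
      rw [mul_left_comm g] at this
      convert this using 1
      ring
    | add x hx y hy h1 h2 =>
      rw [mul_add, map_add]
      have := add_mem h1 h2
      rwa [add_sub_add_comm]
end

section
variable {K : Type*} [Field K] {n : ℕ}

lemma irr_le_of_U {l : MvPolynomial (Fin n) K} {I : Ideal (MvPolynomial (Fin n) K)} {t0 : ℕ}
    (h : homComp K I (t0+1) ⊔ lmulW l (homogeneousSubmodule (Fin n) K t0) = homogeneousSubmodule (Fin n) K (t0+1)) :
    irr K n ^ (t0+1) ≤ I ⊔ Ideal.span {l} := by
  rw [irr, pow_idealOfVars_eq_span, Ideal.span_le]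
  rintro _ ⟨ω, hω, rfl⟩
  have h1 : monomial ω (1:K) ∈ homogeneousSubmodule (Fin n) K (t0+1) := isHomogeneous_monomial _ hω
  rw [← h] at h1
  obtain ⟨u, hu, v, ⟨w, hw, rfl⟩, h2⟩ := Submodule.mem_sup.1 h1
  change monomial ω (1:K) ∈ _
  rw [← h2]
  exact add_mem (Ideal.mem_sup_left (mem_homComp.1 hu).1)
    (Ideal.mem_sup_right (Ideal.mul_mem_right _ _ (Ideal.mem_span_singleton_self l)))

lemma exists_HG {l : MvPolynomial (Fin n) K} (hl : l.IsHomogeneous 1)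
    {I : Ideal (MvPolynomial (Fin n) K)} (hI : HomI I) {t0 : ℕ}
    (h : irr K n ^ (t0+1) ≤ I ⊔ Ideal.span {l}) :
    ∃ H G : MvPolynomial (Fin n) K →ₗ[K] MvPolynomial (Fin n) K,
      (∀ a ∈ irr K n ^ (t0+1), a = H a + l * G a) ∧
      (∀ a ∈ irr K n ^ (t0+1), H a ∈ I ⊓ irr K n ^ (t0+1)) ∧
      (∀ t, t0 ≤ t → ∀ a ∈ irr K n ^ (t+1), G a ∈ irr K n ^ t) := by
  have hex : ∀ ω : Fin n →₀ ℕ, ∃ u g : MvPolynomial (Fin n) K, t0 + 1 ≤ ω.degree →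
      monomial ω 1 = u + l * g ∧ u ∈ I ∧ u.IsHomogeneous ω.degree ∧ g.IsHomogeneous (ω.degree - 1) := by
    intro ω
    by_cases hω : t0 + 1 ≤ ω.degree
    · obtain ⟨t, ht⟩ : ∃ t, ω.degree = t + 1 := ⟨ω.degree - 1, by omega⟩
      have hU := U_eq hl I hI t ((Ideal.pow_le_pow_right (by omega)).trans h)
      have h1 : monomial ω (1:K) ∈ homogeneousSubmodule (Fin n) K (t+1) := isHomogeneous_monomial _ ht
      rw [← hU] at h1
      obtain ⟨u, hu, v, ⟨w, hw, rfl⟩, h2⟩ := Submodule.mem_sup.1 h1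
      refine ⟨u, w, fun _ => ⟨h2.symm, (mem_homComp.1 hu).1, ?_, ?_⟩⟩
      · rw [ht]; exact (mem_homComp.1 hu).2
      · rw [ht]; exact hw
    · exact ⟨0, 0, fun h => absurd h hω⟩
  choose u g hug using hex
  let H := (basisMonomials (Fin n) K).constr K u
  let G := (basisMonomials (Fin n) K).constr K g
  have hH : ∀ ω, H (monomial ω 1) = u ω := by
    intro ω
    have := (basisMonomials (Fin n) K).constr_basis K u ω
    rwa [coe_basisMonomials] at this
  have hG : ∀ ω, G (monomial ω 1) = g ω := by
    intro ω
    have := (basisMonomials (Fin n) K).constr_basis K g ω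
    rwa [coe_basisMonomials] at this
  refine ⟨H, G, ?_, ?_, ?_⟩
  · intro a ha
    have := lin_sub_mem (t0+1) ⊥ LinearMap.id (H + LinearMap.mulLeft K l ∘ₗ G) (fun ω hω => ?_) ha
    · rw [Ideal.mem_bot, sub_eq_zero] at this
      exact this
    · rw [Ideal.mem_bot, sub_eq_zero]
      simp only [LinearMap.id_apply, LinearMap.add_apply, LinearMap.comp_apply, LinearMap.mulLeft_apply, hH, hG]
      exact (hug ω hω).1
  · intro a ha
    have := lin_sub_mem (t0+1) (I ⊓ irr K n ^ (t0+1)) H 0 (fun ω hω => ?_) ha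
    · simpa only [LinearMap.zero_apply, sub_zero] using this
    · simp only [LinearMap.zero_apply, sub_zero, hH]
      obtain ⟨_, h2, h3, _⟩ := hug ω hω
      exact ⟨h2, mem_irr_pow_of_hom h3 hω⟩
  · intro t ht a ha
    have := lin_sub_mem (t+1) (irr K n ^ t) G 0 (fun ω hω => ?_) ha
    · simpa only [LinearMap.zero_apply, sub_zero] using this
    · simp only [LinearMap.zero_apply, sub_zero, hG]
      obtain ⟨_, h2, h3, h4⟩ := hug ω (by omega)
      exact mem_irr_pow_of_hom h4 (by omega)

lemma X_mul_mem_irr {a : MvPolynomial (Fin n) K} {t : ℕ} (j : Fin n) (h : a ∈ irr K n ^ t) :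
    X j * a ∈ irr K n ^ (t+1) := by
  rw [pow_succ']; exact Ideal.mul_mem_mul (X_mem_irr j) h

lemma PP.one {l : MvPolynomial (Fin n) K} (hl : l.IsHomogeneous 1)
    {I : Ideal (MvPolynomial (Fin n) K)} (hI : HomI I) (hIl : ∀ g, l * g ∈ I → g ∈ I) {t0 : ℕ}
    (h : irr K n ^ (t0+1) ≤ I ⊔ Ideal.span {l}) :
    ∃ H, PP (I ⊓ irr K n ^ (t0+1)) l (t0+1) 1 H := by
  obtain ⟨H, G, h1, h2, h3⟩ := exists_HG hl hI h
  refine ⟨H, ?_, ?_, ?_⟩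
  · rw [pow_one, one_mul]; exact h2
  · rw [pow_one, one_mul]
    intro a ha j
    have e1 := h1 a ha
    have hXa := X_mul_mem_irr j ha
    have hXa' := Ideal.pow_le_pow_right (Nat.le_succ _) hXa
    have e2 := h1 (X j * a) hXa'
    have e3 : X j * H a - H (X j * a) = l * (G (X j * a) - X j * G a) := by
      have : X j * (H a + l * G a) = H (X j * a) + l * G (X j * a) := by rw [← e1, ← e2]
      linear_combination this
    rw [e3]
    refine Ideal.mul_mem_mul (Ideal.mem_span_singleton_self l) ⟨hIl _ ?_, ?_⟩
    · rw [← e3]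
      exact sub_mem (I.mul_mem_left _ (h2 a ha).1) (h2 _ hXa').1
    · exact sub_mem (h3 _ (by omega) _ hXa) (X_mul_mem_irr j (h3 t0 le_rfl _ ha))
  · rw [pow_one]
    intro u hu j
    have hXa := X_mul_mem_irr j hu.2
    have hXa' := Ideal.pow_le_pow_right (Nat.le_succ _) hXa
    have e2 := h1 (X j * u) hXa'
    have e3 : X j * u - H (X j * u) = l * G (X j * u) := by linear_combination e2
    rw [e3]
    refine Ideal.mul_mem_mul (Ideal.mem_span_singleton_self l) ⟨hIl _ ?_, h3 _ (by omega) _ hXa⟩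
    rw [← e3]
    exact sub_mem (I.mul_mem_left _ hu.1) (h2 _ hXa').1

lemma PP.exists {l : MvPolynomial (Fin n) K} (hl : l.IsHomogeneous 1)
    {I : Ideal (MvPolynomial (Fin n) K)} (hI : HomI I) (hIl : ∀ g, l * g ∈ I → g ∈ I) {t0 : ℕ}
    (h : irr K n ^ (t0+1) ≤ I ⊔ Ideal.span {l}) (r : ℕ) :
    ∃ H, PP (I ⊓ irr K n ^ (t0+1)) l (t0+1) (r+1) H := by
  obtain ⟨H1, hH1⟩ := PP.one hl hI hIl h
  induction r with
  | zero => exact ⟨H1, hH1⟩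
  | succ r ih =>
    obtain ⟨H, hH⟩ := ih
    exact hH1.step inf_le_right hH

/-- descent -/
lemma PP.descent {J : Ideal (MvPolynomial (Fin n) K)} {l : MvPolynomial (Fin n) K} {σ r : ℕ}
    {H : MvPolynomial (Fin n) K →ₗ[K] MvPolynomial (Fin n) K}
    (hl : l.IsHomogeneous 1) (hl0 : l ≠ 0) (h : PP J l σ r H) {F : MvPolynomial (Fin n) K}
    (hF : F ∈ irr K n ^ (r * σ)) (hlF : l * F ∈ irr K n * J ^ r) : F ∈ J ^ r := by
  obtain ⟨i, ii, iii⟩ := h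
  have h1 : l * F - H (l * F) ∈ Ideal.span {l} * J ^ r := by
    generalize l * F = w at hlF
    induction hlF using Submodule.mul_induction_on' with
    | mem_mul_mem x hx u hu =>
      rw [irr, idealOfVars] at hx
      induction hx using Submodule.span_induction generalizing u with
      | mem x hx =>
        obtain ⟨j, rfl⟩ := hx
        exact iii u hu j
      | zero => simp
      | add x y _ _ hx hy =>
        rw [add_mul, map_add, add_sub_add_comm]
        exact add_mem (hx u hu) (hy u hu)
      | smul a x _ hx =>
        rw [smul_eq_mul, mul_comm a x, mul_assoc]
        exact hx (a * u) (Ideal.mul_mem_left _ _ hu)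
    | add x hx y hy h1 h2 =>
      rw [map_add, add_sub_add_comm]
      exact add_mem h1 h2
  have h2 : l * H F - H (l * F) ∈ Ideal.span {l} * J ^ r := by
    have hl' : l ∈ homogeneousSubmodule (Fin n) K 1 := hl
    rw [homogeneousSubmodule_one_eq_span_X] at hl'
    generalize Ideal.span {l} = L at *
    clear hlF h1 hl hl0
    induction hl' using Submodule.span_induction with
    | mem x hx =>
      obtain ⟨j, rfl⟩ := hx
      exact ii F hF j
    | zero => simp
    | add x y _ _ hx hy =>
      rw [add_mul, add_mul, map_add, add_sub_add_comm]
      exact add_mem hx hy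
    | smul a x _ hx =>
      rw [smul_mul_assoc, smul_mul_assoc, map_smul, ← smul_sub, smul_eq_C_mul]
      exact Ideal.mul_mem_left _ _ hx
  have h3 : l * F ∈ Ideal.span {l} * J ^ r := by
    have h4 : l * H F ∈ Ideal.span {l} * J ^ r := Ideal.mul_mem_mul (Ideal.mem_span_singleton_self l) (i F hF)
    have := add_mem (sub_mem h1 h2) h4
    convert this using 1; ring
  rw [Ideal.mem_span_singleton_mul] at h3
  obtain ⟨z, hz, hz'⟩ := h3
  rwa [← mul_left_cancel₀ hl0 hz']

/-! Generation in degree σ -/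

lemma span_gen (S : Set (MvPolynomial (Fin n) K)) (e : ℕ) (hS : ∀ f ∈ S, f.IsHomogeneous e)
    {w : MvPolynomial (Fin n) K} (hw : w ∈ Ideal.span S) (hw' : w ∈ irr K n ^ (e+1)) :
    w ∈ irr K n * Ideal.span S := by
  have hle : Ideal.span S ≤ irr K n ^ e := Ideal.span_le.2 fun f hf => mem_irr_pow_of_hom (hS f hf) le_rfl
  have hle' : irr K n * Ideal.span S ≤ irr K n ^ (e+1) := by
    rw [pow_succ']; exact Ideal.mul_mono_right hle
  have key : w - homogeneousComponent e w ∈ irr K n * Ideal.span S := by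
    clear hw'
    induction hw using Submodule.span_induction with
    | mem x hx => rw [homogeneousComponent_eq_self (hS x hx), sub_self]; exact zero_mem _
    | zero => simp
    | add x y _ _ hx hy => rw [map_add, add_sub_add_comm]; exact add_mem hx hy
    | smul c x hxS hx =>
      rw [smul_eq_mul]
      set xe := homogeneousComponent e x with hxe
      have hxe' : xe ∈ Ideal.span S := by
        have := sub_mem (show x ∈ Ideal.span S from hxS) (Ideal.mul_le_right hx)
        simpa using this
      have e1 : homogeneousComponent e (c * x) = homogeneousComponent 0 c * xe := by
        have e2 : c * x = c * xe + c * (x - xe) := by ring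
        rw [e2, map_add, homComp_eq_zero_of_mem_irr (hle' (Ideal.mul_mem_left _ c hx)) (Nat.lt_succ_self e), add_zero]
        have := homComp_mul_hom (g := c) (homogeneousComponent_isHomogeneous e x) 0
        rw [zero_add] at this
        exact this
      have e3 : c * x - homogeneousComponent e (c * x) = (c - homogeneousComponent 0 c) * xe + c * (x - xe) := by
        rw [e1]; ring
      rw [e3]
      refine add_mem (Ideal.mul_mem_mul ?_ hxe') (Ideal.mul_mem_left _ _ hx)
      have : c - homogeneousComponent 0 c ∈ irr K n ^ 1 := by
        rw [mem_pow_idealOfVars_iff']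
        intro x hx
        have : x = 0 := by rw [← Finsupp.degree_eq_zero_iff]; omega
        subst this
        simp
      simpa using this
  rwa [homComp_eq_zero_of_mem_irr hw' (Nat.lt_succ_self e), sub_zero] at key
end

section
variable {K : Type*} [Field K] {n : ℕ}

lemma gen_one {l : MvPolynomial (Fin n) K} (hl : l.IsHomogeneous 1)
    {I : Ideal (MvPolynomial (Fin n) K)} (hI : HomI I) (hIl : ∀ g, l * g ∈ I → g ∈ I) {t0 : ℕ}
    (h : irr K n ^ (t0+1) ≤ I ⊔ Ideal.span {l}) {f : MvPolynomial (Fin n) K} (hf : f ∈ I)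
    (hf' : f ∈ irr K n ^ (t0+2)) : f ∈ irr K n * (I ⊓ irr K n ^ (t0+1)) := by
  obtain ⟨H, G, h1, h2, h3⟩ := exists_HG hl hI h
  have hlm : l ∈ irr K n := by
    have := mem_irr_pow_of_hom hl le_rfl
    simpa using this
  have key : ∃ u ∈ irr K n * (I ⊓ irr K n ^ (t0+1)), ∃ g ∈ irr K n ^ (t0+1), f = u + l * g := by
    rw [pow_succ'] at hf'
    clear hf
    induction hf' using Submodule.mul_induction_on' with
    | mem_mul_mem x hx a ha =>
      refine ⟨x * H a, Ideal.mul_mem_mul hx (h2 a ha), x * G a, ?_, ?_⟩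
      · rw [pow_succ']; exact Ideal.mul_mem_mul hx (h3 t0 le_rfl a ha)
      · conv_lhs => rw [h1 a ha]
        ring
    | add x hx y hy h1 h2 =>
      obtain ⟨u, hu, g, hg, rfl⟩ := h1
      obtain ⟨u', hu', g', hg', rfl⟩ := h2
      exact ⟨u + u', add_mem hu hu', g + g', add_mem hg hg', by ring⟩
  obtain ⟨u, hu, g, hg, rfl⟩ := key
  have hu' : u ∈ I := (Ideal.mul_le_right hu).1
  have hlg : l * g ∈ I := by simpa using sub_mem hf hu'
  exact add_mem hu (Ideal.mul_mem_mul hlm ⟨hIl g hlg, hg⟩)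

open scoped Pointwise in
lemma span_pow_hom (S : Set (MvPolynomial (Fin n) K)) (e : ℕ) (hS : ∀ f ∈ S, f.IsHomogeneous e) (r : ℕ) :
    ∃ S' : Set (MvPolynomial (Fin n) K), (∀ f ∈ S', f.IsHomogeneous (r * e)) ∧
      Ideal.span S ^ r = Ideal.span S' := by
  induction r with
  | zero =>
    refine ⟨{1}, ?_, by simp⟩
    rintro _ rfl
    simpa using isHomogeneous_one (Fin n) K
  | succ r ih =>
    obtain ⟨S', h1, h2⟩ := ih
    refine ⟨S' * S, ?_, by rw [pow_succ, h2, Ideal.span_mul_span']⟩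
    rintro _ ⟨x, hx, y, hy, rfl⟩
    rw [add_mul, one_mul]
    exact (h1 x hx).mul (hS y hy)

lemma pow_le_sup_aux {R : Type*} [CommRing R] (J W M : Ideal R) (hW : W ≤ J) (h : J ≤ W ⊔ M * J) (r : ℕ) :
    J ^ r ≤ W ^ r ⊔ M * J ^ r := by
  induction r with
  | zero => simp
  | succ r ih =>
    have h1 : J ^ (r+1) ≤ (W ^ r ⊔ M * J ^ r) * (W ⊔ M * J) := by
      rw [pow_succ]; exact Ideal.mul_mono ih h
    refine h1.trans ?_
    rw [Ideal.sup_mul, Ideal.mul_sup, ← pow_succ]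
    have hWr : W ^ r ≤ J ^ r := Ideal.pow_right_mono hW r
    refine sup_le (sup_le le_sup_left ?_) ?_
    · apply le_sup_of_le_right
      rw [mul_left_comm, pow_succ]
      exact Ideal.mul_mono_right (Ideal.mul_mono_left hWr)
    · apply le_sup_of_le_right
      rw [mul_assoc, pow_succ]
      refine Ideal.mul_mono_right (Ideal.mul_mono_right (sup_le hW Ideal.mul_le_right))

lemma gen_pow {l : MvPolynomial (Fin n) K} (hl : l.IsHomogeneous 1)
    {I : Ideal (MvPolynomial (Fin n) K)} (hI : HomI I) (hIl : ∀ g, l * g ∈ I → g ∈ I) {t0 : ℕ}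
    (h : irr K n ^ (t0+1) ≤ I ⊔ Ideal.span {l}) (r : ℕ) {f : MvPolynomial (Fin n) K}
    (hf : f ∈ (I ⊓ irr K n ^ (t0+1)) ^ r)
    (hf' : f ∈ irr K n ^ (r * (t0+1) + 1)) : f ∈ irr K n * (I ⊓ irr K n ^ (t0+1)) ^ r := by
  obtain ⟨J, hJ⟩ : ∃ J, J = I ⊓ irr K n ^ (t0+1) := ⟨_, rfl⟩
  have hJle : J ≤ irr K n ^ (t0+1) := hJ ▸ inf_le_right
  obtain ⟨S, hS⟩ : ∃ S : Set (MvPolynomial (Fin n) K), S = homComp K I (t0+1) := ⟨_, rfl⟩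
  have hS1 : ∀ f ∈ S, f.IsHomogeneous (t0+1) := fun f hf => (mem_homComp.1 (hS ▸ hf)).2
  have hSJ : Ideal.span S ≤ J := by
    rw [Ideal.span_le, hJ]
    intro x hx
    exact ⟨(mem_homComp.1 (hS ▸ hx)).1, mem_irr_pow_of_hom (hS1 x hx) le_rfl⟩
  have hJ2 : J ≤ Ideal.span S ⊔ irr K n * J := by
    intro u hu
    rw [hJ] at hu
    have hu1 := hI u hu.1 (t0+1)
    have e : u = homogeneousComponent (t0+1) u + (u - homogeneousComponent (t0+1) u) := by ring
    rw [e]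
    refine add_mem (Ideal.mem_sup_left (Ideal.subset_span ?_)) (Ideal.mem_sup_right ?_)
    · rw [hS]; exact mem_homComp.2 ⟨hu1, homogeneousComponent_isHomogeneous _ _⟩
    · rw [hJ]
      refine gen_one hl hI hIl h (sub_mem hu.1 hu1) ?_
      have hu2 : u ∈ irr K n ^ (t0+1) := hu.2
      rw [mem_pow_idealOfVars_iff'] at hu2 ⊢
      intro x hx
      rw [coeff_sub, coeff_homogeneousComponent]
      split_ifs with h5
      · simp
      · rw [hu2 x (by omega), sub_zero]
  rw [← hJ] at hf ⊢
  obtain ⟨S', h1, h2⟩ := span_pow_hom S _ hS1 r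
  obtain ⟨w, hw, v, hv, rfl⟩ := Submodule.mem_sup.1 (pow_le_sup_aux J (Ideal.span S) (irr K n) hSJ hJ2 r hf)
  refine add_mem ?_ hv
  have hv' : v ∈ irr K n ^ (r * (t0+1) + 1) := by
    have : irr K n * J ^ r ≤ irr K n ^ (r * (t0+1) + 1) := by
      rw [pow_succ', mul_comm r, pow_mul]
      exact Ideal.mul_mono_right (Ideal.pow_right_mono hJle r)
    exact this hv
  have hw' : w ∈ irr K n ^ (r * (t0+1) + 1) := by simpa using sub_mem hf' hv'
  have : Ideal.span S ^ r ≤ J ^ r := Ideal.pow_right_mono hSJ r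
  refine Ideal.mul_mono_right this ?_
  rw [h2] at hw ⊢
  exact span_gen S' _ h1 hw hw'

lemma sat_pow {l : MvPolynomial (Fin n) K} (hl : l.IsHomogeneous 1) (hl0 : l ≠ 0)
    {I : Ideal (MvPolynomial (Fin n) K)} (hI : HomI I) (hIl : ∀ g, l * g ∈ I → g ∈ I) {t0 : ℕ}
    (h : irr K n ^ (t0+1) ≤ I ⊔ Ideal.span {l}) (r : ℕ) (k : ℕ) :
    ∀ {F : MvPolynomial (Fin n) K}, F ∈ irr K n ^ ((r+1) * (t0+1)) →
      l ^ (k+1) * F ∈ irr K n * (I ⊓ irr K n ^ (t0+1)) ^ (r+1) → F ∈ (I ⊓ irr K n ^ (t0+1)) ^ (r+1) := by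
  obtain ⟨H, hH⟩ := PP.exists hl hI hIl h r
  have hlm : l ∈ irr K n := by
    have := mem_irr_pow_of_hom hl le_rfl
    simpa using this
  induction k with
  | zero =>
    intro F hF h1
    rw [zero_add, pow_one] at h1
    exact hH.descent hl hl0 hF h1
  | succ k ih =>
    intro F hF h1
    have hlF : l * F ∈ irr K n ^ ((r+1) * (t0+1) + 1) := by
      rw [pow_succ']; exact Ideal.mul_mem_mul hlm hF
    have h2 : l * F ∈ (I ⊓ irr K n ^ (t0+1)) ^ (r+1) := by
      apply ih (Ideal.pow_le_pow_right (Nat.le_succ _) hlF)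
      rwa [← mul_assoc, ← pow_succ]
    exact hH.descent hl hl0 hF (gen_pow hl hI hIl h _ h2 hlF)

/-- Main comparison. -/
lemma symb_le_pow {l : MvPolynomial (Fin n) K} (hl : l.IsHomogeneous 1) (hl0 : l ≠ 0)
    {I : Ideal (MvPolynomial (Fin n) K)} (hI : HomI I) (hIl : ∀ g, l * g ∈ I → g ∈ I) {t0 : ℕ}
    (h : irr K n ^ (t0+1) ≤ I ⊔ Ideal.span {l}) (r : ℕ) (Q : Ideal (MvPolynomial (Fin n) K))
    (k : ℕ) (hQ : irr K n ^ k * Q ≤ I ^ (r+1)) :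
    Q ⊓ irr K n ^ ((r+1) * (t0+1)) ≤ I ^ (r+1) := by
  intro F hF
  have hlm : l ∈ irr K n := by
    have := mem_irr_pow_of_hom hl le_rfl
    simpa using this
  have h1 : F ∈ (I ⊓ irr K n ^ (t0+1)) ^ (r+1) := by
    apply sat_pow hl hl0 hI hIl h r ((t0+1)*(r+1) + k) hF.2
    rw [pow_succ' l, mul_assoc]
    refine Ideal.mul_mem_mul hlm ?_
    have h2 : l ^ k * F ∈ I ^ (r+1) := hQ (Ideal.mul_mem_mul (Ideal.pow_mem_pow hlm k) hF.1)
    have h3 : irr K n ^ ((t0+1)*(r+1)) * I ^ (r+1) ≤ (I ⊓ irr K n ^ (t0+1)) ^ (r+1) := by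
      rw [pow_mul, ← mul_pow, mul_comm]
      exact Ideal.pow_right_mono Ideal.mul_le_inf _
    rw [pow_add l, mul_assoc]
    exact h3 (Ideal.mul_mem_mul (Ideal.pow_mem_pow hlm _) h2)
  exact Ideal.pow_right_mono inf_le_left _ h1
end

section
variable {K : Type*} [Field K] [Infinite K] {N s : ℕ} (q : Fin s → Fin (N+1) → K) (c : Fin s → Fin (N+1))

lemma iInf_univ_eq (m : Fin s → ℕ) : (⨅ i ∈ (Finset.univ : Finset (Fin s)), ptIdeal (q i) (c i) ^ m i) =
    ⨅ i, ptIdeal (q i) (c i) ^ m i := by simp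

lemma reg_exists (hN : 1 ≤ N) (hq : ∀ i, q i (c i) = 1)
    (hne : ∀ i j, i ≠ j → ∀ a : K, q i ≠ a • q j) (m : Fin s → ℕ) :
    ∃ t, Module.finrank K (homComp K (⨅ i, ptIdeal (q i) (c i) ^ m i) t) +
      ∑ i, (m i + N - 1).choose N = (t + N).choose N := by
  obtain ⟨⟨T, hT⟩, -⟩ := hilb_fat q c hN hq hne m Finset.univ
  have := hT T le_rfl
  rw [iInf_univ_eq] at this
  exact ⟨T, this⟩

lemma fat_homI (m : Fin s → ℕ) : HomI (⨅ i, ptIdeal (q i) (c i) ^ m i) :=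
  HomI.iInf fun i => (ptIdeal_homI (q i) (c i)).pow (m i)

lemma reg_facts (hN : 1 ≤ N) (hq : ∀ i, q i (c i) = 1)
    (hne : ∀ i j, i ≠ j → ∀ a : K, q i ≠ a • q j) (m : Fin s → ℕ) (t0 : ℕ)
    (ht0 : Module.finrank K (homComp K (⨅ i, ptIdeal (q i) (c i) ^ m i) t0) +
      ∑ i, (m i + N - 1).choose N = (t0 + N).choose N) :
    homComp K (⨅ i, ptIdeal (q i) (c i) ^ m i) (t0+1) ≠ ⊥ ∧
    ∃ l : MvPolynomial (Fin (N+1)) K, l.IsHomogeneous 1 ∧ l ≠ 0 ∧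
      (∀ g, l * g ∈ (⨅ i, ptIdeal (q i) (c i) ^ m i) → g ∈ (⨅ i, ptIdeal (q i) (c i) ^ m i)) ∧
      irr K (N+1) ^ (t0+1) ≤ (⨅ i, ptIdeal (q i) (c i) ^ m i) ⊔ Ideal.span {l} := by
  obtain ⟨l, hl, hl0, hlI⟩ : ∃ l : MvPolynomial (Fin (N+1)) K, l.IsHomogeneous 1 ∧ l ≠ 0 ∧
      ∀ i, l ∉ ptIdeal (q i) (c i) := by
    by_cases hs : Nonempty (Fin s)
    · obtain ⟨l, hl, hlI⟩ := exists_lin q c hq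
      refine ⟨l, hl, ?_, hlI⟩
      rintro rfl
      exact hlI hs.some (zero_mem _)
    · exact ⟨X 0, isHomogeneous_X _ _, X_ne_zero _, fun i => absurd ⟨i⟩ hs⟩
  have hI : ∀ g, l * g ∈ (⨅ i, ptIdeal (q i) (c i) ^ m i) → g ∈ (⨅ i, ptIdeal (q i) (c i) ^ m i) := by
    intro g hg
    rw [Ideal.mem_iInf] at hg ⊢
    exact fun i => ptIdeal_nzd (q i) (c i) (hq i) _ (hlI i) (hg i)
  have h2 := (hilb_fat q c hN hq hne m Finset.univ).2 (t0+1)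
  rw [iInf_univ_eq] at h2
  generalize (⨅ i, ptIdeal (q i) (c i) ^ m i) = I at *
  have hU := finrank_U hl hl0 I hI t0
  rw [finrank_hom] at hU
  have heq : homComp K I (t0+1) ⊔ lmulW l (homogeneousSubmodule (Fin (N+1)) K t0) =
      homogeneousSubmodule (Fin (N+1)) K (t0+1) := by
    apply Submodule.eq_of_le_of_finrank_le (U_le hl I t0)
    rw [finrank_hom]
    omega
  refine ⟨?_, l, hl, hl0, hI, irr_le_of_U heq⟩
  intro hbot
  rw [hbot, bot_sup_eq] at heq
  have h5 := congrArg (fun V : Submodule K _ => Module.finrank K V) heq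
  simp only [finrank_lmulW hl0, finrank_hom] at h5
  have : (t0 + N).choose N < (t0 + 1 + N).choose N := by
    obtain ⟨N, rfl⟩ : ∃ k, N = k + 1 := ⟨N - 1, by omega⟩
    rw [show t0 + 1 + (N + 1) = (t0 + (N+1)) + 1 by ring, Nat.choose_succ_succ]
    have : 0 < (t0 + (N+1)).choose N := Nat.choose_pos (by omega)
    simp only [Nat.succ_eq_add_one]
    omega
  omega

lemma symb_le (hN : 1 ≤ N) (hq : ∀ i, q i (c i) = 1)
    (hne : ∀ i j, i ≠ j → ∀ a : K, q i ≠ a • q j) (m : Fin s → ℕ) (t0 : ℕ)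
    (ht0 : Module.finrank K (homComp K (⨅ i, ptIdeal (q i) (c i) ^ m i) t0) +
      ∑ i, (m i + N - 1).choose N = (t0 + N).choose N) (r : ℕ) (hr : 0 < r) :
    (⨅ i, ptIdeal (q i) (c i) ^ (r * m i)) ⊓ irr K (N+1) ^ (r * (t0+1)) ≤
      (⨅ i, ptIdeal (q i) (c i) ^ m i) ^ r := by
  obtain ⟨r, rfl⟩ : ∃ k, r = k + 1 := ⟨r - 1, by omega⟩
  obtain ⟨-, l, hl, hl0, hI, hle⟩ := reg_facts q c hN hq hne m t0 ht0
  obtain ⟨k, hk⟩ := irr_pow_mul_inf_le Finset.univ (irr K (N+1)) (fun i => ptIdeal (q i) (c i) ^ ((r+1) * m i))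
    fun i _ j _ hij => pow_sup q c i j hij hne _ _
  rw [iInf_univ_eq] at hk
  refine symb_le_pow hl hl0 (fat_homI q c m) hI hle r _ k (hk.trans ?_)
  have : ∏ j, ptIdeal (q j) (c j) ^ ((r+1) * m j) = (∏ j, ptIdeal (q j) (c j) ^ m j) ^ (r+1) := by
    rw [← Finset.prod_pow]
    refine Finset.prod_congr rfl fun j _ => ?_
    rw [mul_comm, pow_mul]
  rw [this]
  refine Ideal.pow_right_mono ?_ _
  refine Ideal.prod_le_inf.trans ?_
  rw [Finset.inf_univ_eq_iInf]
end

section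
variable {K : Type*} [Field K] {n : ℕ}

lemma alphaDeg_spec {I : Ideal (MvPolynomial (Fin n) K)} (h : ∃ t, homComp K I t ≠ ⊥) :
    homComp K I (alphaDeg K I) ≠ ⊥ :=
  Nat.sInf_mem (s := {t : ℕ | homComp K I t ≠ ⊥}) h

lemma alphaDeg_le {I : Ideal (MvPolynomial (Fin n) K)} {t : ℕ} (h : homComp K I t ≠ ⊥) :
    alphaDeg K I ≤ t := Nat.sInf_le (s := {t : ℕ | homComp K I t ≠ ⊥}) h

lemma alphaDeg_spec' {I : Ideal (MvPolynomial (Fin n) K)} (h : ∃ t, homComp K I t ≠ ⊥) :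
    ∃ f ∈ I, f.IsHomogeneous (alphaDeg K I) ∧ f ≠ 0 := by
  obtain ⟨f, hf, h0⟩ := (Submodule.ne_bot_iff _).1 (alphaDeg_spec h)
  exact ⟨f, (mem_homComp.1 hf).1, (mem_homComp.1 hf).2, h0⟩

lemma alphaDeg_le' {I : Ideal (MvPolynomial (Fin n) K)} {t : ℕ} {f : MvPolynomial (Fin n) K}
    (hf : f ∈ I) (h : f.IsHomogeneous t) (h0 : f ≠ 0) : alphaDeg K I ≤ t :=
  alphaDeg_le ((Submodule.ne_bot_iff _).2 ⟨f, mem_homComp.2 ⟨hf, h⟩, h0⟩)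

lemma le_irr_alphaDeg {I : Ideal (MvPolynomial (Fin n) K)} (hI : HomI I) :
    I ≤ irr K n ^ alphaDeg K I := by
  intro f hf
  rw [mem_pow_idealOfVars_iff']
  intro x hx
  by_contra h
  have h1 : homogeneousComponent x.degree f ≠ 0 := by
    intro h2
    have := congrArg (coeff x) h2
    rw [coeff_homogeneousComponent] at this
    simp at this
    exact h this
  have := alphaDeg_le' (hI f hf x.degree) (homogeneousComponent_isHomogeneous _ _) h1
  omega

lemma le_alphaDeg {I : Ideal (MvPolynomial (Fin n) K)} (h : ∃ t, homComp K I t ≠ ⊥) {k : ℕ}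
    (hI : I ≤ irr K n ^ k) : k ≤ alphaDeg K I := by
  obtain ⟨f, hf, h1, h0⟩ := alphaDeg_spec' h
  by_contra hlt
  push Not at hlt
  have := homComp_eq_zero_of_mem_irr (hI hf) hlt
  rw [homogeneousComponent_eq_self h1] at this
  exact h0 this

lemma abstract_bounds (N : ℕ) (S : ℕ → Ideal (MvPolynomial (Fin n) K)) (I : Ideal (MvPolynomial (Fin n) K))
    (hIS : I = S 1) (hom : ∀ k, HomI (S k)) (hmul : ∀ a b, S a * S b ≤ S (a + b))
    (hanti : ∀ a b, a ≤ b → S b ≤ S a) (hbot : ∀ k, ∃ t, homComp K (S k) t ≠ ⊥)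
    (hirr : ∀ k, S k ≤ irr K n ^ k) (hcont : ∀ a r, 0 < r → N * r < a → S a ≤ I ^ r)
    (σ : ℕ) (hσ : alphaDeg K I ≤ σ) (hreg : ∀ r, 0 < r → S r ⊓ irr K n ^ (r * σ) ≤ I ^ r)
    (W ρ : ℝ) (hW : W = ⨅ k : ℕ+, (alphaDeg K (S k) : ℝ) / (k : ℝ))
    (hρ : ρ = sSup {x : ℝ | ∃ a r : ℕ, 0 < a ∧ 0 < r ∧ ¬ S a ≤ I ^ r ∧ x = (a : ℝ) / (r : ℝ)}) :
    ((1 : ℝ) ≤ ρ ∧ ρ ≤ (N : ℝ)) ∧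
    (∀ a r : ℕ, 0 < a → 0 < r →
      (a : ℝ) / (r : ℝ) < (alphaDeg K I : ℝ) / W →
      ∃ T : ℕ, ∀ t : ℕ, T ≤ t → ¬ S (a * t) ≤ I ^ (r * t)) ∧
    (∀ a r : ℕ, 0 < a → 0 < r → (σ : ℝ) / W ≤ (a : ℝ) / (r : ℝ) → S a ≤ I ^ r) ∧
    ((alphaDeg K I : ℝ) / W ≤ ρ ∧ ρ ≤ (σ : ℝ) / W ∧
     (alphaDeg K I = σ → ρ = (alphaDeg K I : ℝ) / W)) := by
  have hge : ∀ k, k ≤ alphaDeg K (S k) := fun k => le_alphaDeg (hbot k) (hirr k)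
  have hα1 : 1 ≤ alphaDeg K I := hIS ▸ hge 1
  have hbdd : BddBelow (Set.range fun k : ℕ+ => (alphaDeg K (S k) : ℝ) / (k : ℝ)) :=
    ⟨0, by rintro _ ⟨k, rfl⟩; positivity⟩
  have hW1 : 1 ≤ W := by
    rw [hW]
    refine le_ciInf fun k => ?_
    rw [le_div_iff₀ (by exact_mod_cast k.pos), one_mul]
    exact_mod_cast hge k
  have hWle : ∀ k : ℕ, 0 < k → W * k ≤ alphaDeg K (S k) := by
    intro k hk
    rw [← le_div_iff₀ (by exact_mod_cast hk), hW]
    exact ciInf_le hbdd ⟨k, hk⟩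
  have hWα : W ≤ alphaDeg K I := by
    have := hWle 1 one_pos
    rw [← hIS] at this
    simpa using this
  have hW0 : 0 < W := by linarith
  have hsub : Subadditive (fun k => (alphaDeg K (S k) : ℝ)) := by
    intro a b
    obtain ⟨f, hf, h1, h0⟩ := alphaDeg_spec' (hbot a)
    obtain ⟨g, hg, h1', h0'⟩ := alphaDeg_spec' (hbot b)
    have := alphaDeg_le' (hmul a b (Ideal.mul_mem_mul hf hg)) (h1.mul h1') (mul_ne_zero h0 h0')
    beta_reduce
    exact_mod_cast this
  have hbdd2 : BddBelow (Set.range fun k : ℕ => (alphaDeg K (S k) : ℝ) / (k : ℝ)) :=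
    ⟨0, by rintro _ ⟨k, rfl⟩; positivity⟩
  have hI : HomI I := hIS ▸ hom 1
  have hB : ∀ a r : ℕ, 0 < a → 0 < r →
      (a : ℝ) / (r : ℝ) < (alphaDeg K I : ℝ) / W →
      ∃ T : ℕ, ∀ t : ℕ, T ≤ t → ¬ S (a * t) ≤ I ^ (r * t) := by
    intro a r ha hr h
    have ha' : (0:ℝ) < a := by exact_mod_cast ha
    have hr' : (0:ℝ) < r := by exact_mod_cast hr
    have h1 : W < r * alphaDeg K I / a := by
      rw [div_lt_div_iff₀ hr' hW0] at h
      rw [lt_div_iff₀ ha']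
      linarith
    rw [hW] at h1
    obtain ⟨k, hk⟩ := exists_lt_of_ciInf_lt h1
    have hlim := hsub.tendsto_lim hbdd2
    have hlt : hsub.lim < r * alphaDeg K I / a :=
      (hsub.lim_le_div hbdd2 k.ne_zero).trans_lt hk
    obtain ⟨T, hT⟩ := Filter.eventually_atTop.1 (hlim.eventually (gt_mem_nhds hlt))
    refine ⟨T + 1, fun t ht hle => ?_⟩
    have h2 := hT (a * t) (by nlinarith)
    have ht' : (0:ℝ) < t := by exact_mod_cast (show 0 < t by omega)
    push_cast at h2
    rw [div_lt_div_iff₀ (by positivity) ha'] at h2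
    have h3 : (r * t) * alphaDeg K I ≤ alphaDeg K (S (a * t)) := by
      apply le_alphaDeg (hbot _)
      refine hle.trans ?_
      rw [mul_comm (r * t) (alphaDeg K I), pow_mul (irr K n)]
      exact Ideal.pow_right_mono (le_irr_alphaDeg hI) _
    have h3' : ((r * t) * alphaDeg K I : ℝ) ≤ alphaDeg K (S (a * t)) := by exact_mod_cast h3
    nlinarith
  have hC : ∀ a r : ℕ, 0 < a → 0 < r → (σ : ℝ) / W ≤ (a : ℝ) / (r : ℝ) → S a ≤ I ^ r := by
    intro a r ha hr h
    have ha' : (0:ℝ) < a := by exact_mod_cast ha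
    have hr' : (0:ℝ) < r := by exact_mod_cast hr
    rw [div_le_div_iff₀ hW0 hr'] at h
    have hσ' : (alphaDeg K I : ℝ) ≤ σ := by exact_mod_cast hσ
    have hα1' : (1 : ℝ) ≤ alphaDeg K I := by exact_mod_cast hα1
    have h1 : r ≤ a := by
      have : (σ : ℝ) * r ≤ σ * a := by nlinarith
      have : (r : ℝ) ≤ a := le_of_mul_le_mul_left this (by linarith)
      exact_mod_cast this
    have h2 : r * σ ≤ alphaDeg K (S a) := by
      have := hWle a ha
      have : ((r * σ : ℕ) : ℝ) ≤ alphaDeg K (S a) := by push_cast; linarith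
      exact_mod_cast this
    refine le_trans (le_inf (hanti r a h1) ?_) (hreg r hr)
    exact (le_irr_alphaDeg (hom a)).trans (Ideal.pow_le_pow_right h2)
  set E := {x : ℝ | ∃ a r : ℕ, 0 < a ∧ 0 < r ∧ ¬ S a ≤ I ^ r ∧ x = (a : ℝ) / (r : ℝ)} with hE
  have hEN : ∀ x ∈ E, x ≤ N := by
    rintro _ ⟨a, r, ha, hr, h, rfl⟩
    rw [div_le_iff₀ (by exact_mod_cast hr)]
    by_contra hlt
    push Not at hlt
    exact h (hcont a r hr (by exact_mod_cast hlt))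
  have hEb : BddAbove E := ⟨N, hEN⟩
  have hEr : ∀ x ∈ E, x ≤ σ / W := by
    rintro _ ⟨a, r, ha, hr, h, rfl⟩
    by_contra hlt
    push Not at hlt
    exact h (hC a r ha hr hlt.le)
  have hdense : ∀ y : ℝ, 0 ≤ y → y < alphaDeg K I / W → ∃ x ∈ E, y < x := by
    intro y hy hlt
    obtain ⟨x, hx1, hx2⟩ := exists_rat_btwn hlt
    have hx0 : 0 < x := by exact_mod_cast hy.trans_lt hx1
    obtain ⟨a, ha⟩ : ∃ a : ℕ, x.num = a := ⟨x.num.toNat, (Int.toNat_of_nonneg (Rat.num_pos.2 hx0).le).symm⟩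
    have ha0 : 0 < a := by have := Rat.num_pos.2 hx0; omega
    have hxe : (x : ℝ) = (a : ℝ) / (x.den : ℝ) := by
      rw [Rat.cast_def, ha]; simp
    obtain ⟨T, hT⟩ := hB a x.den ha0 x.den_pos (hxe ▸ hx2)
    refine ⟨x, ⟨a * (T+1), x.den * (T+1), by positivity, Nat.mul_pos x.den_pos (Nat.succ_pos T), hT (T+1) (by omega), ?_⟩, hx1⟩
    rw [hxe]
    push_cast
    rw [mul_div_mul_right]
    positivity
  have h1α : 1 ≤ alphaDeg K I / W := by rw [le_div_iff₀ hW0]; linarith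
  obtain ⟨x0, hx0, -⟩ := hdense 0 le_rfl (by linarith)
  have hne : E.Nonempty := ⟨x0, hx0⟩
  have hlow : (alphaDeg K I : ℝ) / W ≤ ρ := by
    rw [hρ]
    refine le_of_forall_lt fun y hy => ?_
    obtain ⟨x, hx, hx'⟩ := hdense (max y 0) (le_max_right _ _) (max_lt hy (by linarith))
    exact ((le_max_left _ _).trans_lt hx').trans_le (le_csSup hEb hx)
  have hup : ρ ≤ σ / W := by rw [hρ]; exact csSup_le hne hEr
  refine ⟨⟨h1α.trans hlow, by rw [hρ]; exact csSup_le hne hEN⟩, hB, hC, hlow, hup, fun h => ?_⟩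
  refine le_antisymm ?_ hlow
  rw [h]; exact hup
end

set_option maxHeartbeats 1000000 in
/-- Bounds on the resurgence of a fat point ideal `I = I(Z)`, `Z ⊆ ℙ^N` nonempty:
(a) `1 ≤ ρ(I) ≤ N`;
(b) if `a/r < α(I)/α̂(I)` then `I^{(at)} ⊄ I^{rt}` for all sufficiently large `t`;
(c) if `a/r ≥ reg(I)/α̂(I)` then `I^{(a)} ⊆ I^r`;
(d) `α(I)/α̂(I) ≤ ρ(I) ≤ reg(I)/α̂(I)`, with equality `ρ(I) = α(I)/α̂(I)` when
`α(I) = reg(I)`. -/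
theorem resurgence_bounds (K : Type*) [Field K] [IsAlgClosed K]
    (N s : ℕ) (hN : 1 ≤ N)
    (p : Fin s → (Fin (N + 1) → K)) (hp : ProjDistinct K p)
    (m : Fin s → ℕ) (hm : ∃ i, 0 < m i) :
    ((1 : ℝ) ≤ resurgence K p m ∧ resurgence K p m ≤ (N : ℝ)) ∧
    (∀ a r : ℕ, 0 < a → 0 < r →
      (a : ℝ) / (r : ℝ) < (alphaDeg K (fatIdeal K p m) : ℝ) / waldschmidt K p m →
      ∃ T : ℕ, ∀ t : ℕ, T ≤ t →
        ¬ symbPow K p m (a * t) ≤ (fatIdeal K p m) ^ (r * t)) ∧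
    (∀ a r : ℕ, 0 < a → 0 < r →
      (regIdeal K p m : ℝ) / waldschmidt K p m ≤ (a : ℝ) / (r : ℝ) →
      symbPow K p m a ≤ (fatIdeal K p m) ^ r) ∧
    ((alphaDeg K (fatIdeal K p m) : ℝ) / waldschmidt K p m ≤ resurgence K p m ∧
     resurgence K p m ≤ (regIdeal K p m : ℝ) / waldschmidt K p m ∧
     (alphaDeg K (fatIdeal K p m) = regIdeal K p m →
       resurgence K p m = (alphaDeg K (fatIdeal K p m) : ℝ) / waldschmidt K p m)) := by
  have hinf : Infinite K := IsAlgClosed.instInfinite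
  obtain ⟨hp0, hpd⟩ := hp
  have hc : ∀ i, ∃ c, p i c ≠ 0 := fun i => Function.ne_iff.1 (hp0 i)
  choose c hc using hc
  obtain ⟨q, hqdef⟩ : ∃ q : Fin s → Fin (N+1) → K, ∀ i, q i = (p i (c i))⁻¹ • p i := ⟨_, fun i => rfl⟩
  have hq : ∀ i, q i (c i) = 1 := by intro i; rw [hqdef]; simp [hc i]
  have hne : ∀ i j, i ≠ j → ∀ a : K, q i ≠ a • q j := by
    intro i j hij a h
    rw [hqdef, hqdef] at h
    apply hpd i j hij (p i (c i) * a * (p j (c j))⁻¹)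
    have := congrArg (fun v => p i (c i) • v) h
    simp only [smul_smul] at this
    rw [mul_inv_cancel₀ (hc i), one_smul, ← mul_assoc] at this
    exact this
  have hfat : ∀ m' : Fin s → ℕ, fatIdeal K p m' = ⨅ i, ptIdeal (q i) (c i) ^ m' i := by
    intro m'
    unfold fatIdeal
    refine iInf_congr fun i => ?_
    rw [coneIdeal_eq (p i) (c i) (hc i), hqdef]
  have hsymb : ∀ k, symbPow K p m k = ⨅ i, ptIdeal (q i) (c i) ^ (k * m i) := fun k => hfat _
  have hset : ∃ t, t ∈ {t : ℕ | (Module.finrank K ↥(homComp K (fatIdeal K p m) t) : ℤ)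
      = ((t + N).choose N : ℤ) - ∑ i, ((m i + N - 1).choose N : ℤ)} := by
    obtain ⟨t, ht⟩ := reg_exists q c hN hq hne m
    refine ⟨t, ?_⟩
    rw [Set.mem_setOf_eq, hfat m, ← ht]
    push_cast; ring
  have ht0 := Nat.sInf_mem hset
  obtain ⟨t0, ht0def⟩ : ∃ t0, t0 = sInf {t : ℕ | (Module.finrank K ↥(homComp K (fatIdeal K p m) t) : ℤ)
      = ((t + N).choose N : ℤ) - ∑ i, ((m i + N - 1).choose N : ℤ)} := ⟨_, rfl⟩
  rw [← ht0def, Set.mem_setOf_eq, hfat m] at ht0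
  have hregdef : regIdeal K p m = t0 + 1 := by
    unfold regIdeal; rw [← ht0def, add_comm]
  have ht0' : Module.finrank K (homComp K (⨅ i, ptIdeal (q i) (c i) ^ m i) t0) +
      ∑ i, (m i + N - 1).choose N = (t0 + N).choose N := by
    zify; linarith
  refine abstract_bounds N (symbPow K p m) (fatIdeal K p m) ?_ ?_ ?_ ?_ ?_ ?_ ?_ (regIdeal K p m) ?_ ?_
    (waldschmidt K p m) (resurgence K p m) rfl rfl
  · simp [symbPow]
  · intro k; rw [hsymb]; exact fat_homI q c _
  · intro a b
    rw [hsymb, hsymb, hsymb]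
    refine le_iInf fun i => ?_
    rw [add_mul, pow_add]
    exact Ideal.mul_mono (iInf_le _ i) (iInf_le _ i)
  · intro a b hab
    rw [hsymb, hsymb]
    exact iInf_mono fun i => Ideal.pow_le_pow_right (Nat.mul_le_mul_right _ hab)
  · intro k
    obtain ⟨t, ht⟩ := reg_exists q c hN hq hne (fun i => k * m i)
    rw [hsymb]
    exact ⟨t+1, (reg_facts q c hN hq hne _ t ht).1⟩
  · intro k
    obtain ⟨i, hi⟩ := hm
    rw [hsymb]
    refine (iInf_le _ i).trans ?_
    refine (Ideal.pow_right_mono (ptIdeal_le_irr (q i) (c i)) _).trans (Ideal.pow_le_pow_right ?_)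
    exact Nat.le_mul_of_pos_right k hi
  · intro a r hr har
    rw [hsymb, hfat]
    exact containment hN q c hq m a r hr har
  · rw [hregdef, hfat]
    exact alphaDeg_le (reg_facts q c hN hq hne m t0 ht0').1
  · intro r hr
    rw [hregdef, hsymb, hfat]
    exact symb_le q c hN hq hne m t0 ht0' r hr

end
end
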